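/- Let r = r(n) be an arbitrary sequence of integers with 1 ≤ r(n) ≤ n and, for each n, let X_1, …, X_{r+1} be independent random points chosen according to the Gaussian model, the Beta model with parameter ν > 0, or the spherical model in ℝ^n; set 𝓛_{n,r} := log(r! · 𝒱_{n,r}). Then (𝓛_{n,r} − E[𝓛_{n,r}])/√(Var 𝓛_{n,r}) converges in distribution, as n → ∞, to a standard Gaussian random variable. -/

import Mathlib

open MeasureTheory ProbabilityTheory Real Filter Finset

/-- The standard Gaussian measure on `ℝ^n`. -/
noncomputable def stdGaussian (n : ℕ) : Measure (EuclideanSpace ℝ (Fin n)) :=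
  volume.withDensity fun x =>
    ENNReal.ofReal ((2 * π) ^ (-(n : ℝ) / 2) * Real.exp (-‖x‖ ^ 2 / 2))

/-- The Beta model with parameter `ν` on `ℝ^n`. -/
noncomputable def betaModel (n : ℕ) (ν : ℝ) : Measure (EuclideanSpace ℝ (Fin n)) :=
  volume.withDensity fun x =>
    if ‖x‖ < 1 then
      ENNReal.ofReal (π ^ (-(n : ℝ) / 2) * Real.Gamma (((n : ℝ) + ν) / 2)
        / Real.Gamma (ν / 2) * (1 - ‖x‖ ^ 2) ^ ((ν - 2) / 2))
    else 0

/-- The uniform probability measure on the unit sphere `S^{n-1} ⊂ ℝ^n`. -/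
noncomputable def sphereUniform (n : ℕ) : Measure (EuclideanSpace ℝ (Fin n)) :=
  (μH[(n : ℝ) - 1] (Metric.sphere (0 : EuclideanSpace ℝ (Fin n)) 1))⁻¹ •
    (μH[(n : ℝ) - 1]).restrict (Metric.sphere (0 : EuclideanSpace ℝ (Fin n)) 1)

/-- The `r`-dimensional volume (Hausdorff measure) of the convex hull of the points
`X 0, …, X r` in `ℝ^n`. -/
noncomputable def simplexVol (n r : ℕ) (X : Fin (r + 1) → EuclideanSpace ℝ (Fin n)) : ℝ :=
  (μH[(r : ℝ)] (convexHull ℝ (Set.range X))).toReal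

/-- `𝓛_{n,r} = log (r! 𝒱_{n,r})`, the log-volume of the random simplex. -/
noncomputable def Lnr (n r : ℕ) (X : Fin (r + 1) → EuclideanSpace ℝ (Fin n)) : ℝ :=
  Real.log ((r.factorial : ℝ) * simplexVol n r X)

namespace RS

/-- square integrable law -/
def L2 (P : Measure ℝ) : Prop := MemLp (id : ℝ → ℝ) 2 P

noncomputable def mean (P : Measure ℝ) : ℝ := ∫ x, x ∂P

noncomputable def var (P : Measure ℝ) : ℝ := variance id P

/-- centred characteristic function -/
noncomputable def cc (P : Measure ℝ) (t : ℝ) : ℂ :=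
  charFun P t * Complex.exp (-(t * mean P : ℝ) * Complex.I)

lemma conv_L2 {P Q : Measure ℝ} [IsProbabilityMeasure P] [IsProbabilityMeasure Q]
    (hP : L2 P) (hQ : L2 Q) : L2 (P.conv Q) ∧ mean (P.conv Q) = mean P + mean Q ∧
      var (P.conv Q) = var P + var Q := by
  have h1 : MemLp (fun p : ℝ × ℝ => p.1) 2 (P.prod Q) := by
    simpa using hP.comp_fst Q
  have h2 : MemLp (fun p : ℝ × ℝ => p.2) 2 (P.prod Q) := by
    simpa using hQ.comp_snd P
  have hm : AEMeasurable (fun p : ℝ × ℝ => p.1 + p.2) (P.prod Q) := by fun_prop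
  refine ⟨?_, ?_, ?_⟩
  · unfold L2 Measure.conv
    rw [memLp_map_measure_iff (by fun_prop) hm]
    exact h1.add h2
  · unfold mean Measure.conv
    rw [integral_map hm (by fun_prop), integral_add (h1.integrable (by norm_num))
      (h2.integrable (by norm_num))]
    congr 1
    · have := integral_fun_fst (μ := P) (ν := Q) (fun x : ℝ => x)
      simpa using this
    · have := integral_fun_snd (μ := P) (ν := Q) (fun x : ℝ => x)
      simpa using this
  · unfold var Measure.conv
    rw [variance_id_map hm]
    have h := variance_add_prod (μ := P) (ν := Q) (X := fun x : ℝ => x) (Y := fun x : ℝ => x) hP hQ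
    exact h

lemma eq_conv_of_charFun {P Q M : Measure ℝ} [IsProbabilityMeasure P] [IsProbabilityMeasure Q]
    [IsProbabilityMeasure M] (h : ∀ t, charFun P t * charFun Q t = charFun M t) :
    M = P.conv Q := by
  apply Measure.ext_of_charFun
  ext t
  rw [charFun_conv, h]

lemma deconv_L2 {P Q : Measure ℝ} [IsProbabilityMeasure P] [IsProbabilityMeasure Q]
    (hQ : L2 Q) (hM : L2 (P.conv Q)) : L2 P := by
  have h2 : MemLp (fun p : ℝ × ℝ => p.2) 2 (P.prod Q) := by
    simpa using hQ.comp_snd P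
  have hm : AEMeasurable (fun p : ℝ × ℝ => p.1 + p.2) (P.prod Q) := by fun_prop
  unfold L2 Measure.conv at hM
  rw [memLp_map_measure_iff (by fun_prop) hm] at hM
  have h3 : MemLp (fun p : ℝ × ℝ => p.1) 2 (P.prod Q) := by
    have := hM.sub h2
    refine this.congr_norm (by fun_prop) ?_
    filter_upwards with p
    simp
  have h4 : MemLp (id : ℝ → ℝ) 2 ((P.prod Q).map Prod.fst) := by
    rw [memLp_map_measure_iff (by fun_prop) (by fun_prop)]
    exact h3
  have h5 : (P.prod Q).map Prod.fst = P := by simp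
  rwa [h5] at h4

lemma deconv {P Q M : Measure ℝ} [IsProbabilityMeasure P] [IsProbabilityMeasure Q]
    [IsProbabilityMeasure M] (h : ∀ t, charFun P t * charFun Q t = charFun M t)
    (hQ : L2 Q) (hM : L2 M) :
    L2 P ∧ mean M = mean P + mean Q ∧ var M = var P + var Q := by
  have h1 := eq_conv_of_charFun h
  subst h1
  have := deconv_L2 hQ hM
  exact ⟨this, (conv_L2 this hQ).2⟩

lemma cc_mul {P Q M : Measure ℝ} (h : ∀ t, charFun P t * charFun Q t = charFun M t)
    (hm : mean M = mean P + mean Q) (t : ℝ) : cc P t * cc Q t = cc M t := by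
  unfold cc
  rw [← h, hm]
  have : Complex.exp (-(t * (mean P + mean Q) : ℝ) * Complex.I) =
    Complex.exp (-(t * mean P : ℝ) * Complex.I) * Complex.exp (-(t * mean Q : ℝ) * Complex.I) := by
    rw [← Complex.exp_add]; congr 1; push_cast; ring
  rw [this]; ring

lemma cc_norm (P : Measure ℝ) [IsProbabilityMeasure P] (t : ℝ) : ‖cc P t‖ ≤ 1 := by
  unfold cc
  have h : ‖Complex.exp (-(t * mean P : ℝ) * Complex.I)‖ = 1 := by
    rw [← Complex.ofReal_neg, Complex.norm_exp_ofReal_mul_I]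
  rw [norm_mul, h, mul_one]
  exact norm_charFun_le_one t

lemma exp_bound (x : ℝ) : ‖Complex.exp (x * Complex.I) - 1 - x * Complex.I‖ ≤ 2 * x ^ 2 := by
  have h0 : ‖Complex.exp (x * Complex.I) - 1‖ ≤ |x| := by
    have := Real.norm_exp_I_mul_ofReal_sub_one_le (x := x)
    rw [mul_comm]; simpa using this
  by_cases hx : |x| ≤ 1
  · have := Complex.norm_exp_sub_one_sub_id_le (x := x * Complex.I) (by simpa using hx)
    have h2 : ‖Complex.exp (x * Complex.I) - 1 - x * Complex.I‖ ≤ x ^ 2 := by simpa using this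
    nlinarith [sq_nonneg x]
  · push Not at hx
    calc _ ≤ ‖Complex.exp (x * Complex.I) - 1‖ + ‖x * Complex.I‖ := norm_sub_le _ _
      _ ≤ |x| + |x| := by
        gcongr
        simp
      _ ≤ 2 * x ^ 2 := by rw [← sq_abs]; nlinarith

lemma cc_near_one {P : Measure ℝ} [IsProbabilityMeasure P] (hP : L2 P) (t : ℝ) :
    ‖cc P t - 1‖ ≤ 2 * t ^ 2 * var P := by
  have hIntg : Integrable (fun x : ℝ => x) P := hP.integrable (by norm_num)
  have h1 : cc P t = ∫ x, Complex.exp ((t * (x - mean P) : ℝ) * Complex.I) ∂P := by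
    unfold cc
    rw [charFun_apply_real, ← integral_mul_const]
    congr 1; ext x
    rw [← Complex.exp_add]; congr 1; push_cast; ring
  have hi1 : Integrable (fun x : ℝ => Complex.exp ((t * (x - mean P) : ℝ) * Complex.I)) P := by
    refine Integrable.mono' (integrable_const (1 : ℝ)) (by fun_prop) ?_
    filter_upwards with x
    rw [Complex.norm_exp_ofReal_mul_I]
  have hi2 : Integrable (fun x : ℝ => ((t * (x - mean P) : ℝ) : ℂ) * Complex.I) P := by
    apply Integrable.mul_const
    apply Integrable.ofReal
    apply Integrable.const_mul
    exact hIntg.sub (integrable_const _)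
  have h2 : ∫ x, ((t * (x - mean P) : ℝ) : ℂ) * Complex.I ∂P = 0 := by
    rw [integral_mul_const, integral_complex_ofReal, integral_const_mul, integral_sub hIntg (integrable_const _)]
    simp [mean]
  have h3 : cc P t - 1 = ∫ x, (Complex.exp ((t * (x - mean P) : ℝ) * Complex.I) - 1
      - ((t * (x - mean P) : ℝ) : ℂ) * Complex.I) ∂P := by
    have hi3 : Integrable (fun x : ℝ => Complex.exp ((t * (x - mean P) : ℝ) * Complex.I) - 1) P :=
      hi1.sub (integrable_const _)
    rw [integral_sub hi3 hi2, integral_sub hi1 (integrable_const _), h2, h1]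
    simp
  rw [h3]
  have hsq : Integrable (fun x : ℝ => (x - mean P) ^ 2) P := by
    have : MemLp (fun x : ℝ => x - mean P) 2 P := hP.sub (memLp_const _)
    exact this.integrable_sq
  calc _ ≤ ∫ x, 2 * t ^ 2 * (x - mean P) ^ 2 ∂P := by
        apply norm_integral_le_of_norm_le (hsq.const_mul _)
        filter_upwards with x
        have := exp_bound (t * (x - mean P))
        rwa [mul_pow, ← mul_assoc] at this
    _ = _ := by
      rw [integral_const_mul, var, variance_eq_integral (by fun_prop)]
      rfl

end RS

namespace RS

/-- `P` is close to Gaussian, up to convolution factors, with error `e`. -/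
def Good (P : Measure ℝ) (e : ℝ) : Prop :=
  ∃ α S B : Measure ℝ, IsProbabilityMeasure α ∧ IsProbabilityMeasure S ∧ IsProbabilityMeasure B ∧
    L2 α ∧ L2 S ∧ L2 B ∧ (∀ t, charFun P t * charFun α t = charFun S t * charFun B t) ∧
    0 < var S ∧ var α ≤ e * var S ∧ var B ≤ e * var S ∧
    ∀ t : ℝ, ‖cc S t - Complex.exp ((-(var S * t ^ 2 / 2) : ℝ))‖ ≤ e * (√(var S) * |t|) ^ 3

lemma var_nonneg (P : Measure ℝ) : 0 ≤ var P := variance_nonneg _ _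

lemma exp_neg_lip {x y : ℝ} (hx : 0 ≤ x) (hy : 0 ≤ y) : |rexp (-x) - rexp (-y)| ≤ |x - y| := by
  wlog h : x ≤ y generalizing x y
  · rw [abs_sub_comm, abs_sub_comm x]; exact this hy hx (by linarith)
  rw [abs_of_nonneg (by simpa using h), abs_of_nonpos (by linarith)]
  have h1 : rexp (-y) = rexp (-x) * rexp (-(y - x)) := by rw [← Real.exp_add]; congr 1; ring
  have h2 : 1 - (y - x) ≤ rexp (-(y - x)) := by have := Real.add_one_le_exp (-(y-x)); linarith
  have h3 : rexp (-x) ≤ 1 := by rw [Real.exp_le_one_iff]; linarith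
  have h4 : 0 < rexp (-x) := Real.exp_pos _
  rw [h1]
  nlinarith

lemma good_bound {P : Measure ℝ} [IsProbabilityMeasure P] {e : ℝ} (h : Good P e) (he : e ≤ 1 / 2) :
    L2 P ∧ 0 < var P ∧ ∀ t : ℝ, ‖cc P (t / √(var P)) - Complex.exp ((-(t ^ 2 / 2) : ℝ))‖
      ≤ 9 * e * t ^ 2 + 8 * e * |t| ^ 3 := by
  obtain ⟨α, S, B, i1, i2, i3, hα, hS, hB, hc, hv, ha, hb, hn⟩ := h
  have hSB := conv_L2 hS hB
  have hc' : ∀ t, charFun P t * charFun α t = charFun (S.conv B) t := by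
    intro t; rw [charFun_conv, hc]
  obtain ⟨hP, hm, hvar⟩ := deconv hc' hα hSB.1
  have he0 : 0 ≤ e := by
    have := var_nonneg α
    by_contra h0
    push Not at h0
    nlinarith
  rw [hSB.2.2] at hvar
  have hvα := var_nonneg α
  have hvB := var_nonneg B
  have hlow : var S / 2 ≤ var P := by nlinarith
  have hPpos : 0 < var P := by linarith
  refine ⟨hP, hPpos, fun t => ?_⟩
  set u := t / √(var P) with hu
  have hu2 : u ^ 2 = t ^ 2 / var P := by rw [hu, div_pow, Real.sq_sqrt hPpos.le]
  have huv : u ^ 2 * var S ≤ 2 * t ^ 2 := by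
    rw [hu2, div_mul_eq_mul_div, div_le_iff₀ hPpos]
    nlinarith [sq_nonneg t]
  have hid : cc P u * cc α u = cc S u * cc B u := by
    rw [cc_mul hc' hm, cc_mul (M := S.conv B) (fun t => (charFun_conv (μ := S) (ν := B) t).symm) hSB.2.1]
  have h1 : ‖cc P u - cc S u‖ ≤ 8 * e * t ^ 2 := by
    have e1 : cc P u - cc S u = cc S u * (cc B u - 1) - cc P u * (cc α u - 1) := by
      linear_combination hid
    rw [e1]
    have nα := cc_near_one hα u
    have nB := cc_near_one hB u
    calc _ ≤ ‖cc S u‖ * ‖cc B u - 1‖ + ‖cc P u‖ * ‖cc α u - 1‖ := by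
          refine (norm_sub_le _ _).trans ?_
          rw [norm_mul, norm_mul]
      _ ≤ 1 * (2 * u ^ 2 * var B) + 1 * (2 * u ^ 2 * var α) := by
          gcongr
          · exact cc_norm S u
          · exact cc_norm P u
      _ ≤ 1 * (2 * u ^ 2 * (e * var S)) + 1 * (2 * u ^ 2 * (e * var S)) := by gcongr
      _ = 4 * e * (u ^ 2 * var S) := by ring
      _ ≤ 4 * e * (2 * t ^ 2) := by gcongr
      _ = _ := by ring
  have h2 : ‖cc S u - Complex.exp ((-(var S * u ^ 2 / 2) : ℝ))‖ ≤ 8 * e * |t| ^ 3 := by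
    refine (hn u).trans ?_
    have : √(var S) * |u| ≤ 2 * |t| := by
      apply abs_le_of_sq_le_sq' _ (by positivity) |>.2
      rw [mul_pow, Real.sq_sqrt hv.le, sq_abs, mul_pow, sq_abs]
      nlinarith [sq_nonneg t]
    calc e * (√(var S) * |u|) ^ 3 ≤ e * (2 * |t|) ^ 3 := by gcongr
      _ = _ := by ring
  have h3 : ‖Complex.exp ((-(var S * u ^ 2 / 2) : ℝ)) - Complex.exp ((-(t ^ 2 / 2) : ℝ))‖
      ≤ e * t ^ 2 := by
    rw [← Complex.ofReal_exp, ← Complex.ofReal_exp, ← Complex.ofReal_sub, Complex.norm_real,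
      Real.norm_eq_abs]
    refine (exp_neg_lip (by positivity) (by positivity)).trans ?_
    have : var S * u ^ 2 / 2 - t ^ 2 / 2 = u ^ 2 / 2 * (var S - var P) := by
      rw [hu2]; field_simp
    rw [this, abs_mul, abs_of_nonneg (by positivity)]
    have h4 : |var S - var P| ≤ e * var S := by
      rw [abs_le]; constructor <;> linarith
    calc u ^ 2 / 2 * |var S - var P| ≤ u ^ 2 / 2 * (e * var S) := by gcongr
      _ = e / 2 * (u ^ 2 * var S) := by ring
      _ ≤ e / 2 * (2 * t ^ 2) := by gcongr
      _ = _ := by ring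
  have := norm_add_le (cc P u - cc S u) (cc S u - Complex.exp ((-(var S * u ^ 2 / 2) : ℝ)))
  have := norm_add_le (cc P u - cc S u + (cc S u - Complex.exp ((-(var S * u ^ 2 / 2) : ℝ))))
    (Complex.exp ((-(var S * u ^ 2 / 2) : ℝ)) - Complex.exp ((-(t ^ 2 / 2) : ℝ)))
  have e2 : cc P u - Complex.exp ((-(t ^ 2 / 2) : ℝ)) = cc P u - cc S u
    + (cc S u - Complex.exp ((-(var S * u ^ 2 / 2) : ℝ))) +
    (Complex.exp ((-(var S * u ^ 2 / 2) : ℝ)) - Complex.exp ((-(t ^ 2 / 2) : ℝ))) := by ring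
  rw [e2]
  linarith

lemma charFun_std (P : Measure ℝ) (t c : ℝ) :
    charFun (P.map (fun x => (x - mean P) / c)) t = cc P (t / c) := by
  have : P.map (fun x => (x - mean P) / c) = (P.map (fun x => c⁻¹ * x)).map (fun x => x + - mean P / c) := by
    rw [Measure.map_map (by fun_prop) (by fun_prop)]
    congr 1; ext x; simp only [Function.comp]; ring
  rw [this]
  rw [charFun_map_add_const, charFun_map_mul]
  unfold cc
  congr 2
  · ring
  · rw [RCLike.inner_apply]; simp; ring

theorem clt (P : ℕ → Measure ℝ) [∀ n, IsProbabilityMeasure (P n)] (e : ℕ → ℝ)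
    (he : Tendsto e atTop (nhds 0)) (h : ∀ n, Good (P n) (e n)) (f : BoundedContinuousFunction ℝ ℝ) :
    Tendsto (fun n => ∫ x, f ((x - mean (P n)) / √(var (P n))) ∂(P n)) atTop
      (nhds (∫ z, f z ∂gaussianReal 0 1)) := by
  have hmeas : ∀ n, Measurable (fun x => (x - mean (P n)) / √(var (P n))) := fun n => by fun_prop
  let Z : ℕ → ProbabilityMeasure ℝ := fun n => ⟨(P n).map (fun x => (x - mean (P n)) / √(var (P n))),
    Measure.isProbabilityMeasure_map (hmeas n).aemeasurable⟩
  let G : ProbabilityMeasure ℝ := ⟨gaussianReal 0 1, inferInstance⟩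
  have hZ : Tendsto Z atTop (nhds G) := by
    rw [ProbabilityMeasure.tendsto_iff_tendsto_charFun]
    intro t
    show Tendsto (fun n => charFun ((P n).map (fun x => (x - mean (P n)) / √(var (P n)))) t) atTop
      (nhds (charFun (gaussianReal 0 1) t))
    simp_rw [charFun_std]
    have hg : charFun (gaussianReal 0 1) t = Complex.exp ((-(t ^ 2 / 2) : ℝ)) := by
      rw [charFun_gaussianReal]; congr 1; push_cast; simp
    rw [hg, tendsto_iff_norm_sub_tendsto_zero]
    have hb : Tendsto (fun n => 9 * e n * t ^ 2 + 8 * e n * |t| ^ 3) atTop (nhds 0) := by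
      have := (((he.const_mul 9).mul_const (t ^ 2)).add ((he.const_mul 8).mul_const (|t| ^ 3)))
      simpa using this
    have hev : ∀ᶠ n in atTop, e n ≤ 1 / 2 := he.eventually_le_const (by norm_num)
    refine squeeze_zero' (Eventually.of_forall fun n => norm_nonneg _) ?_ hb
    filter_upwards [hev] with n hn
    exact (good_bound (h n) hn).2.2 t
  have := (ProbabilityMeasure.tendsto_iff_forall_integral_tendsto.mp hZ) f
  refine this.congr fun n => ?_
  show ∫ x, f x ∂((P n).map _) = _
  rw [integral_map (hmeas n).aemeasurable (by fun_prop)]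

end RS

namespace RS

/-- law of the logarithm of a Gamma variable -/
noncomputable def lg (a : ℝ) : Measure ℝ := (gammaMeasure a 1).map Real.log

/-- law of the logarithm of a Beta variable -/
noncomputable def lb (a b : ℝ) : Measure ℝ := (betaMeasure a b).map Real.log

lemma lg_prob {a : ℝ} (ha : 0 < a) : IsProbabilityMeasure (lg a) := by
  have := isProbabilityMeasure_gammaMeasure ha one_pos
  exact Measure.isProbabilityMeasure_map (by fun_prop)

lemma lb_prob {a b : ℝ} (ha : 0 < a) (hb : 0 < b) : IsProbabilityMeasure (lb a b) := by
  have := isProbabilityMeasureBeta ha hb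
  exact Measure.isProbabilityMeasure_map (by fun_prop)

lemma gamma_integral {a : ℝ} (ha : 0 < a) (g : ℝ → ℂ) :
    ∫ x, g x ∂(gammaMeasure a 1) =
      ∫ x in Set.Ioi (0 : ℝ), (((1 / Real.Gamma a) * (x ^ (a - 1) * rexp (-x)) : ℝ) : ℂ) * g x := by
  unfold gammaMeasure
  rw [integral_withDensity_eq_integral_toReal_smul (by unfold gammaPDF; fun_prop)
    (by filter_upwards with x; simp [gammaPDF])]
  rw [← integral_Ici_eq_integral_Ioi, ← integral_indicator measurableSet_Ici]
  congr 1; ext x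
  by_cases hx : 0 ≤ x
  · rw [Set.indicator_of_mem (Set.mem_Ici.2 hx), gammaPDF_of_nonneg hx, ENNReal.toReal_ofReal]
    · rw [Complex.real_smul]; congr 1; norm_num; ring
    · have := Real.Gamma_pos_of_pos ha
      positivity
  · rw [Set.indicator_of_notMem (by simpa using hx), gammaPDF_of_neg (by linarith)]
    simp

lemma beta_integral {a b : ℝ} (ha : 0 < a) (hb : 0 < b) (g : ℝ → ℂ) :
    ∫ x, g x ∂(betaMeasure a b) =
      ∫ x in (0 : ℝ)..1, (((1 / beta a b) * (x ^ (a - 1) * (1 - x) ^ (b - 1)) : ℝ) : ℂ) * g x := by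
  unfold betaMeasure
  rw [integral_withDensity_eq_integral_toReal_smul (by unfold betaPDF; fun_prop)
    (by filter_upwards with x; simp [betaPDF])]
  rw [intervalIntegral.integral_of_le zero_le_one, integral_Ioc_eq_integral_Ioo,
    ← integral_indicator measurableSet_Ioo]
  congr 1; ext x
  by_cases hx : 0 < x ∧ x < 1
  · rw [Set.indicator_of_mem (by exact hx), betaPDF_of_pos_lt_one hx.1 hx.2, ENNReal.toReal_ofReal]
    · rw [Complex.real_smul]; congr 1; norm_num; ring
    · have := beta_pos ha hb
      have : 0 < 1 - x := by linarith
      have := hx.1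
      positivity
  · rw [Set.indicator_of_notMem (by exact hx)]
    simp [betaPDF_eq, hx]

lemma exp_log_mul {x : ℝ} (hx : 0 < x) (t : ℝ) :
    Complex.exp (t * Real.log x * Complex.I) = (x : ℂ) ^ ((t : ℂ) * Complex.I) := by
  rw [Complex.cpow_def_of_ne_zero (by exact_mod_cast hx.ne'), ← Complex.ofReal_log hx.le]
  congr 1; ring

lemma charFun_lg {a : ℝ} (ha : 0 < a) (t : ℝ) :
    charFun (lg a) t = Complex.Gamma (a + t * Complex.I) / Complex.Gamma a := by
  rw [charFun_apply_real, lg, integral_map (by fun_prop) (by fun_prop), gamma_integral ha]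
  rw [Complex.Gamma_eq_integral (s := a + t * Complex.I) (by simpa using ha), Complex.GammaIntegral,
    div_eq_inv_mul (b := Complex.Gamma a), ← integral_const_mul]
  apply setIntegral_congr_fun measurableSet_Ioi
  intro x hx
  have hx : 0 < x := hx
  simp only
  rw [exp_log_mul hx]
  push_cast
  rw [Complex.ofReal_cpow hx.le, Complex.Gamma_ofReal,
    show (a + t * Complex.I - 1 : ℂ) = ((a - 1 : ℝ) : ℂ) + t * Complex.I by push_cast; ring,
    Complex.cpow_add _ _ (by exact_mod_cast hx.ne')]
  push_cast
  ring

/-- joint law of logs of a Beta variable -/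
lemma beta_joint {a b : ℝ} (ha : 0 < a) (hb : 0 < b) (u v : ℝ) :
    ∫ x, Complex.exp ((u * Real.log x + v * Real.log (1 - x) : ℝ) * Complex.I) ∂(betaMeasure a b) =
      Complex.Gamma (a + u * Complex.I) * Complex.Gamma (b + v * Complex.I)
        / Complex.Gamma (a + b + (u + v) * Complex.I) *
      (Complex.Gamma (a + b) / (Complex.Gamma a * Complex.Gamma b)) := by
  rw [beta_integral ha hb]
  have h2 : Complex.Gamma (a + u * Complex.I) * Complex.Gamma (b + v * Complex.I)
        / Complex.Gamma (a + b + (u + v) * Complex.I) =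
      Complex.betaIntegral (a + u * Complex.I) (b + v * Complex.I) := by
    rw [Complex.Gamma_mul_Gamma_eq_betaIntegral (by simpa using ha) (by simpa using hb)]
    have : (a + u * Complex.I + (b + v * Complex.I) : ℂ) = a + b + (u + v) * Complex.I := by ring
    rw [this, mul_div_cancel_left₀]
    apply Complex.Gamma_ne_zero_of_re_pos
    simp; linarith
  rw [h2, Complex.betaIntegral, mul_comm, ← intervalIntegral.integral_const_mul]
  rw [intervalIntegral.integral_of_le zero_le_one, intervalIntegral.integral_of_le zero_le_one,
    integral_Ioc_eq_integral_Ioo, integral_Ioc_eq_integral_Ioo]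
  apply setIntegral_congr_fun measurableSet_Ioo
  intro x hx
  have hx0 : 0 < x := hx.1
  have hx1 : 0 < 1 - x := by linarith [hx.2]
  simp only
  have e1 : Complex.exp ((u * Real.log x + v * Real.log (1 - x) : ℝ) * Complex.I) =
    (x : ℂ) ^ ((u : ℂ) * Complex.I) * ((1 - x : ℝ) : ℂ) ^ ((v : ℂ) * Complex.I) := by
    rw [← exp_log_mul hx0, ← exp_log_mul hx1, ← Complex.exp_add]; congr 1; push_cast; ring
  rw [e1]
  have e2 : (x : ℂ) ^ (a + u * Complex.I - 1) = ((x ^ (a - 1) : ℝ) : ℂ) * (x : ℂ) ^ ((u : ℂ) * Complex.I) := by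
    rw [Complex.ofReal_cpow hx0.le, ← Complex.cpow_add _ _ (by exact_mod_cast hx0.ne')]
    congr 1; push_cast; ring
  have e3 : (1 - x : ℂ) ^ (b + v * Complex.I - 1) = (((1 - x) ^ (b - 1) : ℝ) : ℂ) *
      ((1 - x : ℝ) : ℂ) ^ ((v : ℂ) * Complex.I) := by
    rw [Complex.ofReal_cpow hx1.le, ← Complex.cpow_add _ _ (by exact_mod_cast hx1.ne')]
    congr 1
    · push_cast; ring
    · push_cast; ring
  rw [e2, e3, beta]
  push_cast
  rw [← Complex.Gamma_ofReal, ← Complex.Gamma_ofReal, ← Complex.Gamma_ofReal]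
  push_cast
  field_simp

lemma Gamma_ne {a : ℝ} (ha : 0 < a) (t : ℝ) : Complex.Gamma (a + t * Complex.I) ≠ 0 := by
  apply Complex.Gamma_ne_zero_of_re_pos; simpa using ha

lemma Gamma_ne' {a : ℝ} (ha : 0 < a) : Complex.Gamma a ≠ 0 := by
  apply Complex.Gamma_ne_zero_of_re_pos; simpa using ha

lemma charFun_lg_ne {a : ℝ} (ha : 0 < a) (t : ℝ) : charFun (lg a) t ≠ 0 := by
  rw [charFun_lg ha]; exact div_ne_zero (Gamma_ne ha t) (Gamma_ne' ha)

/-- in terms of log-gamma characteristic functions -/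
lemma beta_joint' {a b : ℝ} (ha : 0 < a) (hb : 0 < b) (u v : ℝ) :
    (∫ x, Complex.exp ((u * Real.log x + v * Real.log (1 - x) : ℝ) * Complex.I) ∂(betaMeasure a b))
      * charFun (lg (a + b)) (u + v) = charFun (lg a) u * charFun (lg b) v := by
  rw [beta_joint ha hb, charFun_lg ha, charFun_lg hb, charFun_lg (add_pos ha hb)]
  have h1 := Gamma_ne (add_pos ha hb) (u + v)
  have h2 := Gamma_ne' (add_pos ha hb)
  have h3 := Gamma_ne' ha
  have h4 := Gamma_ne' hb
  push_cast at *
  generalize Complex.Gamma (a + b + (u + v) * Complex.I) = z1 at *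
  generalize Complex.Gamma (a + u * Complex.I) = z2 at *
  generalize Complex.Gamma (b + v * Complex.I) = z3 at *
  field_simp

lemma charFun_lb {a b : ℝ} (ha : 0 < a) (hb : 0 < b) (t : ℝ) :
    charFun (lb a b) t * charFun (lg (a + b)) t = charFun (lg a) t := by
  have := beta_joint' ha hb t 0
  have h0 : charFun (lg b) 0 = 1 := by have := lg_prob hb; simp
  rw [h0, mul_one, add_zero] at this
  rw [← this, charFun_apply_real, lb, integral_map (by fun_prop) (by fun_prop)]
  congr 2; ext x; simp

lemma lg_L2 {a : ℝ} (ha : 0 < a) : L2 (lg a) := by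
  unfold L2 lg
  rw [memLp_map_measure_iff (by fun_prop) (by fun_prop)]
  show MemLp Real.log 2 _
  have : (0 : ℝ) ∈ interior (integrableExpSet Real.log (gammaMeasure a 1)) := by
    rw [mem_interior]
    refine ⟨Set.Ioi (-a), ?_, isOpen_Ioi, by simpa using ha⟩
    intro s hs
    have hs : -a < s := hs
    show Integrable _ _
    unfold gammaMeasure
    rw [integrable_withDensity_iff (by unfold gammaPDF; fun_prop)
      (by filter_upwards with x; simp [gammaPDF])]
    have h1 := Real.GammaIntegral_convergent (s := a + s) (by linarith)
    have h2 : IntegrableOn (fun x => rexp (s * Real.log x) * (gammaPDF a 1 x).toReal) (Set.Ioi 0) := by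
      refine (h1.const_mul (1 / Real.Gamma a)).congr ?_
      rw [EventuallyEq, ae_restrict_iff' measurableSet_Ioi]
      filter_upwards with x hx
      have hx : 0 < x := hx
      have := Real.Gamma_pos_of_pos ha
      rw [gammaPDF_of_nonneg hx.le, ENNReal.toReal_ofReal (by positivity)]
      rw [show a + s - 1 = s + (a - 1) by ring, Real.rpow_add hx, mul_comm s, ← Real.rpow_def_of_pos hx]
      simp; ring
    have h3 : IntegrableOn (fun x => rexp (s * Real.log x) * (gammaPDF a 1 x).toReal) (Set.Iio 0) := by
      refine (integrableOn_zero).congr_fun (fun x hx => ?_) measurableSet_Iio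
      rw [gammaPDF_of_neg hx]; simp
    have h4 := h3.union ((integrableOn_Ici_iff_integrableOn_Ioi).2 h2)
    rwa [Set.Iio_union_Ici, integrableOn_univ] at h4
  exact memLp_of_mem_interior_integrableExpSet this 2

end RS

namespace RS

/-- variance of log-gamma -/
noncomputable def psi1 (a : ℝ) : ℝ := var (lg a)

lemma lb_L2 {a b : ℝ} (ha : 0 < a) (hb : 0 < b) : L2 (lb a b) ∧
    mean (lg a) = mean (lb a b) + mean (lg (a + b)) ∧ psi1 a = var (lb a b) + psi1 (a + b) := by
  have := lb_prob ha hb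
  have := lg_prob ha
  have := lg_prob (add_pos ha hb)
  exact deconv (charFun_lb ha hb) (lg_L2 (add_pos ha hb)) (lg_L2 ha)

lemma one_add_ne (x : ℝ) : (1 + x * Complex.I : ℂ) ≠ 0 := by
  intro h
  have := congrArg Complex.re h
  simp at this

lemma charFun_lg_succ {a : ℝ} (ha : 0 < a) (t : ℝ) :
    charFun (lg (a + 1)) t = charFun (lg a) t * (1 + (t / a : ℝ) * Complex.I) := by
  rw [charFun_lg ha, charFun_lg (by linarith)]
  have h1 : Complex.Gamma ((a + 1 : ℝ) + t * Complex.I) = (a + t * Complex.I) * Complex.Gamma (a + t * Complex.I) := by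
    rw [← Complex.Gamma_add_one]
    · congr 1; push_cast; ring
    · intro h
      have := congrArg Complex.re h
      simp at this; linarith
  have h2 : Complex.Gamma ((a + 1 : ℝ)) = a * Complex.Gamma a := by
    rw [← Complex.Gamma_add_one]
    · congr 1; push_cast; ring
    · exact_mod_cast ha.ne'
  rw [h1, h2]
  have := Gamma_ne' ha
  have : (a : ℂ) ≠ 0 := by exact_mod_cast ha.ne'
  push_cast
  field_simp

lemma charFun_lb_one {a : ℝ} (ha : 0 < a) (t : ℝ) :
    charFun (lb a 1) t = 1 / (1 + (t / a : ℝ) * Complex.I) := by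
  have h := charFun_lb ha one_pos t
  rw [charFun_lg_succ ha, ← mul_assoc, mul_right_comm] at h
  have h2 := charFun_lg_ne ha t
  rw [eq_div_iff (one_add_ne _)]
  apply mul_right_cancel₀ h2
  rw [h, one_mul]

lemma charFun_gamma_one (t : ℝ) :
    charFun (gammaMeasure 1 1) t = 1 / (1 + (-t : ℝ) * Complex.I) := by
  rw [charFun_apply_real, gamma_integral one_pos]
  have h1 : ∫ x in Set.Ioi (0 : ℝ), Complex.exp ((-(1 + (-t : ℝ) * Complex.I)) * x) =
      1 / (1 + (-t : ℝ) * Complex.I) := by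
    rw [integral_exp_mul_complex_Ioi (by simp)]
    simp only [Complex.ofReal_zero, mul_zero, Complex.exp_zero]
    rw [neg_div_neg_eq]
  rw [← h1]
  apply setIntegral_congr_fun measurableSet_Ioi
  intro x hx
  simp only [Real.Gamma_one, sub_self, Real.rpow_zero, one_mul, div_one]
  rw [Complex.ofReal_exp, ← Complex.exp_add]; congr 1; push_cast; ring

lemma gamma_one_moment (k : ℕ) : Integrable (fun x : ℝ => x ^ k) (gammaMeasure 1 1) ∧
    ∫ x, x ^ k ∂(gammaMeasure 1 1) = k.factorial := by
  have h0 : Real.Gamma (k + 1) = k.factorial := Real.Gamma_nat_eq_factorial k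
  constructor
  · unfold gammaMeasure
    rw [integrable_withDensity_iff (by unfold gammaPDF; fun_prop)
      (by filter_upwards with x; simp [gammaPDF])]
    have h1 := Real.GammaIntegral_convergent (s := k + 1) (by positivity)
    have h2 : IntegrableOn (fun x : ℝ => x ^ k * (gammaPDF 1 1 x).toReal) (Set.Ioi 0) := by
      refine h1.congr_fun (fun x hx => ?_) measurableSet_Ioi
      have hx : 0 < x := hx
      simp only
      rw [gammaPDF_of_nonneg hx.le, ENNReal.toReal_ofReal (by positivity)]
      simp; ring
    have h3 : IntegrableOn (fun x : ℝ => x ^ k * (gammaPDF 1 1 x).toReal) (Set.Iio 0) := by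
      refine (integrableOn_zero).congr_fun (fun x hx => ?_) measurableSet_Iio
      rw [gammaPDF_of_neg hx]; simp
    have h4 := h3.union ((integrableOn_Ici_iff_integrableOn_Ioi).2 h2)
    rwa [Set.Iio_union_Ici, integrableOn_univ] at h4
  · have h5 : ((∫ x, x ^ k ∂(gammaMeasure 1 1) : ℝ) : ℂ) = (k.factorial : ℝ) := by
      rw [← integral_complex_ofReal, gamma_integral one_pos, ← h0, Real.Gamma_eq_integral (s := k + 1) (by positivity),
        ← integral_complex_ofReal]
      apply setIntegral_congr_fun measurableSet_Ioi
      intro x hx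
      simp
    exact_mod_cast h5

lemma gamma_one_stats : L2 (gammaMeasure 1 1) ∧ mean (gammaMeasure 1 1) = 1 ∧ var (gammaMeasure 1 1) = 1 := by
  have := isProbabilityMeasure_gammaMeasure one_pos one_pos
  have h1 := (gamma_one_moment 1).2
  have h2 := gamma_one_moment 2
  have hL : L2 (gammaMeasure 1 1) := by
    unfold L2
    rw [memLp_two_iff_integrable_sq (by fun_prop)]
    simpa using h2.1
  refine ⟨hL, ?_, ?_⟩
  · simpa [mean] using h1
  · rw [var, variance_eq_sub hL]
    have h3 : ∫ x, (id x : ℝ) ∂(gammaMeasure 1 1) = 1 := by simpa using h1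
    have h4 : ∫ x, (id ^ 2 : ℝ → ℝ) x ∂(gammaMeasure 1 1) = 2 := by simpa using h2.2
    rw [h3, h4]; norm_num

/-- scaling of laws -/
lemma scale_stats {P : Measure ℝ} (u : ℝ) (hP : L2 P) :
    L2 (P.map (fun x => u * x)) ∧ mean (P.map (fun x => u * x)) = u * mean P ∧
      var (P.map (fun x => u * x)) = u ^ 2 * var P ∧
      ∀ t, cc (P.map (fun x => u * x)) t = cc P (u * t) := by
  have hm : mean (P.map (fun x => u * x)) = u * mean P := by
    unfold mean
    rw [integral_map (by fun_prop) (by fun_prop), integral_const_mul]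
  refine ⟨?_, hm, ?_, ?_⟩
  · unfold L2
    rw [memLp_map_measure_iff (by fun_prop) (by fun_prop)]
    exact hP.const_mul u
  · unfold var
    rw [variance_id_map (by fun_prop)]
    exact variance_const_mul u id P
  · intro t
    unfold cc
    rw [hm, charFun_map_mul]
    congr 2
    push_cast; ring

lemma lb_one_stats {a : ℝ} (ha : 0 < a) : mean (lb a 1) = -(1 / a) ∧ var (lb a 1) = 1 / a ^ 2 := by
  have := isProbabilityMeasure_gammaMeasure one_pos one_pos
  have := lb_prob ha one_pos
  obtain ⟨hL, hm, hv⟩ := gamma_one_stats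
  have h : lb a 1 = (gammaMeasure 1 1).map (fun x => (-(1 / a)) * x) := by
    have : IsProbabilityMeasure ((gammaMeasure 1 1).map (fun x => (-(1 / a)) * x)) :=
      Measure.isProbabilityMeasure_map (by fun_prop)
    apply Measure.ext_of_charFun
    ext t
    rw [charFun_lb_one ha, charFun_map_mul, charFun_gamma_one]
    congr 4; ring
  obtain ⟨-, h1, h2, -⟩ := scale_stats (-(1 / a)) hL
  rw [h, h1, h2, hm, hv]
  constructor <;> ring

lemma psi1_succ {a : ℝ} (ha : 0 < a) : psi1 a = 1 / a ^ 2 + psi1 (a + 1) := by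
  rw [(lb_L2 ha one_pos).2.2, (lb_one_stats ha).2]

lemma psi1_nonneg (a : ℝ) : 0 ≤ psi1 a := var_nonneg _

lemma psi1_anti {a b : ℝ} (ha : 0 < a) (h : a ≤ b) : psi1 b ≤ psi1 a := by
  rcases h.eq_or_lt with h | h
  · rw [h]
  · have h1 := (lb_L2 ha (sub_pos.2 h)).2.2
    rw [add_sub_cancel] at h1
    linarith [var_nonneg (lb a (b - a))]

lemma psi1_double {a : ℝ} (ha : 0 < a) : 4 * psi1 (2 * a) = psi1 a + psi1 (a + 1 / 2) := by
  have := lg_prob ha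
  have := lg_prob (show 0 < a + 1 / 2 by linarith)
  have := lg_prob (show 0 < 2 * a by linarith)
  have h2 := lg_L2 (show 0 < 2 * a by linarith)
  have hc := conv_L2 (lg_L2 ha) (lg_L2 (show 0 < a + 1 / 2 by linarith))
  have key : (lg a).conv (lg (a + 1 / 2)) =
      ((lg (2 * a)).map (fun x => 2 * x)).map (fun x => x + (-2 * Real.log 2)) := by
    have i1 : IsProbabilityMeasure ((lg (2 * a)).map (fun x => 2 * x)) :=
      Measure.isProbabilityMeasure_map (by fun_prop)
    have : IsProbabilityMeasure (((lg (2 * a)).map (fun x => 2 * x)).map (fun x => x + (-2 * Real.log 2))) :=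
      Measure.isProbabilityMeasure_map (by fun_prop)
    apply Measure.ext_of_charFun
    ext t
    rw [charFun_conv, charFun_map_add_const, charFun_map_mul, charFun_lg ha,
      charFun_lg (show 0 < a + 1 / 2 by linarith), charFun_lg (show 0 < 2 * a by linarith)]
    have d1 := Complex.Gamma_mul_Gamma_add_half (a + t * Complex.I)
    have d2 := Complex.Gamma_mul_Gamma_add_half a
    have n1 := Gamma_ne' ha
    have n2 := Gamma_ne' (show 0 < a + 1 / 2 by linarith)
    have n3 := Gamma_ne' (show 0 < 2 * a by linarith)
    have e1 : ((a + 1 / 2 : ℝ) + t * Complex.I : ℂ) = a + t * Complex.I + 1 / 2 := by push_cast; ring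
    have e2 : ((a + 1 / 2 : ℝ) : ℂ) = a + 1 / 2 := by push_cast; ring
    have e3 : ((2 * a : ℝ) + (2 * t : ℝ) * Complex.I : ℂ) = 2 * (a + t * Complex.I) := by push_cast; ring
    have e4 : ((2 * a : ℝ) : ℂ) = 2 * a := by push_cast; ring
    rw [e1, e3, div_mul_div_comm, d1, e2, d2, e4]
    rw [e4] at n3
    have e5 : (2 : ℂ) ^ (1 - 2 * (a + t * Complex.I)) = (2 : ℂ) ^ (1 - 2 * (a : ℂ)) *
        Complex.exp (inner ℝ (-2 * Real.log 2) t * Complex.I) := by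
      rw [Complex.cpow_def_of_ne_zero two_ne_zero, Complex.cpow_def_of_ne_zero two_ne_zero, ← Complex.exp_add]
      congr 1
      simp
      rw [show Complex.log 2 = (Real.log 2 : ℝ) by rw [Complex.ofReal_log (by norm_num)]; norm_num]
      ring
    rw [e5]
    have n4 : (2 : ℂ) ^ (1 - 2 * (a : ℂ)) ≠ 0 := by simp [Complex.cpow_eq_zero_iff]
    have n5 : ((√π : ℝ) : ℂ) ≠ 0 := by
      have : (√π) ≠ 0 := by positivity
      exact_mod_cast this
    field_simp
  have h3 : var ((lg a).conv (lg (a + 1 / 2))) = 4 * psi1 (2 * a) := by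
    rw [key]
    have i1 : IsProbabilityMeasure ((lg (2 * a)).map (fun x => 2 * x)) :=
      Measure.isProbabilityMeasure_map (by fun_prop)
    have : var (((lg (2 * a)).map (fun x => 2 * x)).map (fun x => x + (-2 * Real.log 2))) =
        var ((lg (2 * a)).map (fun x => 2 * x)) := by
      unfold var
      rw [variance_id_map (by fun_prop)]
      exact variance_add_const (X := id) (by fun_prop) _
    rw [this, (scale_stats 2 h2).2.2.1, psi1]; norm_num
  rw [← h3, hc.2.2]; rfl

lemma psi1_tendsto : Tendsto psi1 atTop (nhds 0) := by
  have h1 : ∀ k : ℕ, psi1 (2 ^ k) ≤ psi1 1 / 2 ^ k := by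
    intro k
    induction k with
    | zero => simp
    | succ k ih =>
      have hp : (0 : ℝ) < 2 ^ k := by positivity
      have := psi1_double hp
      have h2 := psi1_anti hp (show (2 : ℝ) ^ k ≤ 2 ^ k + 1 / 2 by linarith)
      rw [pow_succ, mul_comm ((2 : ℝ) ^ k)]
      have h3 : psi1 1 / (2 * 2 ^ k) = (psi1 1 / 2 ^ k) / 2 := by field_simp
      rw [h3]
      linarith
  rw [Metric.tendsto_atTop]
  intro ε hε
  have h2 : Tendsto (fun k : ℕ => psi1 1 / 2 ^ k) atTop (nhds 0) := by
    have := (tendsto_pow_atTop_nhds_zero_of_lt_one (r := (1 / 2 : ℝ)) (by norm_num) (by norm_num)).const_mul (psi1 1)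
    simpa [div_eq_mul_inv] using this
  obtain ⟨k, hk⟩ := (h2.eventually_lt_const hε).exists
  refine ⟨2 ^ k, fun a ha => ?_⟩
  rw [Real.dist_eq, sub_zero, abs_of_nonneg (psi1_nonneg a)]
  have := psi1_anti (show (0 : ℝ) < 2 ^ k by positivity) ha
  linarith [h1 k]

end RS

namespace RS

lemma psi1_sum {a : ℝ} (ha : 0 < a) (K : ℕ) :
    psi1 a = ∑ k ∈ range K, 1 / (a + k) ^ 2 + psi1 (a + K) := by
  induction K with
  | zero => simp
  | succ K ih =>
    rw [ih, sum_range_succ, psi1_succ (a := a + K) (by positivity)]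
    push_cast; rw [add_assoc, add_assoc]

lemma psi1_tendsto_nat (a : ℝ) : Tendsto (fun K : ℕ => psi1 (a + K)) atTop (nhds 0) :=
  psi1_tendsto.comp (tendsto_atTop_add_const_left _ _ tendsto_natCast_atTop_atTop)

lemma inv_tendsto_nat (a : ℝ) : Tendsto (fun K : ℕ => 1 / (a + K)) atTop (nhds 0) := by
  have := (tendsto_atTop_add_const_left atTop a (tendsto_natCast_atTop_atTop (R := ℝ))).inv_tendsto_atTop
  simp_rw [one_div]; exact this

/-- auxiliary function `ψ₁(a) - 1/a` -/
lemma psi1_aux {a : ℝ} (ha : 0 < a) (K : ℕ) :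
    psi1 a - 1 / a = ∑ k ∈ range K, 1 / ((a + k) ^ 2 * (a + k + 1)) + (psi1 (a + K) - 1 / (a + K)) := by
  induction K with
  | zero => simp
  | succ K ih =>
    rw [ih, sum_range_succ, psi1_succ (a := a + K) (by positivity)]
    have : 0 < a + K := by positivity
    push_cast
    rw [show a + (K + 1) = a + K + 1 by ring]
    field_simp
    ring

lemma psi1_lower_diff {a b : ℝ} (ha : 0 < a) (hb : 0 ≤ b) :
    1 / a - 1 / (a + b) ≤ psi1 a - psi1 (a + b) := by
  have h : ∀ K : ℕ, (psi1 (a + K) - 1 / (a + K)) - (psi1 (a + b + K) - 1 / (a + b + K)) ≤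
      (psi1 a - 1 / a) - (psi1 (a + b) - 1 / (a + b)) := by
    intro K
    rw [psi1_aux ha K, psi1_aux (a := a + b) (by linarith) K]
    have : ∑ k ∈ range K, 1 / ((a + b + k) ^ 2 * (a + b + k + 1)) ≤
        ∑ k ∈ range K, 1 / ((a + k) ^ 2 * (a + k + 1)) := by
      apply sum_le_sum
      intro k _
      gcongr <;> linarith
    linarith
  have hl : Tendsto (fun K : ℕ => (psi1 (a + K) - 1 / (a + K)) - (psi1 (a + b + K) - 1 / (a + b + K)))
      atTop (nhds ((0 - 0) - (0 - 0))) :=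
    ((psi1_tendsto_nat a).sub (inv_tendsto_nat a)).sub ((psi1_tendsto_nat _).sub (inv_tendsto_nat _))
  have := le_of_tendsto' hl h
  linarith

lemma psi1_lower {a : ℝ} (ha : 0 < a) : 1 / a ≤ psi1 a := by
  have h : ∀ K : ℕ, (psi1 (a + K) - 1 / (a + K)) ≤ psi1 a - 1 / a := by
    intro K
    rw [psi1_aux ha K]
    have : 0 ≤ ∑ k ∈ range K, 1 / ((a + k) ^ 2 * (a + k + 1)) := by positivity
    linarith
  have hl := (psi1_tendsto_nat a).sub (inv_tendsto_nat a)
  have := le_of_tendsto' hl h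
  linarith

lemma psi1_upper {a : ℝ} (ha : 0 < a) : psi1 a ≤ 1 / a + 1 / a ^ 2 := by
  have h : ∀ K : ℕ, psi1 a ≤ 1 / a ^ 2 + 1 / a - 1 / (a + K) + psi1 (a + 1 + K) := by
    intro K
    induction K with
    | zero => have := psi1_succ ha; simp only [Nat.cast_zero, add_zero]; linarith
    | succ K ih =>
      refine ih.trans ?_
      rw [psi1_succ (a := a + 1 + K) (by positivity)]
      push_cast
      have : 0 < a + K := by positivity
      have h1 : 1 / (a + 1 + K) ^ 2 ≤ 1 / (a + K) - 1 / (a + (K + 1)) := by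
        rw [div_sub_div _ _ (by positivity) (by positivity), div_le_div_iff₀ (by positivity) (by positivity)]
        nlinarith
      rw [show a + 1 + (K + 1 : ℝ) = a + 1 + K + 1 by ring]
      linarith
  have hl : Tendsto (fun K : ℕ => 1 / a ^ 2 + 1 / a - 1 / (a + K) + psi1 (a + 1 + K)) atTop
      (nhds (1 / a ^ 2 + 1 / a - 0 + 0)) :=
    ((tendsto_const_nhds).sub (inv_tendsto_nat a)).add (psi1_tendsto_nat _)
  have := ge_of_tendsto' hl h
  linarith

/-- near-Gaussian law with third order error `ρ` -/
def Near (S : Measure ℝ) (ρ : ℝ) : Prop :=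
  L2 S ∧ ∀ t : ℝ, ‖cc S t - Complex.exp ((-(var S * t ^ 2 / 2) : ℝ))‖ ≤ ρ * |t| ^ 3

lemma norm_cexp_neg_le {x : ℝ} (hx : 0 ≤ x) : ‖Complex.exp ((-x : ℝ))‖ ≤ 1 := by
  rw [Complex.norm_exp, Complex.ofReal_re, Real.exp_le_one_iff]; linarith

lemma prod_diff {a b c d : ℂ} (ha : ‖a‖ ≤ 1) (hd : ‖d‖ ≤ 1) : ‖a * b - c * d‖ ≤ ‖b - d‖ + ‖a - c‖ := by
  have : a * b - c * d = a * (b - d) + (a - c) * d := by ring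
  rw [this]
  refine (norm_add_le _ _).trans ?_
  rw [norm_mul, norm_mul]
  have h1 := mul_le_mul_of_nonneg_right ha (norm_nonneg (b - d))
  have h2 := mul_le_mul_of_nonneg_left hd (norm_nonneg (a - c))
  linarith

lemma Near.conv {S T : Measure ℝ} [IsProbabilityMeasure S] [IsProbabilityMeasure T] {ρ σ : ℝ}
    (hS : Near S ρ) (hT : Near T σ) : Near (S.conv T) (ρ + σ) := by
  obtain ⟨h1, h2, h3⟩ := conv_L2 hS.1 hT.1
  refine ⟨h1, fun t => ?_⟩
  rw [← cc_mul (M := S.conv T) (fun t => (charFun_conv (μ := S) (ν := T) t).symm) h2, h3]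
  have e : Complex.exp ((-((var S + var T) * t ^ 2 / 2) : ℝ)) =
    Complex.exp ((-(var S * t ^ 2 / 2) : ℝ)) * Complex.exp ((-(var T * t ^ 2 / 2) : ℝ)) := by
    rw [← Complex.exp_add]; congr 1; push_cast; ring
  rw [e]
  have hn := var_nonneg T
  refine (prod_diff (cc_norm S t) (norm_cexp_neg_le (by positivity))).trans ?_
  have := hS.2 t
  have := hT.2 t
  linarith

lemma Near.scale {S : Measure ℝ} {ρ : ℝ} (hS : Near S ρ) (u : ℝ) :
    Near (S.map (fun x => u * x)) (|u| ^ 3 * ρ) := by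
  obtain ⟨h1, h2, h3, h4⟩ := scale_stats u hS.1
  refine ⟨h1, fun t => ?_⟩
  rw [h4, h3]
  have := hS.2 (u * t)
  rw [show u ^ 2 * var S * t ^ 2 / 2 = var S * (u * t) ^ 2 / 2 by ring]
  refine this.trans (le_of_eq ?_)
  rw [abs_mul]; ring

/-- centred characteristic function of `-Exp(1)` -/
noncomputable def cE (x : ℝ) : ℂ := Complex.exp (x * Complex.I) / (1 + x * Complex.I)

lemma cE_norm (x : ℝ) : ‖cE x‖ = 1 / √(1 + x ^ 2) := by
  unfold cE
  rw [norm_div, Complex.norm_exp_ofReal_mul_I]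
  congr 1
  rw [Complex.norm_def]
  congr 1
  simp [Complex.normSq_apply]; ring

lemma cE_anti {x y : ℝ} (hy : 0 ≤ y) (h : y ≤ x) : ‖cE x‖ ≤ ‖cE y‖ := by
  rw [cE_norm, cE_norm]
  gcongr

lemma cE_ne (x : ℝ) : cE x ≠ 0 := div_ne_zero (Complex.exp_ne_zero _) (one_add_ne x)

lemma cE_deriv (s : ℝ) : HasDerivAt (fun s : ℝ => cE s * Complex.exp ((s ^ 2 / 2 : ℝ)))
    (cE s * Complex.exp ((s ^ 2 / 2 : ℝ)) * (Complex.I * s ^ 2 / (1 + s * Complex.I))) s := by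
  have h0 : HasDerivAt (fun s : ℝ => (s : ℂ)) 1 s := Complex.ofRealCLM.hasDerivAt
  have h1 : HasDerivAt (fun s : ℝ => Complex.exp (s * Complex.I)) (Complex.exp (s * Complex.I) * (1 * Complex.I)) s :=
    (h0.mul_const _).cexp
  have h2 : HasDerivAt (fun s : ℝ => (1 + s * Complex.I : ℂ)) (1 * Complex.I) s :=
    (h0.mul_const _).const_add 1
  have h3 : HasDerivAt (fun s : ℝ => Complex.exp ((s ^ 2 / 2 : ℝ)))
      (Complex.exp ((s ^ 2 / 2 : ℝ)) * s) s := by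
    have : HasDerivAt (fun s : ℝ => ((s ^ 2 / 2 : ℝ) : ℂ)) s s := by
      have h := ((hasDerivAt_pow 2 s).div_const 2).ofReal_comp
      simpa using h
    exact this.cexp
  have h4 := ((h1.div h2 (one_add_ne s)).mul h3)
  refine HasDerivAt.congr_deriv (f := fun s : ℝ => cE s * Complex.exp ((s ^ 2 / 2 : ℝ))) h4 ?_
  have := one_add_ne s
  simp only [cE, Pi.div_apply]
  field_simp
  ring_nf
  simp only [Complex.I_sq, show Complex.I ^ 3 = -Complex.I by rw [pow_succ, Complex.I_sq]; ring]
  ring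

lemma cE_key {x y : ℝ} (hy : 0 ≤ y) (h : y ≤ x) :
    ‖cE x / cE y - Complex.exp ((-((x ^ 2 - y ^ 2) / 2) : ℝ))‖ ≤ (x ^ 3 - y ^ 3) / 3 := by
  set K : ℝ := ‖cE y‖ * rexp (x ^ 2 / 2) with hK
  have hK0 : 0 < K := by have := norm_pos_iff.2 (cE_ne y); positivity
  let f : ℝ → ℂ := fun s => cE s * Complex.exp ((s ^ 2 / 2 : ℝ)) - cE y * Complex.exp ((y ^ 2 / 2 : ℝ))
  have hd : ∀ s, HasDerivAt f (cE s * Complex.exp ((s ^ 2 / 2 : ℝ)) * (Complex.I * s ^ 2 / (1 + s * Complex.I))) s :=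
    fun s => (cE_deriv s).sub_const _
  have hB : ∀ s : ℝ, HasDerivAt (fun s : ℝ => K * ((s ^ 3 - y ^ 3) / 3)) (K * s ^ 2) s := by
    intro s
    have := (((hasDerivAt_pow 3 s).sub_const (y ^ 3)).div_const 3).const_mul K
    refine this.congr_deriv ?_
    norm_num
  have hmain := image_norm_le_of_norm_deriv_right_le_deriv_boundary (f := f) (a := y) (b := x)
    (B := fun s : ℝ => K * ((s ^ 3 - y ^ 3) / 3)) (B' := fun s => K * s ^ 2)
    (fun s _ => (hd s).continuousAt.continuousWithinAt) (fun s _ => (hd s).hasDerivWithinAt)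
    (by simp [f]) hB (by
      intro s hs
      have hs0 : 0 ≤ s := hy.trans hs.1
      have e1 : ‖Complex.I * (s : ℂ) ^ 2 / (1 + s * Complex.I)‖ ≤ s ^ 2 := by
        rw [norm_div, norm_mul, Complex.norm_I, norm_pow, Complex.norm_real, Real.norm_eq_abs, sq_abs, one_mul]
        apply div_le_self (sq_nonneg s)
        have := Complex.abs_re_le_norm (1 + s * Complex.I)
        simpa using this
      have e2 : ‖Complex.exp ((s ^ 2 / 2 : ℝ))‖ ≤ rexp (x ^ 2 / 2) := by
        rw [Complex.norm_exp, Complex.ofReal_re]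
        have := hs.2.le
        gcongr
      rw [norm_mul, norm_mul]
      have := cE_anti hy hs.1
      have : ‖cE s‖ * ‖Complex.exp ((s ^ 2 / 2 : ℝ))‖ ≤ K := by rw [hK]; gcongr
      gcongr)
  have h1 := hmain (Set.right_mem_Icc.2 h)
  simp only [f] at h1
  have e3 : cE x / cE y - Complex.exp ((-((x ^ 2 - y ^ 2) / 2) : ℝ)) =
      (cE x * Complex.exp ((x ^ 2 / 2 : ℝ)) - cE y * Complex.exp ((y ^ 2 / 2 : ℝ))) /
        (cE y * Complex.exp ((x ^ 2 / 2 : ℝ))) := by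
    have n1 := cE_ne y
    have n2 := Complex.exp_ne_zero ((x ^ 2 / 2 : ℝ))
    have e : Complex.exp ((-((x ^ 2 - y ^ 2) / 2) : ℝ)) = Complex.exp ((y ^ 2 / 2 : ℝ)) / Complex.exp ((x ^ 2 / 2 : ℝ)) := by
      rw [← Complex.exp_sub]; congr 1; push_cast; ring
    rw [e]
    field_simp
  rw [e3, norm_div, norm_mul, Complex.norm_exp, Complex.ofReal_re, div_le_iff₀ hK0]
  linarith

end RS

namespace RS

lemma cc_neg (P : Measure ℝ) (t : ℝ) : cc P (-t) = (starRingEnd ℂ) (cc P t) := by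
  unfold cc
  rw [charFun_neg, map_mul, ← Complex.exp_conj]
  congr 2
  simp

lemma near_of_chain (M : ℕ → Measure ℝ) [∀ k, IsProbabilityMeasure (M k)] (hL : ∀ k, L2 (M k))
    (p q : ℕ → ℝ) (p0 : ℝ) (hq : ∀ k, 0 ≤ q k) (hqp : ∀ k, q k ≤ p k) (hp : ∀ k, p k ≤ p0)
    (hc : ∀ k t, cc (M k) t = cE (t * p k) / cE (t * q k) * cc (M (k + 1)) t)
    (hv : ∀ k, var (M k) = (p k ^ 2 - q k ^ 2) + var (M (k + 1)))
    (hlim : Tendsto (fun k => var (M k)) atTop (nhds 0)) :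
    Near (M 0) (p0 / 2 * var (M 0)) := by
  have hpos : ∀ t : ℝ, 0 ≤ t → ‖cc (M 0) t - Complex.exp ((-(var (M 0) * t ^ 2 / 2) : ℝ))‖ ≤
      p0 / 2 * var (M 0) * t ^ 3 := by
    intro t ht
    have h1 : ∀ K, ‖cc (M 0) t - Complex.exp ((-(var (M 0) * t ^ 2 / 2) : ℝ))‖ ≤
        p0 / 2 * (var (M 0) - var (M K)) * t ^ 3 +
          ‖cc (M K) t - Complex.exp ((-(var (M K) * t ^ 2 / 2) : ℝ))‖ := by
      intro K
      induction K with
      | zero => simp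
      | succ K ih =>
        refine ih.trans ?_
        have hx : t * q K ≤ t * p K := by gcongr; exact hqp K
        have hy : 0 ≤ t * q K := mul_nonneg ht (hq K)
        have k1 := cE_key hy hx
        have e : Complex.exp ((-(var (M K) * t ^ 2 / 2) : ℝ)) =
            Complex.exp ((-(((t * p K) ^ 2 - (t * q K) ^ 2) / 2) : ℝ)) *
              Complex.exp ((-(var (M (K + 1)) * t ^ 2 / 2) : ℝ)) := by
          rw [← Complex.exp_add, hv K]; congr 1; push_cast; ring
        have n1 : ‖cE (t * p K) / cE (t * q K)‖ ≤ 1 := by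
          rw [norm_div]
          exact div_le_one_of_le₀ (cE_anti hy hx) (norm_nonneg _)
        have hvn := var_nonneg (M (K + 1))
        have k2 := prod_diff (b := cc (M (K + 1)) t)
          (c := Complex.exp ((-(((t * p K) ^ 2 - (t * q K) ^ 2) / 2) : ℝ))) n1
          (norm_cexp_neg_le (x := var (M (K + 1)) * t ^ 2 / 2) (by positivity))
        rw [← hc, ← e] at k2
        have k3 : ((t * p K) ^ 3 - (t * q K) ^ 3) / 3 ≤ p0 / 2 * (p K ^ 2 - q K ^ 2) * t ^ 3 := by
          have hqK := hq K
          have hpK := hp K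
          have hqpK := hqp K
          have : (p K ^ 3 - q K ^ 3) / 3 ≤ p0 / 2 * (p K ^ 2 - q K ^ 2) := by
            have a1 : (p K ^ 3 - q K ^ 3) / 3 ≤ p K / 2 * (p K ^ 2 - q K ^ 2) := by
              nlinarith [mul_nonneg (sub_nonneg.2 hqpK) (sub_nonneg.2 hqpK),
                mul_nonneg (mul_nonneg (sub_nonneg.2 hqpK) (sub_nonneg.2 hqpK)) hqK,
                mul_nonneg (mul_nonneg (sub_nonneg.2 hqpK) (sub_nonneg.2 hqpK)) (hqK.trans hqpK)]
            have a2 : 0 ≤ p K ^ 2 - q K ^ 2 := by nlinarith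
            nlinarith
          calc _ = (p K ^ 3 - q K ^ 3) / 3 * t ^ 3 := by ring
            _ ≤ _ := by gcongr
        have k4 : var (M 0) - var (M (K + 1)) = (var (M 0) - var (M K)) + (p K ^ 2 - q K ^ 2) := by
          rw [hv K]; ring
        rw [k4]
        nlinarith
    have h2 : ∀ K, ‖cc (M 0) t - Complex.exp ((-(var (M 0) * t ^ 2 / 2) : ℝ))‖ ≤
        p0 / 2 * (var (M 0) - var (M K)) * t ^ 3 + (2 * t ^ 2 * var (M K) + var (M K) * t ^ 2 / 2) := by
      intro K
      refine (h1 K).trans ?_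
      have a1 := cc_near_one (hL K) t
      have hvn := var_nonneg (M K)
      have a2 : ‖(1 : ℂ) - Complex.exp ((-(var (M K) * t ^ 2 / 2) : ℝ))‖ ≤ var (M K) * t ^ 2 / 2 := by
        have := exp_neg_lip (x := 0) (y := var (M K) * t ^ 2 / 2) le_rfl (by positivity)
        rw [← Complex.ofReal_exp, ← Complex.ofReal_one, ← Complex.ofReal_sub, Complex.norm_real, Real.norm_eq_abs]
        simp only [neg_zero, Real.exp_zero, zero_sub, abs_neg] at this
        rwa [abs_of_nonneg (by positivity : 0 ≤ var (M K) * t ^ 2 / 2)] at this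
      have a3 := norm_add_le (cc (M K) t - 1) (1 - Complex.exp ((-(var (M K) * t ^ 2 / 2) : ℝ)))
      rw [sub_add_sub_cancel] at a3
      linarith
    have hl : Tendsto (fun K => p0 / 2 * (var (M 0) - var (M K)) * t ^ 3 +
        (2 * t ^ 2 * var (M K) + var (M K) * t ^ 2 / 2)) atTop
        (nhds (p0 / 2 * (var (M 0) - 0) * t ^ 3 + (2 * t ^ 2 * 0 + 0 * t ^ 2 / 2))) :=
      (((tendsto_const_nhds.sub hlim).const_mul _).mul_const _).add
        ((hlim.const_mul _).add ((hlim.mul_const _).div_const _))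
    have := ge_of_tendsto' hl h2
    simpa using this
  refine ⟨hL 0, fun t => ?_⟩
  rcases le_total 0 t with ht | ht
  · rw [abs_of_nonneg ht]; exact hpos t ht
  · have h := hpos (-t) (by linarith)
    rw [abs_of_nonpos ht]
    refine le_trans (le_of_eq ?_) h
    rw [cc_neg, neg_sq, ← Complex.norm_conj, map_sub]
    congr 2
    rw [← Complex.exp_conj, Complex.conj_ofReal]

lemma cc_lb_one {a : ℝ} (ha : 0 < a) (t : ℝ) : cc (lb a 1) t = cE (t * (1 / a)) := by
  unfold cc cE
  rw [charFun_lb_one ha, (lb_one_stats ha).1]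
  rw [show t / a = t * (1 / a) by ring, one_div_mul_eq_div]
  congr 2; push_cast; ring

lemma cc_lg_succ {a : ℝ} (ha : 0 < a) (t : ℝ) : cc (lg a) t = cE (t * (1 / a)) * cc (lg (a + 1)) t := by
  rw [← cc_lb_one ha, cc_mul (charFun_lb ha one_pos) (lb_L2 ha one_pos).2.1]

lemma cc_lg_ne {a : ℝ} (ha : 0 < a) (t : ℝ) : cc (lg a) t ≠ 0 :=
  mul_ne_zero (charFun_lg_ne ha t) (Complex.exp_ne_zero _)

lemma cc_lb_eq {a b : ℝ} (ha : 0 < a) (hb : 0 < b) (t : ℝ) :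
    cc (lb a b) t = cc (lg a) t / cc (lg (a + b)) t := by
  rw [eq_div_iff (cc_lg_ne (add_pos ha hb) t), cc_mul (charFun_lb ha hb) (lb_L2 ha hb).2.1]

lemma lg_near {a : ℝ} (ha : 0 < a) : Near (lg a) (1 / a / 2 * psi1 a) := by
  have hpos : ∀ k : ℕ, 0 < a + k := fun k => by positivity
  have : ∀ k : ℕ, IsProbabilityMeasure (lg (a + k)) := fun k => lg_prob (hpos k)
  have h := near_of_chain (fun k : ℕ => lg (a + k)) (fun k => lg_L2 (hpos k))
    (fun k => 1 / (a + k)) (fun _ => 0) (1 / a) (fun _ => le_rfl) (fun k => by have := hpos k; positivity)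
    (fun k => by gcongr; linarith [Nat.cast_nonneg (α := ℝ) k])
    (fun k t => by
      rw [cc_lg_succ (hpos k)]
      have : cE (t * 0) = 1 := by simp [cE]
      rw [this, div_one]; push_cast; rw [add_assoc])
    (fun k => by
      have := psi1_succ (hpos k)
      unfold psi1 at this
      rw [this]; push_cast; rw [add_assoc a, div_pow, one_pow]; ring) (psi1_tendsto_nat a)
  simpa [psi1] using h

lemma lb_near {a b : ℝ} (ha : 0 < a) (hb : 0 < b) : Near (lb a b) (1 / a / 2 * var (lb a b)) := by
  have hpos : ∀ k : ℕ, 0 < a + k := fun k => by positivity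
  have hpos2 : ∀ k : ℕ, 0 < a + k + b := fun k => by positivity
  have : ∀ k : ℕ, IsProbabilityMeasure (lb (a + k) b) := fun k => lb_prob (hpos k) hb
  have hvv : ∀ k : ℕ, var (lb (a + k) b) = psi1 (a + k) - psi1 (a + k + b) := fun k => by
    rw [(lb_L2 (hpos k) hb).2.2]; ring
  have h := near_of_chain (fun k : ℕ => lb (a + k) b) (fun k => (lb_L2 (hpos k) hb).1)
    (fun k => 1 / (a + k)) (fun k => 1 / (a + k + b)) (1 / a) (fun k => by have := hpos2 k; positivity)
    (fun k => one_div_le_one_div_of_le (hpos k) (by linarith))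
    (fun k => by gcongr; linarith [Nat.cast_nonneg (α := ℝ) k])
    (fun k t => by
      have e : a + ((k + 1 : ℕ) : ℝ) = a + k + 1 := by push_cast; ring
      rw [e, cc_lb_eq (hpos k) hb, cc_lb_eq (by linarith [hpos k]) hb, cc_lg_succ (hpos k),
        cc_lg_succ (hpos2 k), show a + k + b + 1 = a + k + 1 + b by ring]
      rw [div_mul_div_comm])
    (fun k => by
      have e : a + ((k + 1 : ℕ) : ℝ) = a + k + 1 := by push_cast; ring
      have h1 := hvv (k + 1)
      rw [h1, hvv, e]
      have := psi1_succ (hpos k)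
      have h3 := psi1_succ (hpos2 k)
      rw [show a + k + b + 1 = a + k + 1 + b by ring] at h3
      rw [this, h3]; simp only [div_pow, one_pow]; ring) (by
      refine squeeze_zero (fun k => var_nonneg _) (fun k => ?_) (psi1_tendsto_nat a)
      rw [hvv k]; linarith [psi1_nonneg (a + k + b)])
  simpa using h

/-- iterated convolution -/
noncomputable def convN (f : ℕ → Measure ℝ) : ℕ → Measure ℝ
  | 0 => Measure.dirac 0
  | k + 1 => (convN f k).conv (f k)

lemma convN_prob (f : ℕ → Measure ℝ) (k : ℕ) (hf : ∀ j < k, IsProbabilityMeasure (f j)) :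
    IsProbabilityMeasure (convN f k) := by
  induction k with
  | zero => unfold convN; infer_instance
  | succ k ih =>
    have := ih (fun j hj => hf j (by omega))
    have := hf k (by omega)
    unfold convN
    infer_instance

lemma dirac_near : Near (Measure.dirac (0 : ℝ)) 0 ∧ var (Measure.dirac (0 : ℝ)) = 0 := by
  have hv : var (Measure.dirac (0 : ℝ)) = 0 := by simp [var]
  refine ⟨⟨?_, fun t => ?_⟩, hv⟩
  · unfold L2
    exact MemLp.of_bound (by fun_prop) 0 (by rw [ae_dirac_eq]; simp)
  · rw [hv]; simp [cc, mean]

lemma convN_near (f : ℕ → Measure ℝ) (ρ : ℕ → ℝ) (k : ℕ) (hf : ∀ j < k, IsProbabilityMeasure (f j))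
    (hn : ∀ j < k, Near (f j) (ρ j)) :
    Near (convN f k) (∑ j ∈ range k, ρ j) ∧ var (convN f k) = ∑ j ∈ range k, var (f j) := by
  induction k with
  | zero => simpa [convN] using dirac_near
  | succ k ih =>
    have h1 := ih (fun j hj => hf j (by omega)) (fun j hj => hn j (by omega))
    have := convN_prob f k (fun j hj => hf j (by omega))
    have := hf k (by omega)
    have h2 := hn k (by omega)
    rw [sum_range_succ, sum_range_succ, ← h1.2]
    exact ⟨h1.1.conv h2, (conv_L2 h1.1.1 h2.1).2.2⟩

lemma charFun_convN (f : ℕ → Measure ℝ) (k : ℕ) (hf : ∀ j < k, IsProbabilityMeasure (f j)) (t : ℝ) :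
    charFun (convN f k) t = ∏ j ∈ range k, charFun (f j) t := by
  induction k with
  | zero => simp [convN]
  | succ k ih =>
    have := convN_prob f k (fun j hj => hf j (by omega))
    have := hf k (by omega)
    rw [prod_range_succ, ← ih (fun j hj => hf j (by omega)), convN, charFun_conv]

end RS

namespace RS

/-- square root of Gram determinant -/
noncomputable def Dn {N k : ℕ} (X : Fin k → EuclideanSpace ℝ (Fin N)) : ℝ := √ (Matrix.gram ℝ X).det

/-- the reference simplex -/
noncomputable def refS (r : ℕ) : Set (EuclideanSpace ℝ (Fin r)) :=
  convexHull ℝ (Set.range (Fin.cons (α := fun _ => EuclideanSpace ℝ (Fin r)) 0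
    (fun i => EuclideanSpace.basisFun (Fin r) ℝ i)))

lemma refS_pos (r : ℕ) : 0 < (μH[(r : ℝ)] (refS r)).toReal := by
  apply ENNReal.toReal_pos
  · apply ne_of_gt
    refine lt_of_lt_of_le ?_ (measure_mono interior_subset)
    apply IsOpen.measure_pos _ isOpen_interior
    rw [refS, interior_convexHull_nonempty_iff_affineSpan_eq_top]
    have : (Set.range (Fin.cons (α := fun _ => EuclideanSpace ℝ (Fin r)) 0
      (fun i => EuclideanSpace.basisFun (Fin r) ℝ i))) = insert 0 (Set.range (EuclideanSpace.basisFun (Fin r) ℝ)) := by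
      rw [Fin.range_cons]
    rw [this]
    have h2 := (EuclideanSpace.basisFun (Fin r) ℝ).toBasis.span_eq
    rw [OrthonormalBasis.coe_toBasis] at h2
    apply SetLike.coe_injective
    rw [affineSpan_insert_zero, h2]; rfl
  · apply ne_of_lt
    apply Bornology.IsBounded.measure_lt_top
    rw [refS, isBounded_convexHull]
    exact (Set.finite_range _).isBounded

lemma simplexVol_eq (n r : ℕ) (X : Fin (r + 1) → EuclideanSpace ℝ (Fin n)) :
    simplexVol n r X = Dn (fun i : Fin r => X i.succ - X 0) * (μH[(r : ℝ)] (refS r)).toReal := by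
  set b := (EuclideanSpace.basisFun (Fin r) ℝ)
  set f : EuclideanSpace ℝ (Fin r) →ₗ[ℝ] EuclideanSpace ℝ (Fin n) :=
    b.toBasis.constr ℝ (fun i : Fin r => X i.succ - X 0) with hf
  have hfb : ∀ i, f (b i) = X i.succ - X 0 := fun i => by
    have := b.toBasis.constr_basis ℝ (fun i : Fin r => X i.succ - X 0) i
    rwa [OrthonormalBasis.coe_toBasis] at this
  have h1 : convexHull ℝ (Set.range X) = (fun v => X 0 + v) '' (f '' refS r) := by
    have : (fun v => X 0 + v) '' (f '' refS r) =
        (AffineMap.const ℝ (EuclideanSpace ℝ (Fin r)) (X 0) + f.toAffineMap) '' refS r := by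
      rw [Set.image_image]; rfl
    rw [this, refS, AffineMap.image_convexHull]
    congr 1
    rw [← Set.range_comp]
    congr 1
    ext1 i
    refine Fin.cases ?_ (fun i => ?_) i
    · simp
    · simp [hfb, b] 
      have := hfb i
      simp only [b, EuclideanSpace.basisFun_apply] at this
      rw [this]; abel
  have hnd : f.normDet = Dn (fun i : Fin r => X i.succ - X 0) := by
    have := f.normDet_sq_eq_det_gram b
    simp only [hfb] at this
    unfold Dn
    rw [← this]
    simp [Real.sqrt_sq f.normDet_nonneg]
  unfold simplexVol
  have h2 : μH[(r : ℝ)] ((fun v => X 0 + v) '' (f '' refS r)) = μH[(r:ℝ)] (f '' refS r) :=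
    (IsometryEquiv.addLeft (X 0)).hausdorffMeasure_image _ _
  have h3 := f.hausdorffMeasure_image (refS r)
  rw [finrank_euclideanSpace, Fintype.card_fin] at h3
  rw [h1, h2, h3, hnd, ENNReal.toReal_mul, ENNReal.toReal_ofReal (show 0 ≤ Dn _ from Real.sqrt_nonneg _)]

abbrev E (N : ℕ) := EuclideanSpace ℝ (Fin N)

/-- prepend a coordinate -/
noncomputable def ec {N : ℕ} (t : ℝ) (y : E N) : E (N + 1) := WithLp.toLp 2 (Fin.cons t (fun i => y i))
/-- drop the first coordinate -/
noncomputable def et {N : ℕ} (x : E (N + 1)) : E N := WithLp.toLp 2 (fun i => x i.succ)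

@[simp] lemma ec_zero {N : ℕ} (t : ℝ) (y : E N) : ec t y 0 = t := rfl
@[simp] lemma ec_succ {N : ℕ} (t : ℝ) (y : E N) (i : Fin N) : ec t y i.succ = y i := rfl
@[simp] lemma et_apply {N : ℕ} (x : E (N + 1)) (i : Fin N) : et x i = x i.succ := rfl
@[simp] lemma et_ec {N : ℕ} (t : ℝ) (y : E N) : et (ec t y) = y := rfl
lemma ec_et {N : ℕ} (x : E (N + 1)) : ec (x 0) (et x) = x := by
  ext i; refine Fin.cases ?_ (fun i => ?_) i <;> simp

lemma inner_split {N : ℕ} (x y : E (N + 1)) : inner ℝ x y = x 0 * y 0 + inner ℝ (et x) (et y) := by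
  simp only [PiLp.inner_apply, Fin.sum_univ_succ]
  simp [mul_comm]

lemma norm_sq_ec {N : ℕ} (t : ℝ) (y : E N) : ‖ec t y‖ ^ 2 = t ^ 2 + ‖y‖ ^ 2 := by
  rw [← real_inner_self_eq_norm_sq, inner_split, et_ec, real_inner_self_eq_norm_sq, ec_zero]; ring

lemma continuous_ec {N : ℕ} : Continuous (fun p : ℝ × E N => ec p.1 p.2) := by
  unfold ec
  refine (PiLp.continuous_toLp 2 _).comp ?_
  refine continuous_pi fun i => ?_
  refine Fin.cases ?_ (fun i => ?_) i
  · simp; fun_prop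
  · simp; fun_prop

lemma continuous_et {N : ℕ} : Continuous (et (N := N)) := by
  unfold et
  fun_prop

lemma et_sub {N : ℕ} (x y : E (N + 1)) : et (x - y) = et x - et y := by ext i; simp
lemma ec_sub {N : ℕ} (t s : ℝ) (x y : E N) : ec t x - ec s y = ec (t - s) (x - y) := by
  ext i; refine Fin.cases ?_ (fun i => ?_) i <;> simp

lemma Dn_nonneg {N k : ℕ} (X : Fin k → E N) : 0 ≤ Dn X := Real.sqrt_nonneg _

lemma Dn_continuous {N k : ℕ} : Continuous (fun X : Fin k → E N => Dn X) := by
  unfold Dn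
  refine Real.continuous_sqrt.comp (Continuous.matrix_det ?_)
  refine continuous_pi fun i => continuous_pi fun j => ?_
  simp only [Matrix.gram_apply]
  fun_prop

lemma Dn_zero {N : ℕ} (X : Fin 0 → E N) : Dn X = 1 := by
  simp [Dn]

lemma Dn_one {N : ℕ} (X : Fin 1 → E N) : Dn X = ‖X 0‖ := by
  simp [Dn, Matrix.gram_apply]

lemma Dn_rot {N k : ℕ} (U : E N ≃ₗᵢ[ℝ] E N) (X : Fin k → E N) : Dn (fun i => U (X i)) = Dn X := by
  unfold Dn
  congr 2
  ext i j
  simp [Matrix.gram_apply]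

lemma Dn_perm {N k : ℕ} (σ : Equiv.Perm (Fin k)) (X : Fin k → E N) : Dn (fun i => X (σ i)) = Dn X := by
  unfold Dn
  have : Matrix.gram ℝ (fun i => X (σ i)) = (Matrix.gram ℝ X).submatrix σ σ := by
    ext i j; simp [Matrix.gram_apply]
  rw [this, Matrix.det_submatrix_equiv_self]

lemma Dn_lin {N k : ℕ} (M : Matrix (Fin k) (Fin k) ℝ) (X : Fin k → E N) :
    Dn (fun i => ∑ j, M i j • X j) = |M.det| * Dn X := by
  unfold Dn
  have : Matrix.gram ℝ (fun i => ∑ j, M i j • X j) = M * (Matrix.gram ℝ X) * M.transpose := by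
    ext i j
    simp only [Matrix.gram_apply, Matrix.mul_apply, Matrix.transpose_apply, sum_inner, inner_sum,
      real_inner_smul_left, real_inner_smul_right, Finset.sum_mul]
    refine Finset.sum_congr rfl fun a _ => Finset.sum_congr rfl fun b _ => ?_
    ring
  rw [this, Matrix.det_mul, Matrix.det_mul, Matrix.det_transpose,
    show M.det * (Matrix.gram ℝ X).det * M.det = M.det ^ 2 * (Matrix.gram ℝ X).det by ring,
    Real.sqrt_mul (sq_nonneg _), Real.sqrt_sq_eq_abs]

lemma Dn_cons {N k : ℕ} (s : ℝ) (hs : 0 ≤ s) (w : Fin k → E (N + 1)) :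
    Dn (Fin.cons (ec s 0) w : Fin (k + 1) → E (N + 1)) = s * Dn (fun i => et (w i)) := by
  have key : (Matrix.gram ℝ (Fin.cons (ec s 0) w : Fin (k + 1) → E (N + 1))).det
      = s ^ 2 * (Matrix.gram ℝ (fun i => et (w i))).det := by
    rcases hs.eq_or_lt with rfl | hs
    · rw [Matrix.det_eq_zero_of_row_eq_zero 0]
      · ring
      · intro j
        have : ec (0 : ℝ) (0 : E N) = 0 := by ext i; refine Fin.cases ?_ (fun i => ?_) i <;> simp
        simp [Matrix.gram_apply, this]
    · let B : Matrix (Fin (k + 1)) (Fin (k + 1)) ℝ := fun i j =>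
        Fin.cases (Fin.cases (s ^ 2) (fun j => s * w j 0) j)
          (fun i => Fin.cases 0 (fun j => inner ℝ (et (w i)) (et (w j))) j) i
      have hB : B.det = s ^ 2 * (Matrix.gram ℝ (fun i => et (w i))).det := by
        rw [Matrix.det_succ_column_zero, Fin.sum_univ_succ, Finset.sum_eq_zero]
        · simp [B]
          left; rfl
        · intro i _
          simp [B]
      rw [← hB]
      apply Matrix.det_eq_of_forall_row_eq_smul_add_const
        (fun i => Fin.cases 0 (fun i => w i 0 / s) i) 0 rfl
      intro i j
      refine Fin.cases ?_ (fun i => ?_) i <;> refine Fin.cases ?_ (fun j => ?_) j <;>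
        simp [Matrix.gram_apply, B, inner_split, norm_sq_ec] <;> (try field_simp) <;> (try ring)
  unfold Dn
  rw [key, Real.sqrt_mul (sq_nonneg _), Real.sqrt_sq hs]

/-- volume of the simplex with an apex `p` -/
noncomputable def DV {N r : ℕ} (p : E N) (X : Fin r → E N) : ℝ := Dn (fun i => X i - p)
/-- volume of the simplex with an apex 0 -/
noncomputable def DO {N r : ℕ} (p : E N) (X : Fin r → E N) : ℝ := Dn (Fin.cons p X : Fin (r + 1) → E N)

/-- what we need of the functionals -/
structure GoodD (D : ∀ {N r : ℕ}, E N → (Fin r → E N) → ℝ) : Prop where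
  cont : ∀ N r, Continuous (fun q : E N × (Fin r → E N) => D q.1 q.2)
  rot : ∀ N r (U : E N ≃ₗᵢ[ℝ] E N) (p : E N) (X : Fin r → E N), D (U p) (fun i => U (X i)) = D p X
  elim : ∀ N r (t s : ℝ) (y : E N) (X : Fin r → E (N + 1)), 0 ≤ s →
    D (ec t y) (Fin.cons (ec (t + s) y) X : Fin (r + 1) → E (N + 1)) = s * D y (fun i => et (X i))
  nonneg : ∀ N r (p : E N) (X : Fin r → E N), 0 ≤ D p X

lemma goodDV : GoodD @DV where
  cont N r := Dn_continuous.comp (f := fun q : E N × (Fin r → E N) => fun i => q.2 i - q.1) (by fun_prop)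
  rot N r U p X := by
    unfold DV
    rw [← Dn_rot U (fun i => X i - p)]
    simp
  elim N r t s y X hs := by
    unfold DV
    have : (fun i => (Fin.cons (ec (t + s) y) X : Fin (r + 1) → E (N + 1)) i - ec t y)
        = (Fin.cons (ec s 0) (fun i => X i - ec t y) : Fin (r + 1) → E (N + 1)) := by
      ext1 i
      refine Fin.cases ?_ (fun i => ?_) i
      · simp [ec_sub]
      · simp
    rw [this, Dn_cons _ hs]
    simp [et_sub]
  nonneg N r p X := Dn_nonneg _

lemma goodDO : GoodD @DO where
  cont N r := Dn_continuous.comp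
    (f := fun q : E N × (Fin r → E N) => (Fin.cons q.1 q.2 : Fin (r + 1) → E N)) (by
      refine continuous_pi fun i => ?_
      refine Fin.cases ?_ (fun i => ?_) i
      · simp; fun_prop
      · simp; fun_prop)
  rot N r U p X := by
    unfold DO
    rw [← Dn_rot U (Fin.cons p X)]
    congr 1
    ext1 i
    refine Fin.cases ?_ (fun i => ?_) i <;> simp
  elim N r t s y X hs := by
    unfold DO
    rw [← Dn_perm (Equiv.swap 0 1)]
    have h1 : (1 : Fin (r + 2)) ≠ 0 := by simp
    have := Dn_lin (Matrix.transvection (0 : Fin (r + 2)) 1 (-1 : ℝ))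
      (fun i => (Fin.cons (ec t y) (Fin.cons (ec (t + s) y) X) : Fin (r + 2) → E (N + 1)) (Equiv.swap 0 1 i))
    rw [Matrix.det_transvection_of_ne _ _ h1.symm, abs_one, one_mul] at this
    rw [← this]
    have h3 : (Fin.cons y (fun i => et (X i)) : Fin (r + 1) → E N) =
        fun i => et ((Fin.cons (ec t y) X : Fin (r + 1) → E (N + 1)) i) := by
      ext1 i; refine Fin.cases ?_ (fun i => ?_) i <;> simp
    rw [h3, ← Dn_cons _ hs]
    congr 1
    ext1 i
    refine Fin.cases ?_ (fun i => ?_) i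
    · simp only [Matrix.transvection, Matrix.add_apply, add_smul, Finset.sum_add_distrib, Matrix.one_apply,
        Matrix.single_apply, ite_smul, Finset.sum_ite_eq, one_smul, zero_smul]
      simp [ec_sub, ← sub_eq_add_neg]
    · simp only [Matrix.transvection, Matrix.add_apply, add_smul, Finset.sum_add_distrib, Matrix.one_apply,
        Matrix.single_apply, ite_smul, Finset.sum_ite_eq, one_smul, zero_smul]
      refine Fin.cases ?_ (fun i => ?_) i
      · simp [Fin.succ_ne_zero]
      · have : Equiv.swap (0 : Fin (r + 2)) 1 i.succ.succ = i.succ.succ :=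
          Equiv.swap_apply_of_ne_of_ne (Fin.succ_ne_zero _) (by simp [Fin.ext_iff])
        simp [this, (Fin.succ_ne_zero _).symm]
  nonneg N r p X := Dn_nonneg _

end RS

open scoped ENNReal
namespace RS

/-- splitting off the first coordinate -/
noncomputable def ecE (N : ℕ) : E (N + 1) ≃ᵐ ℝ × E N :=
  (MeasurableEquiv.toLp 2 (Fin (N + 1) → ℝ)).symm.trans
    ((MeasurableEquiv.piFinSuccAbove (fun _ => ℝ) 0).trans
      ((MeasurableEquiv.refl ℝ).prodCongr (MeasurableEquiv.toLp 2 (Fin N → ℝ))))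

lemma ecE_symm {N : ℕ} (p : ℝ × E N) : (ecE N).symm p = ec p.1 p.2 := by
  rw [MeasurableEquiv.symm_apply_eq]
  ext i
  · rfl
  · rfl

lemma ecE_apply {N : ℕ} (x : E (N + 1)) : ecE N x = (x 0, et x) := by
  have := ecE_symm (x 0, et x)
  rw [MeasurableEquiv.symm_apply_eq] at this
  rw [this]; simp [ec_et]

lemma mp_ecE (N : ℕ) : MeasurePreserving (ecE N) := by
  refine (EuclideanSpace.volume_preserving_symm_measurableEquiv_toLp (Fin (N + 1))).trans ?_
  refine (volume_preserving_piFinSuccAbove (fun _ => ℝ) 0).trans ?_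
  exact (MeasurePreserving.id _).prod (EuclideanSpace.volume_preserving_symm_measurableEquiv_toLp (Fin N)).symm

lemma measurable_ec {N : ℕ} : Measurable (fun p : ℝ × E N => ec p.1 p.2) := continuous_ec.measurable
lemma measurable_et {N : ℕ} : Measurable (et (N := N)) := continuous_et.measurable

lemma lint_split {N : ℕ} (F : E (N + 1) → ℝ≥0∞) (hF : Measurable F) :
    ∫⁻ x, F x = ∫⁻ t, ∫⁻ y, F (ec t y) := by
  have h := (mp_ecE N).symm.lintegral_comp hF
  rw [← h]
  simp only [ecE_symm]
  rw [Measure.volume_eq_prod, lintegral_prod _ (by exact (hF.comp measurable_ec).aemeasurable)]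

lemma lint_split' {N : ℕ} (F : E (N + 1) → ℝ≥0∞) (hF : Measurable F) :
    ∫⁻ x, F x = ∫⁻ y, ∫⁻ t, F (ec t y) := by
  rw [lint_split F hF, lintegral_lintegral_swap]
  exact (hF.comp measurable_ec).aemeasurable

/-- surface constant -/
noncomputable def Cn (N : ℕ) : ℝ≥0∞ := (volume : Measure (E (N + 1))).toSphere Set.univ

lemma Cn_ne_top (N : ℕ) : Cn N ≠ ∞ := measure_ne_top _ _
lemma Cn_ne_zero (N : ℕ) : Cn N ≠ 0 := by
  unfold Cn
  rw [Measure.measure_univ_ne_zero]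
  exact Measure.toSphere_ne_zero _

lemma lint_radial {N : ℕ} (H : ℝ → ℝ≥0∞) (hH : Measurable H) :
    ∫⁻ x : E (N + 1), H ‖x‖ = Cn N * ∫⁻ s in Set.Ioi (0 : ℝ), ENNReal.ofReal (s ^ N) * H s := by
  have h0 : ∫⁻ x : E (N + 1), H ‖x‖ = ∫⁻ x : ({(0)}ᶜ : Set (E (N + 1))), H (‖x.1‖) ∂(volume.comap Subtype.val) := by
    rw [lintegral_subtype_comap (measurableSet_singleton _).compl (fun x => H ‖x‖), restrict_compl_singleton]
  have h1 := (Measure.measurePreserving_homeomorphUnitSphereProd (volume : Measure (E (N+1)))).lintegral_comp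
    (f := fun x => H x.2.1) (by fun_prop)
  simp only [homeomorphUnitSphereProd_apply_snd_coe] at h1
  have h3 : ∀ c : ℝ≥0∞, ∫⁻ s : Set.Ioi (0 : ℝ), H s.1 ∂Measure.volumeIoiPow N
     = ∫⁻ s in Set.Ioi (0 : ℝ), ENNReal.ofReal (s ^ N) * H s := by
    intro _
    rw [Measure.volumeIoiPow, lintegral_withDensity_eq_lintegral_mul _ (by fun_prop) (by fun_prop)]
    exact lintegral_subtype_comap (measurableSet_Ioi) (fun s => ENNReal.ofReal (s ^ N) * H s)
  rw [h0, h1]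
  rw [lintegral_prod _ (by fun_prop)]
  simp only [finrank_euclideanSpace, Fintype.card_fin, Nat.add_sub_cancel]
  rw [h3 0]
  simp [Cn, mul_comm]

lemma exists_rot {N : ℕ} (x y : E N) (h : ‖x‖ = ‖y‖) : ∃ U : E N ≃ₗᵢ[ℝ] E N, U x = y :=
  ⟨_, Submodule.reflection_sub h⟩

lemma norm_ec_zero {N : ℕ} (s : ℝ) (hs : 0 ≤ s) : ‖ec s (0 : E N)‖ = s := by
  have := norm_sq_ec s (0 : E N)
  rw [norm_zero] at this
  exact (sq_eq_sq₀ (norm_nonneg _) hs).1 (by linarith)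

lemma ec_add {N : ℕ} (t s : ℝ) (x y : E N) : ec t x + ec s y = ec (t + s) (x + y) := by
  ext i; refine Fin.cases ?_ (fun i => ?_) i <;> simp

lemma lint_elim {N : ℕ} (G : E (N + 1) → E (N + 1) → ℝ≥0∞) (hG : Measurable (fun q : E (N + 1) × E (N + 1) => G q.1 q.2))
    (hrot : ∀ U : E (N + 1) ≃ₗᵢ[ℝ] E (N + 1), ∀ p q, G (U p) (U q) = G p q) :
    ∫⁻ p, ∫⁻ q, G p q = Cn N * ∫⁻ s in Set.Ioi (0 : ℝ), ENNReal.ofReal (s ^ N) *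
      ∫⁻ t, ∫⁻ y, G (ec t y) (ec (t + s) y) := by
  have h1 : ∀ p, ∫⁻ q, G p q = ∫⁻ v, G p (p + v) := fun p => (lintegral_add_left_eq_self _ p).symm
  simp_rw [h1]
  rw [lintegral_lintegral_swap (by
    have : Measurable (fun q : E (N + 1) × E (N + 1) => G q.1 (q.1 + q.2)) := 
      hG.comp (f := fun q : E (N + 1) × E (N + 1) => (q.1, q.1 + q.2)) (by fun_prop)
    exact this.aemeasurable)]
  have h2 : ∀ v, ∫⁻ p, G p (p + v) = ∫⁻ p, G p (p + ec ‖v‖ 0) := by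
    intro v
    obtain ⟨U, hU⟩ := exists_rot v (ec ‖v‖ 0) (by rw [norm_ec_zero _ (norm_nonneg _)])
    rw [← U.measurePreserving.lintegral_comp_emb U.toHomeomorph.measurableEmbedding (fun p => G p (p + ec ‖v‖ 0))]
    refine lintegral_congr fun p => ?_
    rw [← hU, ← map_add, hrot]
  rw [lintegral_congr h2]
  have hm : Measurable (fun q : ℝ × E (N + 1) => G q.2 (q.2 + ec q.1 0)) :=
    hG.comp (f := fun q : ℝ × E (N + 1) => (q.2, q.2 + ec q.1 (0 : E N))) (by
      have : Measurable (fun q : ℝ × E (N + 1) => ec q.1 (0 : E N)) := measurable_ec.comp (f := fun q : ℝ × E (N + 1) => (q.1, (0 : E N))) (by fun_prop)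
      fun_prop)
  rw [lint_radial (fun s => ∫⁻ p, G p (p + ec s 0)) hm.lintegral_prod_right']
  congr 1
  refine lintegral_congr fun s => ?_
  congr 1
  rw [lint_split (fun p => G p (p + ec s 0)) (hm.comp measurable_prodMk_left)]
  simp [ec_add]

end RS

open scoped ENNReal
namespace RS

/-- the unnormalised beta density as a function of `1 - ‖x‖ ^ 2` -/
noncomputable def kk (a u : ℝ) : ℝ≥0∞ := if 0 < u then ENNReal.ofReal (u ^ ((a - 2) / 2)) else 0

lemma kk_meas (a : ℝ) : Measurable (kk a) := by
  unfold kk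
  refine Measurable.ite measurableSet_Ioi (by fun_prop) measurable_const

lemma kk_mul {a w : ℝ} (hw : 0 < w) (u : ℝ) : kk a (w * u) = kk a w * kk a u := by
  unfold kk
  by_cases hu : 0 < u
  · rw [if_pos (mul_pos hw hu), if_pos hw, if_pos hu, Real.mul_rpow hw.le hu.le,
      ENNReal.ofReal_mul (by positivity)]
  · rw [if_neg (by intro h; exact hu ((mul_pos_iff_of_pos_left hw).1 h)), if_neg hu, mul_zero]

lemma kk_nonpos {a u : ℝ} (hu : u ≤ 0) : kk a u = 0 := by simp [kk, not_lt.2 hu]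

/-- the normalisation constant -/
noncomputable def cb (N : ℕ) (a : ℝ) : ℝ :=
  π ^ (-(N : ℝ) / 2) * Real.Gamma (((N : ℝ) + a) / 2) / Real.Gamma (a / 2)

lemma cb_pos (N : ℕ) {a : ℝ} (ha : 0 < a) : 0 < cb N a := by
  have : 0 < Real.Gamma (((N : ℝ) + a) / 2) := Real.Gamma_pos_of_pos (by positivity)
  have : 0 < Real.Gamma (a / 2) := Real.Gamma_pos_of_pos (by positivity)
  unfold cb; positivity

lemma kkn_meas (N : ℕ) (a : ℝ) : Measurable (fun x : E N => kk a (1 - ‖x‖ ^ 2)) :=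
  (kk_meas a).comp (by fun_prop)

lemma beta_eq (N : ℕ) {a : ℝ} (ha : 0 < a) : betaModel N a =
    volume.withDensity (fun x : E N => ENNReal.ofReal (cb N a) * kk a (1 - ‖x‖ ^ 2)) := by
  unfold betaModel
  congr 1
  ext1 x
  have : ‖x‖ < 1 ↔ 0 < 1 - ‖x‖ ^ 2 := by
    rw [sub_pos, sq_lt_one_iff₀ (norm_nonneg _)]
  simp only [kk, this]
  split_ifs
  · rw [← ENNReal.ofReal_mul (cb_pos N ha).le]; rfl
  · simp

lemma beta_lint (N : ℕ) {a : ℝ} (ha : 0 < a) (g : E N → ℝ≥0∞) (hg : Measurable g) :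
    ∫⁻ x, g x ∂(betaModel N a) = ENNReal.ofReal (cb N a) * ∫⁻ x, kk a (1 - ‖x‖ ^ 2) * g x := by
  have := kkn_meas N a
  rw [beta_eq N ha, lintegral_withDensity_eq_lintegral_mul _ (by fun_prop) hg]
  simp only [Pi.mul_apply, mul_assoc]
  rw [lintegral_const_mul _ (by fun_prop)]

lemma lint_sq (K : ℝ → ℝ≥0∞) : ∫⁻ u in Set.Ioi (0 : ℝ), K u =
    ∫⁻ s in Set.Ioi (0 : ℝ), ENNReal.ofReal (2 * s) * K (s ^ 2) := by
  have him : (fun s : ℝ => s ^ 2) '' Set.Ioi 0 = Set.Ioi 0 := by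
    ext u
    constructor
    · rintro ⟨s, hs, rfl⟩; exact pow_pos (Set.mem_Ioi.1 hs) 2
    · intro hu; exact ⟨√u, Real.sqrt_pos.2 hu, Real.sq_sqrt (le_of_lt hu)⟩
  have := lintegral_image_eq_lintegral_abs_deriv_mul (s := Set.Ioi (0:ℝ)) (f := fun s => s ^ 2)
    (f' := fun s => 2 * s) measurableSet_Ioi
    (fun x _ => ((hasDerivAt_pow 2 x).congr_deriv (by simp)).hasDerivWithinAt) (by
      intro x hx y hy h
      exact (sq_eq_sq₀ (le_of_lt hx) (le_of_lt hy)).1 h) K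
  rw [him] at this
  rw [this]
  refine setLIntegral_congr_fun measurableSet_Ioi fun s hs => ?_
  rw [abs_of_pos (mul_pos two_pos hs)]

lemma beta_radial (N : ℕ) {a : ℝ} (ha : 0 < a) (g : ℝ → ℝ≥0∞) (hg : Measurable g) :
    ∫⁻ x : E (N + 1), kk a (1 - ‖x‖ ^ 2) * g (‖x‖ ^ 2) =
      Cn N * ENNReal.ofReal (beta (((N : ℝ) + 1) / 2) (a / 2) / 2) *
        ∫⁻ u, g u ∂(betaMeasure (((N : ℝ) + 1) / 2) (a / 2)) := by
  have hb : 0 < beta (((N : ℝ) + 1) / 2) (a / 2) := beta_pos (by positivity) (by positivity)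
  have hk := kk_meas a
  rw [lint_radial (fun s => kk a (1 - s ^ 2) * g (s ^ 2)) (by fun_prop), mul_assoc]
  congr 1
  have hpm : Measurable (betaPDF (((N : ℝ) + 1) / 2) (a / 2)) :=
    (measurable_betaPDFReal _ _).ennreal_ofReal
  rw [betaMeasure, lintegral_withDensity_eq_lintegral_mul _ hpm hg,
    ← lintegral_const_mul _ (by fun_prop), ← lintegral_add_compl (μ := volume) _ (measurableSet_Ioi (a := (0:ℝ))),
    setLIntegral_eq_zero (measurableSet_Ioi (a := (0:ℝ))).compl, add_zero]
  conv_rhs => rw [lint_sq]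
  · refine setLIntegral_congr_fun measurableSet_Ioi fun s hs => ?_
    simp only [Pi.mul_apply]
    have hs : 0 < s := hs
    by_cases h1 : s ^ 2 < 1
    · rw [betaPDF_of_pos_lt_one (by positivity) h1, kk, if_pos (by linarith)]
      rw [← mul_assoc, ← mul_assoc, ← mul_assoc, ← ENNReal.ofReal_mul (by positivity),
        ← ENNReal.ofReal_mul (by positivity), ← ENNReal.ofReal_mul (by positivity)]
      congr 2
      rw [← Real.rpow_natCast s 2, ← Real.rpow_mul hs.le]
      rw [show ((2:ℕ):ℝ) * (((N:ℝ) + 1) / 2 - 1) = (N : ℝ) - 1 by push_cast; ring,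
        Real.rpow_sub hs, Real.rpow_one, Real.rpow_natCast, show (a - 2) / 2 = a / 2 - 1 by ring]
      field_simp
      rw [Real.rpow_natCast]; ring
    · rw [betaPDF_eq_zero_of_one_le (not_lt.1 h1), kk_nonpos (by linarith)]
      simp
  · intro u hu
    simp only [Set.mem_compl_iff, Set.mem_Ioi, not_lt] at hu
    simp [betaPDF_eq_zero_of_nonpos hu]

lemma Cn_eq (N : ℕ) : Cn N = ENNReal.ofReal (2 * π ^ (((N : ℝ) + 1) / 2) / Real.Gamma (((N : ℝ) + 1) / 2)) := by
  have hp : 0 < ((N : ℝ) + 1) / 2 := by positivity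
  unfold Cn
  rw [Measure.toSphere_apply_univ, EuclideanSpace.volume_ball]
  simp only [finrank_euclideanSpace, Fintype.card_fin, ENNReal.ofReal_one, one_pow, one_mul]
  rw [← ENNReal.ofReal_natCast, ← ENNReal.ofReal_mul (by positivity)]
  congr 1
  push_cast
  rw [Real.Gamma_add_one hp.ne', Real.sqrt_eq_rpow, ← Real.rpow_natCast, ← Real.rpow_mul pi_pos.le]
  have := (Real.Gamma_pos_of_pos hp).ne'
  push_cast
  rw [show 1 / 2 * ((N:ℝ) + 1) = ((N : ℝ) + 1) / 2 by ring]
  field_simp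

lemma beta_const (N : ℕ) {a : ℝ} (ha : 0 < a) : ENNReal.ofReal (cb (N + 1) a) *
    (Cn N * ENNReal.ofReal (beta (((N : ℝ) + 1) / 2) (a / 2) / 2)) = 1 := by
  have hp : 0 < ((N : ℝ) + 1) / 2 := by positivity
  have := (Real.Gamma_pos_of_pos hp)
  have := (Real.Gamma_pos_of_pos (show 0 < a / 2 by positivity))
  have := (Real.Gamma_pos_of_pos (show 0 < ((N : ℝ) + 1) / 2 + a / 2 by positivity))
  rw [Cn_eq, ← ENNReal.ofReal_mul (by positivity), ← ENNReal.ofReal_mul (cb_pos _ ha).le,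
    ← ENNReal.ofReal_one]
  congr 1
  unfold cb beta
  push_cast
  rw [show ((N : ℝ) + 1 + a) / 2 = ((N : ℝ) + 1) / 2 + a / 2 by ring,
    show -((N : ℝ) + 1) / 2 = - (((N : ℝ) + 1) / 2) by ring, Real.rpow_neg pi_pos.le]
  have : 0 < π ^ (((N : ℝ) + 1) / 2) := by positivity
  field_simp

lemma beta_norm_sq (N : ℕ) {a : ℝ} (ha : 0 < a) (g : ℝ → ℝ≥0∞) (hg : Measurable g) :
    ∫⁻ x, g (‖x‖ ^ 2) ∂(betaModel (N + 1) a) = ∫⁻ u, g u ∂(betaMeasure (((N : ℝ) + 1) / 2) (a / 2)) := by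
  rw [beta_lint _ ha _ (by fun_prop), beta_radial N ha g hg, ← mul_assoc, beta_const N ha, one_mul]

lemma beta_prob (N : ℕ) {a : ℝ} (ha : 0 < a) : IsProbabilityMeasure (betaModel N a) := by
  constructor
  rw [← lintegral_one]
  cases N with
  | zero =>
    rw [beta_lint _ ha _ (by fun_prop)]
    have h : (volume : Measure (E 0)) = Measure.dirac 0 := by
      exact _root_.volume_euclideanSpace_eq_dirac (Fin 0)
    have h1 : cb 0 a = 1 := by
      have := (Real.Gamma_pos_of_pos (show 0 < a / 2 by positivity)).ne'
      simp [cb, this]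
    rw [h, lintegral_dirac, h1]
    simp [kk]
  | succ N =>
    have := beta_norm_sq N ha (fun _ => 1) measurable_const
    have h := isProbabilityMeasureBeta (show 0 < ((N : ℝ) + 1) / 2 by positivity) (show 0 < a / 2 by positivity)
    rw [this]; simp

lemma beta_norm_map (N : ℕ) {a : ℝ} (ha : 0 < a) :
    (betaModel (N + 1) a).map (fun x => ‖x‖ ^ 2) = betaMeasure (((N : ℝ) + 1) / 2) (a / 2) := by
  refine Measure.ext_of_lintegral _ fun g hg => ?_
  rw [lintegral_map hg (by fun_prop), beta_norm_sq N ha g hg]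

lemma eq_of_smul {α : Type*} [MeasurableSpace α] {P Q : Measure α} [IsProbabilityMeasure P] [IsProbabilityMeasure Q]
    (c : ℝ≥0∞) (h : ∀ g : α → ℝ≥0∞, Measurable g → ∫⁻ x, g x ∂P = c * ∫⁻ x, g x ∂Q) : P = Q := by
  have h1 := h (fun _ => 1) measurable_const
  simp at h1
  refine Measure.ext_of_lintegral _ fun g hg => ?_
  rw [h g hg, ← h1, one_mul]

/-- scaling in one dimension -/
lemma lint_scale {w : ℝ} (hw : 0 < w) (F : ℝ → ℝ≥0∞) :
    ∫⁻ t, F t = ENNReal.ofReal w * ∫⁻ t, F (w * t) := by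
  have := Real.smul_map_volume_mul_left hw.ne'
  conv_lhs => rw [← this]
  rw [lintegral_smul_measure, (measurableEmbedding_mulLeft₀ hw.ne').lintegral_map, abs_of_pos hw]
  rfl

lemma beta_proj (N : ℕ) {b : ℝ} (hb : 0 < b) : (betaModel (N + 1) b).map et = betaModel N (b + 1) := by
  have := beta_prob (N + 1) hb
  have := beta_prob N (show 0 < b + 1 by linarith)
  have hk := kk_meas b
  have hm := measurable_et (N := N)
  have hm2 := measurable_ec (N := N)
  have : IsProbabilityMeasure ((betaModel (N + 1) b).map et) := Measure.isProbabilityMeasure_map hm.aemeasurable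
  have hc : 0 < cb N (b + 1) := cb_pos _ (by linarith)
  apply eq_of_smul (ENNReal.ofReal (cb (N + 1) b) * (∫⁻ t, kk b (1 - t ^ 2)) / ENNReal.ofReal (cb N (b + 1)))
  intro g hg
  rw [lintegral_map hg hm, beta_lint _ hb _ (by fun_prop), beta_lint _ (by linarith) _ hg]
  rw [lint_split' _ (by fun_prop)]
  rw [← mul_assoc, div_eq_mul_inv, mul_assoc _ _ (ENNReal.ofReal (cb N (b + 1))),
    ENNReal.inv_mul_cancel (by simpa using hc) (by simp), mul_one, mul_assoc]
  congr 1
  rw [← lintegral_const_mul]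
  swap
  · exact (kkn_meas N _).mul hg
  refine lintegral_congr fun y => ?_
  simp only [et_ec, norm_sq_ec]
  rw [lintegral_mul_const _ (by fun_prop)]
  rw [← mul_assoc]
  congr 1
  by_cases hy : 0 < 1 - ‖y‖ ^ 2
  · rw [lint_scale (Real.sqrt_pos.2 hy)]
    have : ∀ t, kk b (1 - ((√(1 - ‖y‖ ^ 2) * t) ^ 2 + ‖y‖ ^ 2)) = kk b (1 - ‖y‖ ^ 2) * kk b (1 - t ^ 2) := by
      intro t
      rw [← kk_mul hy, mul_pow, Real.sq_sqrt hy.le]; congr 1; ring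
    simp_rw [this]
    rw [lintegral_const_mul _ (by fun_prop), ← mul_assoc, mul_comm]
    congr 1
    simp only [kk, if_pos hy]
    rw [← ENNReal.ofReal_mul (by positivity), Real.sqrt_eq_rpow, ← Real.rpow_add hy]
    congr 2; ring
  · rw [kk_nonpos (not_lt.1 hy), mul_zero]
    rw [lintegral_congr (g := fun _ => 0) (fun t => kk_nonpos (by nlinarith [sq_nonneg t])), lintegral_zero]

end RS

open scoped ENNReal
namespace RS

def RotInv {N : ℕ} (μ : Measure (E N)) : Prop := ∀ U : E N ≃ₗᵢ[ℝ] E N, μ.map U = μ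

lemma rotInv_density {N : ℕ} (h : E N → ℝ≥0∞) (hm : Measurable h)
    (hr : ∀ (U : E N ≃ₗᵢ[ℝ] E N) x, h (U x) = h x) : RotInv (volume.withDensity h) := by
  intro U
  have hU : Measurable U := U.continuous.measurable
  refine Measure.ext_of_lintegral _ fun g hg => ?_
  have hgU : Measurable (fun x => g (U x)) := hg.comp hU
  rw [lintegral_map hg hU, lintegral_withDensity_eq_lintegral_mul _ hm hgU,
    lintegral_withDensity_eq_lintegral_mul _ hm hg]
  conv_rhs => rw [← U.measurePreserving.lintegral_comp_emb U.toHomeomorph.measurableEmbedding]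
  simp [hr]

lemma pi_rot {N r : ℕ} {μ : Measure (E N)} [IsProbabilityMeasure μ] (hμ : RotInv μ) (U : E N ≃ₗᵢ[ℝ] E N) :
    (Measure.pi fun _ : Fin r => μ).map (fun X i => U (X i)) = Measure.pi fun _ : Fin r => μ := by
  have hU : Measurable U := U.continuous.measurable
  have : ∀ i : Fin r, SigmaFinite (μ.map U) := fun i => by rw [hμ U]; infer_instance
  rw [Measure.pi_map_pi (fun i => hU.aemeasurable)]
  simp only [hμ U]

lemma lint_pi_succ {N r : ℕ} {μ : Measure (E N)} [IsProbabilityMeasure μ] (F : (Fin (r + 1) → E N) → ℝ≥0∞)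
    (hF : Measurable F) : ∫⁻ X, F X ∂(Measure.pi fun _ : Fin (r + 1) => μ) =
      ∫⁻ q, ∫⁻ X, F (Fin.cons q X) ∂(Measure.pi fun _ : Fin r => μ) ∂μ := by
  have h := (measurePreserving_piFinSuccAbove (fun _ : Fin (r + 1) => μ) 0).symm
  have h2 := h.lintegral_comp hF
  rw [← h2, lintegral_prod]
  · refine lintegral_congr fun q => lintegral_congr fun X => ?_
    simp [MeasurableEquiv.piFinSuccAbove_symm_apply]; rfl
  · exact (hF.comp (MeasurableEquiv.measurable _)).aemeasurable

lemma measurable_cons {N r : ℕ} : Measurable (fun q : E N × (Fin r → E N) => (Fin.cons q.1 q.2 : Fin (r + 1) → E N)) := by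
  refine measurable_pi_lambda _ fun i => ?_
  refine Fin.cases ?_ (fun i => ?_) i
  · simp; fun_prop
  · simp; fun_prop

lemma step_gen {D : ∀ {N r : ℕ}, E N → (Fin r → E N) → ℝ} (hD : GoodD @D) {N r : ℕ}
    (f h : E (N + 1) → ℝ≥0∞) (hf : Measurable f) (hh : Measurable h)
    (hfr : ∀ (U : E (N + 1) ≃ₗᵢ[ℝ] E (N + 1)) x, f (U x) = f x)
    (hhr : ∀ (U : E (N + 1) ≃ₗᵢ[ℝ] E (N + 1)) x, h (U x) = h x)
    (μ : Measure (E (N + 1))) (hμ : μ = volume.withDensity h) [IsProbabilityMeasure μ]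
    (g : E (N + 1) → ℝ → ℝ≥0∞) (hg : Measurable (fun q : E (N + 1) × ℝ => g q.1 q.2))
    (hgr : ∀ (U : E (N + 1) ≃ₗᵢ[ℝ] E (N + 1)) x d, g (U x) d = g x d) :
    ∫⁻ p, f p * ∫⁻ X, g p (D p X) ∂(Measure.pi fun _ : Fin (r + 1) => μ) =
    Cn N * ∫⁻ s in Set.Ioi (0 : ℝ), ENNReal.ofReal (s ^ N) * ∫⁻ t, ∫⁻ y, f (ec t y) * h (ec (t + s) y) *
      ∫⁻ X, g (ec t y) (s * D y X) ∂(Measure.pi fun _ : Fin r => μ.map et) := by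
  have hri : RotInv μ := hμ ▸ rotInv_density h hh hhr
  have hDm : ∀ N r, Measurable (fun q : E N × (Fin r → E N) => D q.1 q.2) := fun N r => (hD.cont N r).measurable
  have hbig : Measurable (fun q : (E (N + 1) × E (N + 1)) × (Fin r → E (N + 1)) =>
      g q.1.1 (D q.1.1 (Fin.cons q.1.2 q.2 : Fin (r + 1) → E (N + 1)))) := by
    refine hg.comp (f := fun q : (E (N + 1) × E (N + 1)) × (Fin r → E (N + 1)) =>
      (q.1.1, D q.1.1 (Fin.cons q.1.2 q.2 : Fin (r + 1) → E (N + 1)))) ?_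
    refine Measurable.prodMk (by fun_prop) ?_
    refine (hDm _ _).comp (f := fun q : (E (N + 1) × E (N + 1)) × (Fin r → E (N + 1)) =>
      (q.1.1, (Fin.cons q.1.2 q.2 : Fin (r + 1) → E (N + 1)))) ?_
    refine Measurable.prodMk (by fun_prop) ?_
    exact measurable_cons.comp (f := fun q : (E (N + 1) × E (N + 1)) × (Fin r → E (N + 1)) => (q.1.2, q.2)) (by fun_prop)
  have hI : Measurable (fun q : E (N + 1) × E (N + 1) => ∫⁻ X, g q.1 (D q.1 (Fin.cons q.2 X : Fin (r + 1) → E (N + 1)))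
      ∂(Measure.pi fun _ : Fin r => μ)) := hbig.lintegral_prod_right'
  have h1 : ∀ p, ∫⁻ X, g p (D p X) ∂(Measure.pi fun _ : Fin (r + 1) => μ) =
      ∫⁻ q, h q * ∫⁻ X, g p (D p (Fin.cons q X : Fin (r + 1) → E (N + 1))) ∂(Measure.pi fun _ : Fin r => μ) := by
    intro p
    rw [lint_pi_succ]
    · conv_lhs => rw [hμ]
      rw [lintegral_withDensity_eq_lintegral_mul _ hh]
      · simp [hμ]
      · subst hμ; exact hI.comp measurable_prodMk_left
    · exact (hg.comp measurable_prodMk_left).comp ((hDm _ _).comp measurable_prodMk_left)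
  simp_rw [h1]
  have h2 : ∀ p, f p * ∫⁻ q, h q * ∫⁻ X, g p (D p (Fin.cons q X : Fin (r + 1) → E (N + 1))) ∂(Measure.pi fun _ : Fin r => μ)
     = ∫⁻ q, f p * h q * ∫⁻ X, g p (D p (Fin.cons q X : Fin (r + 1) → E (N + 1))) ∂(Measure.pi fun _ : Fin r => μ) := by
    intro p
    simp_rw [mul_assoc]
    exact (lintegral_const_mul _ (hh.mul (hI.comp measurable_prodMk_left))).symm
  simp_rw [h2]
  rw [lint_elim]
  · congr 1
    refine setLIntegral_congr_fun measurableSet_Ioi fun s hs => ?_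
    congr 1
    refine lintegral_congr fun t => lintegral_congr fun y => ?_
    congr 1
    have he : Measurable (et (N := N)) := measurable_et
    have := Measure.isProbabilityMeasure_map (μ := μ) he.aemeasurable
    rw [← Measure.pi_map_pi (fun i => he.aemeasurable), lintegral_map]
    · refine lintegral_congr fun X => ?_
      rw [hD.elim _ _ _ _ _ _ (le_of_lt hs)]
    · refine (hg.comp measurable_prodMk_left).comp (((hDm _ _).comp measurable_prodMk_left).const_mul _)
    · fun_prop
  · exact ((hf.comp measurable_fst).mul (hh.comp measurable_snd)).mul hI
  · intro U p q
    rw [hfr, hhr]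
    congr 1
    have hU : Measurable U := U.continuous.measurable
    conv_lhs => rw [← pi_rot hri U]
    rw [lintegral_map]
    · refine lintegral_congr fun X => ?_
      rw [hgr, ← hD.rot _ _ U p]
      congr 2
      ext1 i
      refine Fin.cases ?_ (fun i => ?_) i <;> simp
    · exact hbig.comp (measurable_prodMk_left (x := (U p, U q)))
    · fun_prop

end RS

open scoped ENNReal
namespace RS

noncomputable def Q (D : ∀ {N r : ℕ}, E N → (Fin r → E N) → ℝ) (N r κ : ℕ) (a b : ℝ) : Measure ℝ :=
  ((betaModel N a).prod (Measure.pi fun _ : Fin r => betaModel N b)).map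
    (fun q => √(1 - ‖q.1‖ ^ 2) ^ κ * D q.1 q.2)

noncomputable def T0 (N κ : ℕ) (a b : ℝ) : Measure ℝ :=
  (((volume.restrict (Set.Ioi (0 : ℝ))).prod (volume : Measure ℝ)).withDensity
    (fun z => ENNReal.ofReal (z.1 ^ N) * kk a (1 - z.2 ^ 2) * kk b (1 - (z.2 + z.1) ^ 2))).map
    (fun z => √(1 - z.2 ^ 2) ^ κ * z.1)

instance (N κ : ℕ) (a b : ℝ) : SFinite (T0 N κ a b) := by unfold T0; infer_instance

lemma T0_dens_meas (N : ℕ) (a b : ℝ) : Measurable (fun z : ℝ × ℝ => ENNReal.ofReal (z.1 ^ N) * kk a (1 - z.2 ^ 2) * kk b (1 - (z.2 + z.1) ^ 2)) := by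
  have := kk_meas a
  have := kk_meas b
  fun_prop

lemma T0_lint (N κ : ℕ) (a b : ℝ) (g : ℝ → ℝ≥0∞) (hg : Measurable g) :
    ∫⁻ x, g x ∂(T0 N κ a b) = ∫⁻ s in Set.Ioi (0 : ℝ), ∫⁻ t, ENNReal.ofReal (s ^ N) * kk a (1 - t ^ 2) *
      kk b (1 - (t + s) ^ 2) * g (√(1 - t ^ 2) ^ κ * s) := by
  have := kk_meas a
  have := kk_meas b
  unfold T0
  rw [lintegral_map hg (by fun_prop), lintegral_withDensity_eq_lintegral_mul _ (T0_dens_meas N a b) (by fun_prop),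
    lintegral_prod _ (Measurable.aemeasurable ((T0_dens_meas N a b).mul (by fun_prop)))]
  rfl

lemma T0_pos (N κ : ℕ) (a b : ℝ) : T0 N κ a b (Set.Iic 0) = 0 := by
  rw [← lintegral_indicator_one measurableSet_Iic, T0_lint _ _ _ _ _ (by fun_prop (disch := exact measurableSet_Iic))]
  rw [setLIntegral_congr_fun measurableSet_Ioi (g := fun _ => 0), lintegral_zero]
  intro s hs
  refine (lintegral_congr (g := fun _ => 0) ?_).trans lintegral_zero
  intro t
  by_cases ht : 0 < 1 - t ^ 2
  · have : 0 < √(1 - t ^ 2) ^ κ * s := by have : 0 < s := hs; positivity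
    rw [Set.indicator_of_notMem (by simpa using this), mul_zero]
  · rw [kk_nonpos (not_lt.1 ht)]; simp

section
variable {D : ∀ {N r : ℕ}, E N → (Fin r → E N) → ℝ}

lemma Q_meas (hD : GoodD @D) (N r κ : ℕ) : Measurable (fun q : E N × (Fin r → E N) => √(1 - ‖q.1‖ ^ 2) ^ κ * D q.1 q.2) := by
  have := (hD.cont N r).measurable
  fun_prop

lemma Q_prob (hD : GoodD @D) (N r κ : ℕ) {a b : ℝ} (ha : 0 < a) (hb : 0 < b) : IsProbabilityMeasure (Q @D N r κ a b) := by
  have := beta_prob N ha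
  have := beta_prob N hb
  exact Measure.isProbabilityMeasure_map (Q_meas hD N r κ).aemeasurable

lemma Q_lint (hD : GoodD @D) (N r κ : ℕ) {a b : ℝ} (ha : 0 < a) (hb : 0 < b) (g : ℝ → ℝ≥0∞) (hg : Measurable g) :
    ∫⁻ x, g x ∂(Q @D N r κ a b) = ENNReal.ofReal (cb N a) * ∫⁻ p, kk a (1 - ‖p‖ ^ 2) *
      ∫⁻ X, g (√(1 - ‖p‖ ^ 2) ^ κ * D p X) ∂(Measure.pi fun _ : Fin r => betaModel N b) := by
  have := beta_prob N ha
  have := beta_prob N hb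
  have hm := Q_meas hD N r κ
  unfold Q
  rw [lintegral_map hg hm, lintegral_prod (fun q : E N × (Fin r → E N) => g (√(1 - ‖q.1‖ ^ 2) ^ κ * D q.1 q.2)) (hg.comp hm).aemeasurable]
  exact beta_lint N ha _ (hg.comp hm).lintegral_prod_right'

lemma beta_step_aux (hD : GoodD @D) (N r κ : ℕ) {a b : ℝ} (ha : 0 < a) (hb : 0 < b) (g : ℝ → ℝ≥0∞) (hg : Measurable g) :
    ∫⁻ x, g x ∂(Q @D (N + 1) (r + 1) κ a b) =
    ENNReal.ofReal (cb (N + 1) a) * (Cn N * ENNReal.ofReal (cb (N + 1) b) *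
     ∫⁻ y, kk (a + b + N) (1 - ‖y‖ ^ 2) * ∫⁻ X, ∫⁻ x, g (x * (√(1 - ‖y‖ ^ 2) ^ (κ + 1) * D y X)) ∂(T0 N κ a b)
      ∂(Measure.pi fun _ : Fin r => betaModel N (b + 1))) := by
  have := beta_prob (N + 1) ha
  have := beta_prob (N + 1) hb
  have := beta_prob N (show 0 < b + 1 by linarith)
  have hka := kk_meas a
  have hkb := kk_meas b
  have hec := measurable_ec (N := N)
  have hDm := (hD.cont N r).measurable
  rw [Q_lint hD _ _ _ ha hb _ hg]
  congr 1
  rw [step_gen hD (fun p => kk a (1 - ‖p‖ ^ 2)) (fun x => ENNReal.ofReal (cb (N + 1) b) * kk b (1 - ‖x‖ ^ 2))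
    (by fun_prop) (by fun_prop) (by simp) (by simp) _ (beta_eq (N + 1) hb)
    (fun p d => g (√(1 - ‖p‖ ^ 2) ^ κ * d)) (by fun_prop) (by simp)]
  rw [beta_proj N hb, mul_assoc]
  congr 1
  -- bring y outside
  have hI : Measurable (fun z : (ℝ × ℝ) × E N => ∫⁻ X, g (√(1 - (z.1.2 ^ 2 + ‖z.2‖ ^ 2)) ^ κ * (z.1.1 * D z.2 X))
     ∂(Measure.pi fun _ : Fin r => betaModel N (b + 1))) := by
    refine Measurable.lintegral_prod_right' (f := fun w : ((ℝ × ℝ) × E N) × (Fin r → E N) =>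
      g (√(1 - (w.1.1.2 ^ 2 + ‖w.1.2‖ ^ 2)) ^ κ * (w.1.1.1 * D w.1.2 w.2))) ?_
    have : Measurable (fun w : ((ℝ × ℝ) × E N) × (Fin r → E N) => D w.1.2 w.2) :=
      hDm.comp (f := fun w : ((ℝ × ℝ) × E N) × (Fin r → E N) => (w.1.2, w.2)) (by fun_prop)
    fun_prop
  set I : (ℝ × ℝ) × E N → ℝ≥0∞ := (fun z : (ℝ × ℝ) × E N => ∫⁻ X, g (√(1 - (z.1.2 ^ 2 + ‖z.2‖ ^ 2)) ^ κ * (z.1.1 * D z.2 X))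
     ∂(Measure.pi fun _ : Fin r => betaModel N (b + 1))) with hIdef
  have hL : ∀ s : ℝ, ENNReal.ofReal (s ^ N) * ∫⁻ t, ∫⁻ y, kk a (1 - ‖ec t y‖ ^ 2) * (ENNReal.ofReal (cb (N + 1) b) * kk b (1 - ‖ec (t + s) y‖ ^ 2)) *
      ∫⁻ X, g (√(1 - ‖ec t y‖ ^ 2) ^ κ * (s * D y X)) ∂(Measure.pi fun _ : Fin r => betaModel N (b + 1))
      = ENNReal.ofReal (cb (N + 1) b) * ∫⁻ y, ∫⁻ t, ENNReal.ofReal (s ^ N) * (kk a (1 - (t ^ 2 + ‖y‖ ^ 2)) * kk b (1 - ((t + s) ^ 2 + ‖y‖ ^ 2)) *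
        I ((s, t), y)) := by
    intro s
    simp only [norm_sq_ec]
    rw [lintegral_lintegral_swap, ← lintegral_const_mul, ← lintegral_const_mul]
    · refine lintegral_congr fun y => ?_
      rw [← lintegral_const_mul, ← lintegral_const_mul]
      · refine lintegral_congr fun t => ?_
        ring
      · fun_prop
      · fun_prop
    · refine Measurable.lintegral_prod_right' (f := fun w : E N × ℝ =>  ENNReal.ofReal (s ^ N) * (kk a (1 - (w.2 ^ 2 + ‖w.1‖ ^ 2)) * kk b (1 - ((w.2 + s) ^ 2 + ‖w.1‖ ^ 2)) *
        I ((s, w.2), w.1))) ?_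
      fun_prop
    · refine Measurable.lintegral_prod_right' (f := fun w : E N × ℝ => kk a (1 - (w.2 ^ 2 + ‖w.1‖ ^ 2)) * (ENNReal.ofReal (cb (N + 1) b) * kk b (1 - ((w.2 + s) ^ 2 + ‖w.1‖ ^ 2))) *
        I ((s, w.2), w.1)) ?_
      fun_prop
    · refine Measurable.aemeasurable ?_
      change Measurable (fun w : ℝ × E N => kk a (1 - (w.1 ^ 2 + ‖w.2‖ ^ 2)) * (ENNReal.ofReal (cb (N + 1) b) * kk b (1 - ((w.1 + s) ^ 2 + ‖w.2‖ ^ 2))) *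
        I ((s, w.1), w.2))
      fun_prop
  have hJ : Measurable (fun w : ℝ × E N => ∫⁻ t, ENNReal.ofReal (w.1 ^ N) * (kk a (1 - (t ^ 2 + ‖w.2‖ ^ 2)) * kk b (1 - ((t + w.1) ^ 2 + ‖w.2‖ ^ 2)) *
        I ((w.1, t), w.2))) := by
    refine Measurable.lintegral_prod_right' (f := fun w : (ℝ × E N) × ℝ =>  ENNReal.ofReal (w.1.1 ^ N) * (kk a (1 - (w.2 ^ 2 + ‖w.1.2‖ ^ 2)) * kk b (1 - ((w.2 + w.1.1) ^ 2 + ‖w.1.2‖ ^ 2)) *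
        I ((w.1.1, w.2), w.1.2))) ?_
    fun_prop
  rw [lintegral_congr hL, lintegral_const_mul _ hJ.lintegral_prod_right', lintegral_lintegral_swap hJ.aemeasurable]
  congr 1
  refine lintegral_congr fun y => ?_
  by_cases hy : 0 < 1 - ‖y‖ ^ 2
  swap
  · rw [kk_nonpos (not_lt.1 hy), zero_mul]
    have : ∀ s t : ℝ, ENNReal.ofReal (s ^ N) * (kk a (1 - (t ^ 2 + ‖y‖ ^ 2)) * kk b (1 - ((t + s) ^ 2 + ‖y‖ ^ 2)) *
        I ((s, t), y)) = 0 := fun s t => by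
      rw [kk_nonpos (by nlinarith [sq_nonneg t])]; simp
    simp_rw [this]; simp
  set w := 1 - ‖y‖ ^ 2 with hw
  have hsw := Real.sqrt_pos.2 hy
  have hsq := Real.sq_sqrt hy.le
  have hT : ∀ X : Fin r → E N, ∫⁻ x, g (x * (√w ^ (κ + 1) * D y X)) ∂(T0 N κ a b) =
      ∫⁻ s in Set.Ioi (0 : ℝ), ∫⁻ t, ENNReal.ofReal (s ^ N) * kk a (1 - t ^ 2) *
      kk b (1 - (t + s) ^ 2) * g (√(1 - t ^ 2) ^ κ * s * (√w ^ (κ + 1) * D y X)) :=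
    fun X => T0_lint _ _ _ _ (fun x => g (x * (√w ^ (κ + 1) * D y X))) (by fun_prop)
  simp_rw [hT]
  have hDy : Measurable (fun X => D (r := r) y X) := hDm.comp measurable_prodMk_left
  have hmm : Measurable (fun z : ((Fin r → E N) × ℝ) × ℝ => ENNReal.ofReal (z.1.2 ^ N) * kk a (1 - z.2 ^ 2) *
      kk b (1 - (z.2 + z.1.2) ^ 2) * g (√(1 - z.2 ^ 2) ^ κ * z.1.2 * (√w ^ (κ + 1) * D y z.1.1))) := by fun_prop
  have hsw0 := lintegral_lintegral_swap (μ := Measure.pi fun _ : Fin r => betaModel N (b + 1))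
    (ν := volume.restrict (Set.Ioi (0 : ℝ))) (f := fun X s => ∫⁻ t, ENNReal.ofReal (s ^ N) * kk a (1 - t ^ 2) *
      kk b (1 - (t + s) ^ 2) * g (√(1 - t ^ 2) ^ κ * s * (√w ^ (κ + 1) * D y X)))
      (Measurable.aemeasurable hmm.lintegral_prod_right')
  rw [hsw0]
  have hsw1 : ∀ s : ℝ, ∫⁻ X, (∫⁻ t, ENNReal.ofReal (s ^ N) * kk a (1 - t ^ 2) *
      kk b (1 - (t + s) ^ 2) * g (√(1 - t ^ 2) ^ κ * s * (√w ^ (κ + 1) * D y X))) ∂(Measure.pi fun _ : Fin r => betaModel N (b + 1)) =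
      ∫⁻ t, ENNReal.ofReal (s ^ N) * kk a (1 - t ^ 2) *
      kk b (1 - (t + s) ^ 2) * I ((√w * s, √w * t), y) := by
    intro s
    rw [lintegral_lintegral_swap]
    · refine lintegral_congr fun t => ?_
      rw [lintegral_const_mul _ (by fun_prop)]
      congr 1
      refine lintegral_congr fun X => ?_
      congr 1
      have : 1 - ((√w * t) ^ 2 + ‖y‖ ^ 2) = w * (1 - t ^ 2) := by rw [mul_pow, hsq, hw]; ring
      simp only [this, Real.sqrt_mul hy.le]
      ring
    · refine Measurable.aemeasurable ?_
      exact hmm.comp (g := fun z : ((Fin r → E N) × ℝ) × ℝ => ENNReal.ofReal (z.1.2 ^ N) * kk a (1 - z.2 ^ 2) *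
      kk b (1 - (z.2 + z.1.2) ^ 2) * g (√(1 - z.2 ^ 2) ^ κ * z.1.2 * (√w ^ (κ + 1) * D y z.1.1))) (f := fun q : (Fin r → E N) × ℝ => ((q.1, s), q.2)) (by fun_prop)
  rw [lintegral_congr hsw1]
  rw [← lintegral_indicator measurableSet_Ioi, lint_scale hsw, ← lintegral_indicator measurableSet_Ioi,
    ← lintegral_const_mul, ← lintegral_const_mul]
  · refine lintegral_congr fun s => ?_
    by_cases hs : 0 < s
    · rw [Set.indicator_of_mem (by simpa using mul_pos hsw hs), Set.indicator_of_mem (by simpa using hs),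
        lint_scale hsw, ← mul_assoc, ← lintegral_const_mul, ← lintegral_const_mul]
      · refine lintegral_congr fun t => ?_
        have h1 : 1 - ((√w * t) ^ 2 + ‖y‖ ^ 2) = w * (1 - t ^ 2) := by rw [mul_pow, hsq, hw]; ring
        have h2 : 1 - ((√w * t + √w * s) ^ 2 + ‖y‖ ^ 2) = w * (1 - (t + s) ^ 2) := by
          rw [← mul_add, mul_pow, hsq, hw]; ring
        rw [h1, h2, kk_mul hy, kk_mul hy, mul_pow, ENNReal.ofReal_mul (by positivity)]
        have h3 : kk (a + b + N) w = ENNReal.ofReal √w * ENNReal.ofReal √w * ENNReal.ofReal (√w ^ N) * kk a w * kk b w := by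
          simp only [kk, if_pos hy]
          rw [← ENNReal.ofReal_mul (by positivity), ← ENNReal.ofReal_mul (by positivity),
            ← ENNReal.ofReal_mul (by positivity), ← ENNReal.ofReal_mul (by positivity)]
          congr 1
          rw [Real.mul_self_sqrt hy.le, Real.sqrt_eq_rpow, ← Real.rpow_natCast, ← Real.rpow_mul hy.le]
          nth_rw 2 [← Real.rpow_one w]
          rw [← Real.rpow_add hy, ← Real.rpow_add hy, ← Real.rpow_add hy]
          congr 1; ring
        rw [h3]; ring
      · fun_prop
      · fun_prop
    · rw [Set.indicator_of_notMem, Set.indicator_of_notMem (by simpa using hs)]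
      · simp
      · simp only [Set.mem_Ioi, not_lt]; exact mul_nonpos_of_nonneg_of_nonpos hsw.le (not_lt.1 hs)
  · refine Measurable.indicator ?_ measurableSet_Ioi
    refine Measurable.lintegral_prod_right' (f := fun q : ℝ × ℝ => ENNReal.ofReal (q.1 ^ N) * kk a (1 - q.2 ^ 2) *
      kk b (1 - (q.2 + q.1) ^ 2) * I ((√w * q.1, √w * q.2), y)) ?_
    fun_prop
  · refine Measurable.comp (g := (Set.Ioi (0:ℝ)).indicator _) ?_ (by fun_prop)
    refine Measurable.indicator ?_ measurableSet_Ioi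
    exact hJ.comp (f := fun s : ℝ => (s, y)) (by fun_prop)
end
end RS

open scoped ENNReal
namespace RS

def Pos (P : Measure ℝ) : Prop := P (Set.Iic 0) = 0

lemma Pos.ae {P : Measure ℝ} (h : Pos P) : ∀ᵐ x ∂P, 0 < x := by
  rw [ae_iff]; simpa [Pos, Set.Iic] using h

lemma Pos.of_ae {P : Measure ℝ} (h : ∀ᵐ x ∂P, 0 < x) : Pos P := by
  rw [ae_iff] at h; simpa [Pos, Set.Iic] using h

lemma pos_mconv {P R : Measure ℝ} [IsProbabilityMeasure P] [IsProbabilityMeasure R] (hP : Pos P) (hR : Pos R) :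
    Pos (P.mconv R) := by
  apply Pos.of_ae
  unfold Measure.mconv
  rw [ae_map_iff (by fun_prop) measurableSet_Ioi]
  have h1 : ∀ᵐ z ∂(P.prod R), 0 < z.1 := Measure.quasiMeasurePreserving_fst.ae hP.ae
  have h2 : ∀ᵐ z ∂(P.prod R), 0 < z.2 := Measure.quasiMeasurePreserving_snd.ae hR.ae
  filter_upwards [h1, h2] with z h1 h2 using mul_pos h1 h2

lemma log_mconv {P R : Measure ℝ} [IsProbabilityMeasure P] [IsProbabilityMeasure R] (hP : Pos P) (hR : Pos R) :
    (P.mconv R).map Real.log = (P.map Real.log).conv (R.map Real.log) := by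
  have : IsProbabilityMeasure (P.map Real.log) := Measure.isProbabilityMeasure_map (by fun_prop)
  have : IsProbabilityMeasure (R.map Real.log) := Measure.isProbabilityMeasure_map (by fun_prop)
  have hl := Real.measurable_log
  refine Measure.ext_of_lintegral _ fun g hg => ?_
  have hm : Measurable (fun x => ∫⁻ y, g (x + y) ∂(R.map Real.log)) := 
    Measurable.lintegral_prod_right' (f := fun q : ℝ × ℝ => g (q.1 + q.2)) (by fun_prop)
  rw [lintegral_map hg hl, Measure.lintegral_mconv (by fun_prop), Measure.lintegral_conv hg,
    lintegral_map hm hl]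
  refine lintegral_congr_ae ?_
  filter_upwards [hP.ae] with x hx
  rw [lintegral_map (by fun_prop) hl]
  refine lintegral_congr_ae ?_
  filter_upwards [hR.ae] with y hy
  rw [Real.log_mul hx.ne' hy.ne']

lemma beta_step_all (N κ : ℕ) {a b : ℝ} (ha : 0 < a) (hb : 0 < b) : ∃ T : Measure ℝ, IsProbabilityMeasure T ∧ Pos T ∧
    ∀ (D : ∀ {N r : ℕ}, E N → (Fin r → E N) → ℝ), GoodD @D → ∀ r,
      Q @D (N + 1) (r + 1) κ a b = Measure.mconv T (Q @D N r (κ + 1) (a + b + N) (b + 1)) := by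
  have hab : 0 < a + b + N := by positivity
  have hb1 : 0 < b + 1 := by positivity
  set c : ℝ≥0∞ := ENNReal.ofReal (cb (N + 1) a) * (Cn N * ENNReal.ofReal (cb (N + 1) b)) * (ENNReal.ofReal (cb N (a + b + N)))⁻¹ with hc
  have hcb := cb_pos N hab
  have key : ∀ (D : ∀ {N r : ℕ}, E N → (Fin r → E N) → ℝ), GoodD @D → ∀ r, ∀ g : ℝ → ℝ≥0∞, Measurable g →
      ∫⁻ x, g x ∂(Q @D (N + 1) (r + 1) κ a b) = c * ∫⁻ d, ∫⁻ x, g (x * d) ∂(T0 N κ a b) ∂(Q @D N r (κ + 1) (a + b + N) (b + 1)) := by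
    intro D hD r g hg
    rw [beta_step_aux hD N r κ ha hb g hg]
    have hm : Measurable (fun d => ∫⁻ x, g (x * d) ∂(T0 N κ a b)) :=
      Measurable.lintegral_prod_right' (f := fun q : ℝ × ℝ => g (q.2 * q.1)) (by fun_prop)
    rw [Q_lint hD N r (κ + 1) hab hb1 _ hm, hc, ← mul_assoc, mul_assoc _ (ENNReal.ofReal (cb N (a + b + N)))⁻¹,
      ← mul_assoc (ENNReal.ofReal (cb N (a + b + N)))⁻¹,
      ENNReal.inv_mul_cancel (by simpa using hcb) (by simp), one_mul]
  have hT : IsProbabilityMeasure (c • T0 N κ a b) := by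
    constructor
    have := Q_prob goodDV (N + 1) (0 + 1) κ ha hb
    have := Q_prob goodDV N 0 (κ + 1) hab hb1
    have h := key @DV goodDV 0 (fun _ => 1) measurable_const
    simp at h
    simpa using h.symm
  refine ⟨c • T0 N κ a b, hT, ?_, ?_⟩
  · simp [Pos, T0_pos]
  · intro D hD r
    have := Q_prob hD N r (κ + 1) hab hb1
    rw [Measure.mconv_comm]
    refine Measure.ext_of_lintegral _ fun g hg => ?_
    rw [key D hD r g hg, Measure.lintegral_mconv hg]
    simp_rw [lintegral_smul_measure, smul_eq_mul]
    rw [lintegral_const_mul]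
    · simp_rw [mul_comm]
    · exact Measurable.lintegral_prod_right' (f := fun q : ℝ × ℝ => g (q.1 * q.2)) (by fun_prop)

noncomputable def QL (D : ∀ {N r : ℕ}, E N → (Fin r → E N) → ℝ) (N r κ : ℕ) (a b : ℝ) : Measure ℝ :=
  (Q @D N r κ a b).map Real.log

lemma QL_prob {D : ∀ {N r : ℕ}, E N → (Fin r → E N) → ℝ} (hD : GoodD @D) (N r κ : ℕ) {a b : ℝ} (ha : 0 < a) (hb : 0 < b) : IsProbabilityMeasure (QL @D N r κ a b) := by
  have := Q_prob hD N r κ ha hb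
  exact Measure.isProbabilityMeasure_map (by fun_prop)

lemma elim_all (r : ℕ) : ∀ (N κ : ℕ) (a b : ℝ), 0 < a → 0 < b → ∃ M : Measure ℝ, IsProbabilityMeasure M ∧
    ∀ (D : ∀ {N r : ℕ}, E N → (Fin r → E N) → ℝ), GoodD @D → ∀ k,
      Pos (Q @D N k (κ + r) (a + r * (b + N + r - 1)) (b + r)) →
      Pos (Q @D (N + r) (k + r) κ a b) ∧
      QL @D (N + r) (k + r) κ a b = M.conv (QL @D N k (κ + r) (a + r * (b + N + r - 1)) (b + r)) := by
  induction r with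
  | zero =>
    intro N κ a b ha hb
    refine ⟨Measure.dirac 0, inferInstance, fun D hD k h => ?_⟩
    have := QL_prob hD N k κ ha hb
    simp only [Nat.cast_zero, zero_mul, add_zero] at h ⊢
    exact ⟨h, (Measure.dirac_zero_conv _).symm⟩
  | succ r ih =>
    intro N κ a b ha hb
    have hab : 0 < a + b + (N + r : ℕ) := by positivity
    have hb1 : 0 < b + 1 := by positivity
    obtain ⟨M, hM, h1⟩ := ih N (κ + 1) _ _ hab hb1
    obtain ⟨T, hT, hTp, h2⟩ := beta_step_all (N + r) κ ha hb
    have : IsProbabilityMeasure (T.map Real.log) := Measure.isProbabilityMeasure_map (by fun_prop)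
    refine ⟨(T.map Real.log).conv M, inferInstance, fun D hD k h => ?_⟩
    have e1 : a + (r + 1 : ℕ) * (b + N + (r + 1 : ℕ) - 1) = a + b + (N + r : ℕ) + r * (b + 1 + N + r - 1) := by
      push_cast; ring
    have e2 : b + (r + 1 : ℕ) = b + 1 + r := by push_cast; ring
    have e3 : κ + (r + 1) = κ + 1 + r := by ring
    rw [e1, e2, e3] at h ⊢
    obtain ⟨h3, h4⟩ := h1 D hD k h
    have h5 := h2 D hD (k + r)
    have := Q_prob hD (N + r) (k + r) (κ + 1) hab hb1
    change Pos (Q @D (N + r + 1) (k + r + 1) κ a b) ∧ QL @D (N + r + 1) (k + r + 1) κ a b = _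
    rw [QL, h5]
    refine ⟨pos_mconv hTp h3, ?_⟩
    have hpp : 0 < a + b + (N + r : ℕ) + r * (b + 1 + N + r - 1) := by
      have : 0 ≤ b + 1 + N + r - 1 := by have : (0:ℝ) ≤ N := by positivity
                                         have : (0:ℝ) ≤ r := by positivity
                                         linarith
      positivity
    have := QL_prob hD N k (κ + 1 + r) hpp (show 0 < b + 1 + r by positivity)
    rw [log_mconv hTp h3, Measure.conv_assoc, ← h4, QL]

end RS

open scoped ENNReal
namespace RS

noncomputable def ab (A B u v : ℝ) : Measure ℝ := (betaMeasure A B).map (fun x => u * Real.log x + v * Real.log (1 - x))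

lemma ab_prob {A B : ℝ} (hA : 0 < A) (hB : 0 < B) (u v : ℝ) : IsProbabilityMeasure (ab A B u v) := by
  have := isProbabilityMeasureBeta hA hB
  exact Measure.isProbabilityMeasure_map (by fun_prop)

lemma ab_charFun {A B : ℝ} (hA : 0 < A) (hB : 0 < B) (u v t : ℝ) :
    charFun (ab A B u v) t * charFun ((lg (A + B)).map (fun x => (u + v) * x)) t =
     charFun (((lg A).map (fun x => u * x)).conv ((lg B).map (fun x => v * x))) t := by
  have h1 := lg_prob hA
  have h2 := lg_prob hB
  have h3 := lg_prob (add_pos hA hB)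
  have : IsProbabilityMeasure ((lg A).map (fun x => u * x)) := Measure.isProbabilityMeasure_map (by fun_prop)
  have : IsProbabilityMeasure ((lg B).map (fun x => v * x)) := Measure.isProbabilityMeasure_map (by fun_prop)
  rw [charFun_conv, charFun_map_mul, charFun_map_mul, charFun_map_mul, ← beta_joint' hA hB,
    charFun_apply_real, ab, integral_map (by fun_prop) (by fun_prop), ← add_mul]
  congr 2
  ext1 x
  congr 1
  push_cast; ring

lemma ab_stats {A B : ℝ} (hA : 0 < A) (hB : 0 < B) (u v : ℝ) : L2 (ab A B u v) ∧
    var (ab A B u v) = u ^ 2 * psi1 A + v ^ 2 * psi1 B - (u + v) ^ 2 * psi1 (A + B) := by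
  have h1 := lg_prob hA
  have h2 := lg_prob hB
  have h3 := lg_prob (add_pos hA hB)
  have := ab_prob hA hB u v
  have : IsProbabilityMeasure ((lg A).map (fun x => u * x)) := Measure.isProbabilityMeasure_map (by fun_prop)
  have : IsProbabilityMeasure ((lg B).map (fun x => v * x)) := Measure.isProbabilityMeasure_map (by fun_prop)
  have : IsProbabilityMeasure ((lg (A + B)).map (fun x => (u + v) * x)) := Measure.isProbabilityMeasure_map (by fun_prop)
  have s1 := scale_stats u (lg_L2 hA)
  have s2 := scale_stats v (lg_L2 hB)
  have s3 := scale_stats (u + v) (lg_L2 (add_pos hA hB))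
  have hc := conv_L2 s1.1 s2.1
  have hd := deconv (ab_charFun hA hB u v) s3.1 hc.1
  refine ⟨hd.1, ?_⟩
  have := hd.2.2
  rw [hc.2.2, s1.2.2.1, s2.2.2.1, s3.2.2.1] at this
  unfold psi1
  linarith

lemma beta_ae (A B : ℝ) : ∀ᵐ x ∂(betaMeasure A B), 0 < x ∧ x < 1 := by
  have hm : Measurable (betaPDF A B) := (measurable_betaPDFReal A B).ennreal_ofReal
  rw [betaMeasure, ae_withDensity_iff hm]
  filter_upwards with x hx
  by_contra h
  apply hx
  simp [betaPDF, betaPDFReal, h]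

lemma base_pos (N : ℕ) {a : ℝ} (ha : 0 < a) : ∀ᵐ y ∂(betaModel (N + 1) a), 0 < ‖y‖ ∧ 0 < 1 - ‖y‖ ^ 2 := by
  have h := beta_ae (((N : ℝ) + 1) / 2) (a / 2)
  rw [← beta_norm_map N ha] at h
  filter_upwards [ae_of_ae_map (by fun_prop) h] with y hy
  refine ⟨?_, by linarith [hy.2]⟩
  by_contra h0
  have : ‖y‖ = 0 := le_antisymm (not_lt.1 h0) (norm_nonneg _)
  simp [this] at hy

lemma Q_zero {D : ∀ {N r : ℕ}, E N → (Fin r → E N) → ℝ} (hD : GoodD @D) (N κ : ℕ) {a b : ℝ} (ha : 0 < a) (hb : 0 < b) (G : E N → ℝ)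
    (hG : ∀ p X, D (r := 0) p X = G p) (hGm : Measurable G) :
    Q @D N 0 κ a b = (betaModel N a).map (fun p => √(1 - ‖p‖ ^ 2) ^ κ * G p) := by
  have := beta_prob N ha
  have := beta_prob N hb
  unfold Q
  simp_rw [hG]
  have := Measure.map_map (μ := (betaModel N a).prod (Measure.pi fun _ : Fin 0 => betaModel N b)) 
    (g := (fun p : E N => √(1 - ‖p‖ ^ 2) ^ κ * G p)) (f := Prod.fst) (by fun_prop) measurable_fst
  rw [Measure.map_fst_prod] at this
  simp at this
  rw [this]; rfl

lemma DV_zero {N : ℕ} (p : E N) (X : Fin 0 → E N) : DV p X = 1 := by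
  unfold DV; exact Dn_zero _

lemma DO_zero {N : ℕ} (p : E N) (X : Fin 0 → E N) : DO p X = ‖p‖ := by
  unfold DO; rw [Dn_one]; rfl

lemma QV_zero_pos (N κ : ℕ) {a b : ℝ} (ha : 0 < a) (hb : 0 < b) : Pos (Q @DV N 0 κ a b) := by
  rw [Q_zero goodDV N κ ha hb (fun _ => 1) DV_zero measurable_const]
  apply Pos.of_ae
  rw [ae_map_iff (by fun_prop) measurableSet_Ioi]
  rcases N with _ | N
  · refine ae_of_all _ fun x => ?_
    have : x = 0 := Subsingleton.elim _ _
    simp [this]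
  · filter_upwards [base_pos N ha] with y hy
    have := hy.2
    positivity

lemma QO_zero_pos (N κ : ℕ) {a b : ℝ} (ha : 0 < a) (hb : 0 < b) : Pos (Q @DO (N + 1) 0 κ a b) := by
  rw [Q_zero goodDO (N + 1) κ ha hb (fun x => ‖x‖) DO_zero measurable_norm]
  apply Pos.of_ae
  rw [ae_map_iff (by fun_prop) measurableSet_Ioi]
  filter_upwards [base_pos N ha] with y hy
  have := hy.2
  have := hy.1
  positivity

lemma QV_pos (N k κ : ℕ) {a b : ℝ} (ha : 0 < a) (hb : 0 < b) : Pos (Q @DV (N + k) k κ a b) := by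
  obtain ⟨M, hM, h⟩ := elim_all k N κ a b ha hb
  have := (h @DV goodDV 0 (QV_zero_pos _ _ ?_ (by positivity))).1
  · simpa using this
  · rcases k with _ | k
    · simpa using ha
    · have : 0 ≤ b + N + (k + 1 : ℕ) - 1 := by push_cast; have : (0:ℝ) ≤ N := by positivity
                                               have : (0:ℝ) ≤ k := by positivity
                                               linarith
      positivity

lemma QLV_zero (N κ : ℕ) {a b : ℝ} (ha : 0 < a) (hb : 0 < b) :
    QL @DV (N + 1) 0 κ a b = ab (((N : ℝ) + 1) / 2) (a / 2) 0 (κ / 2) := by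
  rw [QL, Q_zero goodDV (N + 1) κ ha hb (fun _ => 1) DV_zero measurable_const, ab, ← beta_norm_map N ha,
    Measure.map_map (by fun_prop) (by fun_prop), Measure.map_map (by fun_prop) (by fun_prop)]
  refine Measure.map_congr ?_
  filter_upwards [base_pos N ha] with y hy
  simp only [Function.comp]
  rw [mul_one, Real.log_pow, Real.log_sqrt hy.2.le]; ring

lemma QLO_zero (N κ : ℕ) {a b : ℝ} (ha : 0 < a) (hb : 0 < b) :
    QL @DO (N + 1) 0 κ a b = ab (((N : ℝ) + 1) / 2) (a / 2) (1 / 2) (κ / 2) := by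
  rw [QL, Q_zero goodDO (N + 1) κ ha hb (fun x => ‖x‖) DO_zero measurable_norm, ab, ← beta_norm_map N ha,
    Measure.map_map (by fun_prop) (by fun_prop), Measure.map_map (by fun_prop) (by fun_prop)]
  refine Measure.map_congr ?_
  filter_upwards [base_pos N ha] with y hy
  have := Real.sqrt_pos.2 hy.2
  simp only [Function.comp]
  rw [Real.log_mul (by positivity) hy.1.ne', Real.log_pow, Real.log_sqrt hy.2.le, Real.log_pow]
  push_cast; ring

/-- polar decomposition -/
noncomputable def DL {N : ℕ} (μ : Measure (E N)) (k : ℕ) : Measure ℝ := (Measure.pi fun _ : Fin k => μ).map Dn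

lemma DL_prob {N : ℕ} (μ : Measure (E N)) [IsProbabilityMeasure μ] (k : ℕ) : IsProbabilityMeasure (DL μ k) :=
  Measure.isProbabilityMeasure_map Dn_continuous.measurable.aemeasurable

lemma DL_succ {N : ℕ} (μ : Measure (E (N + 1))) [IsProbabilityMeasure μ] (hμ : RotInv μ) (k : ℕ) :
    DL μ (k + 1) = (μ.map (fun x => ‖x‖)).mconv (DL (μ.map et) k) := by
  have hD : ∀ N k : ℕ, Measurable (Dn (N := N) (k := k)) := fun N k => Dn_continuous.measurable
  have he := measurable_et (N := N)
  have : IsProbabilityMeasure (μ.map et) := Measure.isProbabilityMeasure_map he.aemeasurable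
  have := DL_prob (μ.map et) k
  refine Measure.ext_of_lintegral _ fun g hg => ?_
  rw [DL, lintegral_map hg (hD _ _), lint_pi_succ (fun X => g (Dn X)) (hg.comp (hD _ _)), Measure.lintegral_mconv hg,
    lintegral_map (Measurable.lintegral_prod_right' (f := fun q : ℝ × ℝ => g (q.1 * q.2)) (by fun_prop)) (by fun_prop)]
  refine lintegral_congr fun p => ?_
  obtain ⟨U, hU⟩ := exists_rot p (ec ‖p‖ 0) (norm_ec_zero _ (norm_nonneg _)).symm
  have hU' : Measurable U := U.continuous.measurable
  have h1 : ∀ X : Fin k → E (N + 1), g (Dn (Fin.cons p X : Fin (k + 1) → E (N + 1))) =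
      (fun X => g (‖p‖ * Dn (fun i => et (X i)))) (fun i => U (X i)) := by
    intro X
    simp only
    rw [← Dn_cons _ (norm_nonneg _), ← Dn_rot U]
    congr 2
    ext1 i
    refine Fin.cases ?_ (fun i => ?_) i <;> simp [hU]
  have hm : Measurable (fun X : Fin k → E (N + 1) => g (‖p‖ * Dn (fun i => et (X i)))) := by
    have : Measurable (fun X : Fin k → E (N + 1) => Dn (fun i => et (X i))) := (hD _ _).comp (by fun_prop)
    fun_prop
  rw [lintegral_congr h1, ← lintegral_map (μ := Measure.pi fun _ : Fin k => μ) (g := fun (X : Fin k → E (N + 1)) i => U (X i)) hm (by fun_prop), pi_rot hμ U, DL,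
    ← Measure.pi_map_pi (fun i => he.aemeasurable), lintegral_map (by fun_prop) (hD _ _), lintegral_map _ (by fun_prop)]
  exact (hg.comp (measurable_const_mul _)).comp (hD _ _)

end RS

open scoped ENNReal
namespace RS

/-- law of half the logarithm of a beta variable -/
noncomputable def hlb (A B : ℝ) : Measure ℝ := (lb A B).map (fun x => 1 / 2 * x)

lemma hlb_prob {A B : ℝ} (hA : 0 < A) (hB : 0 < B) : IsProbabilityMeasure (hlb A B) := by
  have := lb_prob hA hB
  exact Measure.isProbabilityMeasure_map (by fun_prop)

lemma log_norm_beta (N : ℕ) {b : ℝ} (hb : 0 < b) :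
    ((betaModel (N + 1) b).map (fun x => ‖x‖)).map Real.log = hlb (((N : ℝ) + 1) / 2) (b / 2) := by
  rw [hlb, lb, ← beta_norm_map N hb, Measure.map_map (by fun_prop) (by fun_prop), Measure.map_map (by fun_prop) (by fun_prop), Measure.map_map (by fun_prop) (by fun_prop)]
  congr 1
  ext1 x
  simp

lemma beta_rot (N : ℕ) {b : ℝ} (hb : 0 < b) : RotInv (betaModel N b) := by
  rw [beta_eq N hb]
  have := kkn_meas N b
  exact rotInv_density _ (by fun_prop) (by simp)

lemma pos_norm_beta (N : ℕ) {b : ℝ} (hb : 0 < b) : Pos ((betaModel (N + 1) b).map (fun x => ‖x‖)) := by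
  apply Pos.of_ae
  rw [ae_map_iff (by fun_prop) measurableSet_Ioi]
  filter_upwards [base_pos N hb] with y hy using hy.1

lemma DL_beta (k : ℕ) : ∀ (N : ℕ) {b : ℝ}, 0 < b → Pos (DL (betaModel (N + k) b) k) ∧
    ∀ t, charFun ((DL (betaModel (N + k) b) k).map Real.log) t =
      ∏ j ∈ range k, charFun (hlb (((N : ℝ) + k - j) / 2) ((b + j) / 2)) t := by
  induction k with
  | zero =>
    intro N b hb
    have := beta_prob N hb
    have h : DL (betaModel (N + 0) b) 0 = Measure.dirac 1 := by
      unfold DL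
      have : (Dn : (Fin 0 → E (N + 0)) → ℝ) = fun _ => 1 := funext Dn_zero
      rw [this, Measure.map_const]
      simp
    rw [h, Measure.map_dirac' Real.measurable_log]
    refine ⟨?_, fun t => by simp⟩
    simp [Pos]
  | succ k ih =>
    intro N b hb
    have hb1 : 0 < b + 1 := by positivity
    obtain ⟨h1, h2⟩ := ih N hb1
    have := beta_prob (N + k + 1) hb
    have := beta_prob (N + k) hb1
    have hl := DL_succ (betaModel (N + k + 1) b) (beta_rot _ hb) k
    rw [beta_proj _ hb] at hl
    have hp := pos_norm_beta (N + k) hb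
    have : IsProbabilityMeasure ((betaModel (N + k + 1) b).map (fun x => ‖x‖)) := Measure.isProbabilityMeasure_map (by fun_prop)
    have := DL_prob (betaModel (N + k) (b + 1)) k
    change Pos (DL (betaModel (N + k + 1) b) (k + 1)) ∧ ∀ t, charFun ((DL (betaModel (N + k + 1) b) (k + 1)).map Real.log) t = _
    rw [hl]
    refine ⟨pos_mconv hp h1, fun t => ?_⟩
    have : IsProbabilityMeasure ((DL (betaModel (N + k) (b + 1)) k).map Real.log) := Measure.isProbabilityMeasure_map (by fun_prop)
    have hA : (0:ℝ) < (((N + k : ℕ) : ℝ) + 1) / 2 := by positivity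
    have := hlb_prob hA (show 0 < b / 2 by positivity)
    rw [log_mconv hp h1, log_norm_beta _ hb, charFun_conv, h2, Finset.prod_range_succ', mul_comm]
    congr 1
    · refine Finset.prod_congr rfl fun j _ => ?_
      congr 2 <;> (push_cast; ring)
    · congr 2 <;> (push_cast; ring)

lemma pi_cons {N r : ℕ} (μ : Measure (E N)) [IsProbabilityMeasure μ] :
    (μ.prod (Measure.pi fun _ : Fin r => μ)).map (fun q => (Fin.cons q.1 q.2 : Fin (r + 1) → E N)) =
      Measure.pi fun _ : Fin (r + 1) => μ := by
  refine Measure.ext_of_lintegral _ fun g hg => ?_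
  rw [lintegral_map hg measurable_cons, lint_pi_succ g hg, lintegral_prod]
  exact (hg.comp measurable_cons).aemeasurable

lemma QO_eq (N r : ℕ) {b : ℝ} (hb : 0 < b) : Q @DO N r 0 b b = DL (betaModel N b) (r + 1) := by
  have := beta_prob N hb
  rw [DL, ← pi_cons, Measure.map_map Dn_continuous.measurable measurable_cons, Q]
  congr 1
  ext1 q
  simp [DO, Function.comp]

lemma apos {a b : ℝ} (ha : 0 < a) (hb : 0 < b) (N r : ℕ) : 0 < a + r * (b + (N + 1 : ℕ) + r - 1) := by
  have : (0:ℝ) ≤ N := by positivity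
  have : (0:ℝ) ≤ r := by positivity
  have : 0 ≤ b + (N + 1 : ℕ) + r - 1 := by push_cast; linarith
  positivity

lemma comb1 (N r κ : ℕ) {a b : ℝ} (ha : 0 < a) (hb : 0 < b) (t : ℝ) :
    charFun (QL @DV (N + 1 + r) r κ a b) t * charFun (ab (((N : ℝ) + 1) / 2) ((a + r * (b + (N + 1 : ℕ) + r - 1)) / 2) (1 / 2) ((κ + r : ℕ) / 2)) t
    = charFun (QL @DO (N + 1 + r) r κ a b) t * charFun (ab (((N : ℝ) + 1) / 2) ((a + r * (b + (N + 1 : ℕ) + r - 1)) / 2) 0 ((κ + r : ℕ) / 2)) t := by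
  have hb' : 0 < b + r := by positivity
  have ha' := apos ha hb N r
  obtain ⟨M, hM, h⟩ := elim_all r (N + 1) κ a b ha hb
  have hV := (h @DV goodDV 0 (QV_zero_pos _ _ ha' hb')).2
  have hO := (h @DO goodDO 0 (QO_zero_pos _ _ ha' hb')).2
  rw [zero_add, QLV_zero _ _ ha' hb'] at hV
  rw [zero_add, QLO_zero _ _ ha' hb'] at hO
  have := ab_prob (show 0 < ((N : ℝ) + 1) / 2 by positivity) (half_pos ha') 0 (((κ + r : ℕ) : ℝ) / 2)
  have := ab_prob (show 0 < ((N : ℝ) + 1) / 2 by positivity) (half_pos ha') (1 / 2) (((κ + r : ℕ) : ℝ) / 2)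
  rw [hV, hO, charFun_conv, charFun_conv]
  ring

lemma comb2 (r κ : ℕ) {a b : ℝ} (ha : 0 < a) (hb : 0 < b) (t : ℝ) :
    charFun (QL @DV (1 + r) (1 + r) κ a b) t * charFun (ab (1 / 2) ((a + r * (b + (0 + 1 : ℕ) + r - 1)) / 2) (1 / 2) ((κ + r : ℕ) / 2)) t
    = charFun (QL @DO (1 + r) r κ a b) t * charFun (QL @DV 1 1 (κ + r) (a + r * (b + (0 + 1 : ℕ) + r - 1)) (b + r)) t := by
  have hb' : 0 < b + r := by positivity
  have ha' := apos ha hb 0 r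
  obtain ⟨M, hM, h⟩ := elim_all r (0 + 1) κ a b ha hb
  have hV := (h @DV goodDV 1 (QV_pos 0 1 _ ha' hb')).2
  have hO := (h @DO goodDO 0 (QO_zero_pos _ _ ha' hb')).2
  rw [zero_add r, QLO_zero _ _ ha' hb'] at hO
  simp only [Nat.cast_zero, zero_add (1 : ℝ)] at hO
  simp only [zero_add (1 : ℕ)] at hO hV ha' ⊢
  have := QL_prob goodDV 1 1 (κ + r) ha' hb'
  have := ab_prob (show 0 < (1 : ℝ) / 2 by positivity) (half_pos ha') (1 / 2) (((κ + r : ℕ) : ℝ) / 2)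
  rw [hV, hO, charFun_conv, charFun_conv]
  ring

end RS

open scoped ENNReal
namespace RS

lemma beta_mean {A B : ℝ} (hA : 0 < A) (hB : 0 < B) :
    ∫⁻ x, ENNReal.ofReal x ∂(betaMeasure A B) = ENNReal.ofReal (A / (A + B)) := by
  have hm : ∀ A B, Measurable (betaPDF A B) := fun A B => (measurable_betaPDFReal A B).ennreal_ofReal
  have hb := beta_pos hA hB
  have hA1 : 0 < A + 1 := by positivity
  have hb1 := beta_pos hA1 hB
  have hr : beta (A + 1) B = A / (A + B) * beta A B := by
    have := (Real.Gamma_pos_of_pos (add_pos hA hB))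
    unfold beta
    rw [show A + 1 + B = A + B + 1 by ring, Real.Gamma_add_one hA.ne', Real.Gamma_add_one (add_pos hA hB).ne']
    field_simp
  rw [betaMeasure, lintegral_withDensity_eq_lintegral_mul _ (hm A B) (by fun_prop)]
  have : ∀ x, (betaPDF A B * fun x => ENNReal.ofReal x) x = ENNReal.ofReal (A / (A + B)) * betaPDF (A + 1) B x := by
    intro x
    simp only [Pi.mul_apply]
    by_cases hx : 0 < x ∧ x < 1
    · rw [betaPDF_of_pos_lt_one hx.1 hx.2, betaPDF_of_pos_lt_one hx.1 hx.2,
        ← ENNReal.ofReal_mul (by have := hx.1; have : 0 < 1 - x := by linarith [hx.2]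
                                 positivity), ← ENNReal.ofReal_mul (by positivity)]
      congr 1
      rw [hr, show A + 1 - 1 = (A - 1) + 1 by ring, Real.rpow_add_one hx.1.ne']
      field_simp
    · simp [betaPDF, betaPDFReal, hx]
  rw [lintegral_congr this, lintegral_const_mul _ (hm _ _), lintegral_betaPDF_eq_one hA1 hB, mul_one]

lemma cb_one_le {b : ℝ} (hb : 0 < b) : cb 1 b ≤ √b := by
  have h0 : 0 < b / 2 := by positivity
  have h1 := Real.Gamma_mul_add_mul_le_rpow_Gamma_mul_rpow_Gamma (s := b / 2) (t := b / 2 + 1) (a := 1 / 2) (b := 1 / 2)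
    h0 (by positivity) (by norm_num) (by norm_num) (by norm_num)
  rw [show (1:ℝ) / 2 * (b / 2) + 1 / 2 * (b / 2 + 1) = (1 + b) / 2 by ring, Real.Gamma_add_one h0.ne'] at h1
  have hg := Real.Gamma_pos_of_pos h0
  rw [Real.mul_rpow h0.le hg.le, mul_comm (_ ^ _) (_ * _), mul_assoc, ← Real.rpow_add hg] at h1
  norm_num at h1
  rw [← Real.sqrt_eq_rpow] at h1
  unfold cb
  push_cast
  rw [div_le_iff₀ hg]
  have h2 : π ^ (-(1:ℝ) / 2) ≤ 1 := by
    apply Real.rpow_le_one_of_one_le_of_nonpos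
    · linarith [pi_gt_three]
    · norm_num
  have h3 : √(b / 2) ≤ √b := Real.sqrt_le_sqrt (by linarith)
  have hg2 := Real.Gamma_pos_of_pos (show 0 < (1 + b) / 2 by positivity)
  calc _ ≤ 1 * Real.Gamma ((1 + b) / 2) := by gcongr
    _ ≤ √(b / 2) * Real.Gamma (b / 2) := by rw [one_mul]; exact h1
    _ ≤ _ := by gcongr

noncomputable def phi (z : E 1) : ℝ≥0∞ := kk 2 (1 - ‖z‖ ^ 2) * ENNReal.ofReal (Real.log ‖z‖ ^ 2)

lemma phi_meas : Measurable phi := (kkn_meas 1 2).mul (by fun_prop)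

lemma phi_fin : ∫⁻ z, phi z ≠ ∞ := by
  have h1 := (scale_stats (1/2) (lb_L2 (show (0:ℝ) < 1 / 2 by norm_num) (one_pos)).1).1
  have h2 := log_norm_beta 0 (show (0:ℝ) < 2 by norm_num)
  have h3 : L2 (((betaModel (0 + 1) 2).map (fun x => ‖x‖)).map Real.log) := by
    rw [h2, hlb]; convert h1 using 3 <;> norm_num
  unfold L2 at h3
  rw [Measure.map_map (by fun_prop) (by fun_prop), memLp_map_measure_iff (by fun_prop) (by fun_prop)] at h3
  have h4 := h3.integrable_sq
  have h5 := h4.lintegral_lt_top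
  simp only [Function.comp, id] at h5
  rw [beta_lint _ (by norm_num) (fun x => ENNReal.ofReal (Real.log ‖x‖ ^ 2)) (by fun_prop)] at h5
  intro h
  unfold phi at h
  change ENNReal.ofReal (cb 1 2) * _ < _ at h5
  rw [h, ENNReal.mul_top (by simpa using cb_pos 1 (by norm_num))] at h5
  exact lt_irrefl _ h5

lemma phi_scale {w : ℝ} (hw : 0 < w) : ∫⁻ z, phi (w • z) = (ENNReal.ofReal w)⁻¹ * ∫⁻ z, phi z := by
  have h := Measure.map_addHaar_smul (volume : Measure (E 1)) hw.ne'
  rw [← lintegral_map (μ := volume) (g := fun z : E 1 => w • z) phi_meas (by fun_prop)]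
  rw [h, lintegral_smul_measure, smul_eq_mul]
  simp [abs_of_pos hw, ENNReal.ofReal_inv_of_pos hw]

lemma kk_le_one {b u : ℝ} (hb : 2 ≤ b) (hu : u ≤ 1) : kk b u ≤ 1 := by
  unfold kk
  split_ifs with h
  · rw [ENNReal.ofReal_le_one]
    exact Real.rpow_le_one h.le hu (by linarith)
  · simp

lemma L_pt (z : E 1) : ENNReal.ofReal (Real.log ‖z‖ ^ 2) ≤ ENNReal.ofReal (‖z‖ ^ 2) + phi z := by
  by_cases h : ‖z‖ < 1
  · have h1 : 0 < 1 - ‖z‖ ^ 2 := by nlinarith [norm_nonneg z]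
    have : phi z = ENNReal.ofReal (Real.log ‖z‖ ^ 2) := by
      simp [phi, kk, h1]
    rw [this]; exact le_add_self
  · refine le_add_right (ENNReal.ofReal_le_ofReal ?_)
    have h1 := Real.log_nonneg (not_lt.1 h)
    have h2 := Real.log_le_self (norm_nonneg z)
    gcongr

lemma beta_sq_mean {b : ℝ} (hb : 0 < b) : ∫⁻ x, ENNReal.ofReal (‖x‖ ^ 2) ∂(betaModel 1 b) = ENNReal.ofReal (1 / (1 + b)) := by
  have := beta_norm_sq 0 hb (fun u => ENNReal.ofReal u) (by fun_prop)
  rw [zero_add] at this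
  rw [this, beta_mean (by norm_num) (half_pos hb)]
  congr 1
  push_cast
  field_simp
  ring

lemma L_bound {a b : ℝ} (hb : 2 ≤ b) (hba : b ≤ a) :
    ∫⁻ p, ∫⁻ q, ENNReal.ofReal (Real.log (√b * ‖q - p‖) ^ 2) ∂(betaModel 1 b) ∂(betaModel 1 a) ≤ 4 + ∫⁻ z, phi z := by
  have hb0 : 0 < b := by linarith
  have ha0 : 0 < a := by linarith
  have := beta_prob 1 hb0
  have := beta_prob 1 ha0
  have hsb := Real.sqrt_pos.2 hb0
  have hphi := phi_meas
  have h1 : ∀ p : E 1, ∫⁻ q, ENNReal.ofReal (Real.log (√b * ‖q - p‖) ^ 2) ∂(betaModel 1 b) ≤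
      (ENNReal.ofReal (2 * b) * ENNReal.ofReal (1 / (1 + b)) + ENNReal.ofReal (2 * b) * ENNReal.ofReal (‖p‖ ^ 2)) + ∫⁻ z, phi z := by
    intro p
    calc _ ≤ ∫⁻ q, (ENNReal.ofReal (2 * b) * ENNReal.ofReal (‖q‖ ^ 2) + ENNReal.ofReal (2 * b) * ENNReal.ofReal (‖p‖ ^ 2)) + phi (√b • (q - p)) ∂(betaModel 1 b) := by
          refine lintegral_mono fun q => ?_
          have := L_pt (√b • (q - p))
          rw [norm_smul, Real.norm_of_nonneg hsb.le] at this
          refine this.trans ?_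
          gcongr
          rw [← ENNReal.ofReal_mul (by positivity), ← ENNReal.ofReal_mul (by positivity), ← ENNReal.ofReal_add (by positivity) (by positivity)]
          apply ENNReal.ofReal_le_ofReal
          rw [mul_pow, Real.sq_sqrt hb0.le]
          have h3 := norm_sub_le q p
          have : ‖q - p‖ ^ 2 ≤ 2 * (‖q‖ ^ 2 + ‖p‖ ^ 2) := by
            nlinarith [norm_nonneg (q - p), norm_nonneg q, norm_nonneg p, sq_nonneg (‖q‖ - ‖p‖)]
          nlinarith
      _ ≤ _ := by
          rw [lintegral_add_left (by fun_prop), lintegral_add_left (by fun_prop), lintegral_const_mul _ (by fun_prop), beta_sq_mean hb0,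
            lintegral_const, measure_univ, mul_one]
          refine add_le_add le_rfl ?_
          rw [beta_lint _ hb0 _ (by fun_prop)]
          calc _ ≤ ENNReal.ofReal (cb 1 b) * ∫⁻ q, phi (√b • (q - p)) := by
                gcongr with q
                calc _ ≤ 1 * phi (√b • (q - p)) := by
                      gcongr
                      exact kk_le_one hb (by linarith [sq_nonneg ‖q‖])
                  _ = _ := one_mul _
            _ = ENNReal.ofReal (cb 1 b) * ((ENNReal.ofReal √b)⁻¹ * ∫⁻ z, phi z) := by
                rw [lintegral_sub_right_eq_self (fun q => phi (√b • q)) p, phi_scale hsb]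
            _ ≤ ENNReal.ofReal √b * ((ENNReal.ofReal √b)⁻¹ * ∫⁻ z, phi z) := by
                gcongr; exact cb_one_le hb0
            _ = _ := by
                rw [← mul_assoc, ENNReal.mul_inv_cancel (by simpa using hb0) (by simp), one_mul]
  refine (lintegral_mono h1).trans ?_
  rw [lintegral_add_left (by fun_prop), lintegral_add_left (by fun_prop), lintegral_const_mul (ENNReal.ofReal (2 * b)) (f := fun p : E 1 => ENNReal.ofReal (‖p‖ ^ 2)) (by fun_prop), beta_sq_mean ha0,
            lintegral_const, measure_univ, mul_one, lintegral_const, measure_univ, mul_one]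
  refine add_le_add ?_ le_rfl
  rw [← ENNReal.ofReal_mul (by positivity), ← ENNReal.ofReal_mul (by positivity), ← ENNReal.ofReal_add (by positivity) (by positivity)]
  rw [show (4 : ℝ≥0∞) = ENNReal.ofReal 4 by norm_num]
  apply ENNReal.ofReal_le_ofReal
  have e1 : 2 * b * (1 / (1 + b)) ≤ 2 := by
    rw [mul_one_div, div_le_iff₀ (by positivity)]; linarith
  have e2 : 2 * b * (1 / (1 + a)) ≤ 2 := by
    rw [mul_one_div, div_le_iff₀ (by positivity)]; linarith
  linarith

lemma var_le {Ω : Type*} [MeasurableSpace Ω] {μ : Measure Ω} [IsProbabilityMeasure μ] {X : Ω → ℝ} (hX : MemLp X 2 μ) (c : ℝ) :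
    variance X μ ≤ ∫ ω, (X ω - c) ^ 2 ∂μ := by
  have h := variance_sub_const hX.aestronglyMeasurable c
  rw [← h]
  exact variance_le_expectation_sq (hX.sub (memLp_const c)).aestronglyMeasurable

lemma QL11_stats : ∃ K : ℝ, ∀ (a b : ℝ) (κ : ℕ), 2 ≤ b → b ≤ a → L2 (QL @DV 1 1 κ a b) ∧
    var (QL @DV 1 1 κ a b) ≤ 2 * var (ab (1 / 2) (a / 2) 0 (κ / 2)) + K := by
  refine ⟨2 * (4 + ∫⁻ z, phi z).toReal, fun a b κ hb hba => ?_⟩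
  have hb0 : 0 < b := by linarith
  have ha0 : 0 < a := by linarith
  have := beta_prob 1 hb0
  have := beta_prob 1 ha0
  have hsb := Real.sqrt_pos.2 hb0
  set μ := (betaModel 1 a).prod (Measure.pi fun _ : Fin 1 => betaModel 1 b) with hμ
  set U : E 1 × (Fin 1 → E 1) → ℝ := fun q => κ / 2 * Real.log (1 - ‖q.1‖ ^ 2) with hU
  set L : E 1 × (Fin 1 → E 1) → ℝ := fun q => Real.log (√b * ‖q.2 0 - q.1‖) with hL
  have hUm : Measurable U := by fun_prop
  have hLm : Measurable L := by fun_prop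
  have hUmap : μ.map U = ab (1 / 2) (a / 2) 0 (κ / 2) := by
    have h1 := Measure.map_map (μ := μ) (g := fun p : E 1 => κ / 2 * Real.log (1 - ‖p‖ ^ 2)) (f := Prod.fst) (by fun_prop) (by fun_prop)
    rw [hμ, Measure.map_fst_prod, measure_univ, one_smul, ← hμ] at h1
    have h2 := beta_norm_map 0 ha0
    norm_num at h2
    have h3 : U = (fun p : E 1 => κ / 2 * Real.log (1 - ‖p‖ ^ 2)) ∘ Prod.fst := rfl
    rw [h3, ← h1, ab, ← h2, Measure.map_map (by fun_prop) (by fun_prop)]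
    congr 1
    ext1 x
    simp
  have hst := ab_stats (show (0:ℝ) < 1 / 2 by norm_num) (half_pos ha0) 0 (κ / 2)
  have hUL : MemLp U 2 μ := by
    have := hst.1
    rw [← hUmap, L2, memLp_map_measure_iff (by fun_prop) (by fun_prop)] at this
    exact this
  have hLb : ∫⁻ q, ENNReal.ofReal (L q ^ 2) ∂μ ≤ 4 + ∫⁻ z, phi z := by
    refine le_trans (le_of_eq ?_) (L_bound hb hba)
    rw [hμ, lintegral_prod _ (by fun_prop)]
    refine lintegral_congr fun p => ?_
    have := (measurePreserving_funUnique (betaModel 1 b) (Fin 1)).lintegral_comp (f := fun q => ENNReal.ofReal (Real.log (√b * ‖q - p‖) ^ 2)) (by fun_prop)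
    exact this
  have hfin : 4 + ∫⁻ z, phi z ≠ ∞ := by simp [phi_fin]
  have hLsq : Integrable (fun q => L q ^ 2) μ := by
    refine ⟨by fun_prop, ?_⟩
    rw [hasFiniteIntegral_iff_ofReal (ae_of_all _ fun _ => sq_nonneg _)]
    exact lt_of_le_of_lt hLb (lt_top_iff_ne_top.2 hfin)
  have hLL : MemLp L 2 μ := (memLp_two_iff_integrable_sq hLm.aestronglyMeasurable).2 hLsq
  have hLv : ∫ q, L q ^ 2 ∂μ ≤ (4 + ∫⁻ z, phi z).toReal := by
    rw [integral_eq_lintegral_of_nonneg_ae (ae_of_all _ fun _ => sq_nonneg _) (by fun_prop)]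
    exact ENNReal.toReal_mono hfin hLb
  have hpos := (QV_pos 0 1 κ ha0 hb0).ae
  rw [zero_add] at hpos
  have hpos' := ae_of_ae_map (Q_meas goodDV 1 1 κ).aemeasurable hpos
  have hbase : ∀ᵐ q ∂μ, 0 < 1 - ‖q.1‖ ^ 2 := by
    have := base_pos 0 ha0
    rw [zero_add] at this
    have h2 : ∀ᵐ y ∂(betaModel 1 a), 0 < 1 - ‖y‖ ^ 2 := this.mono fun y hy => hy.2
    exact Measure.quasiMeasurePreserving_fst.ae h2
  have hD1 : ∀ (p : E 1) (X : Fin 1 → E 1), DV p X = ‖X 0 - p‖ := fun p X => by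
    unfold DV; exact Dn_one _
  have hmap : QL @DV 1 1 κ a b = μ.map (fun q => (U q + L q) - Real.log √b) := by
    rw [QL, Q, Measure.map_map (by fun_prop) (Q_meas goodDV 1 1 κ)]
    refine Measure.map_congr ?_
    filter_upwards [hpos', hbase] with q h1 h2
    have h3 := Real.sqrt_pos.2 h2
    rw [hD1] at h1
    have h4 : 0 < ‖q.2 0 - q.1‖ := (mul_pos_iff_of_pos_left (by positivity)).1 h1
    simp only [Function.comp, hD1, hU, hL]
    rw [Real.log_mul (by positivity) h4.ne', Real.log_pow, Real.log_sqrt h2.le, Real.log_mul hsb.ne' h4.ne']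
    ring
  clear_value U L
  have hXL : MemLp (fun q => (U q + L q) - Real.log √b) 2 μ := (hUL.add hLL).sub (memLp_const _)
  have hXm : Measurable (fun q => (U q + L q) - Real.log √b) := by fun_prop
  rw [hmap]
  refine ⟨?_, ?_⟩
  · rw [L2, memLp_map_measure_iff (by fun_prop) (by fun_prop)]; exact hXL
  · rw [var, variance_id_map hXm.aemeasurable]
    refine (var_le hXL (μ[U] - Real.log √b)).trans ?_
    have hVU : ∫ q, (U q - μ[U]) ^ 2 ∂μ = var (ab (1 / 2) (a / 2) 0 (κ / 2)) := by
      rw [← hUmap, var, variance_id_map hUm.aemeasurable, variance_eq_integral hUm.aemeasurable]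
    have hUsq : Integrable (fun q => (U q - μ[U]) ^ 2) μ := (hUL.sub (memLp_const _)).integrable_sq
    calc _ ≤ ∫ q, 2 * (U q - μ[U]) ^ 2 + 2 * L q ^ 2 ∂μ := by
          refine integral_mono ?_ ((hUsq.const_mul _).add (hLsq.const_mul _)) fun q => ?_
          · exact (hXL.sub (memLp_const _)).integrable_sq
          · simp only
            nlinarith [sq_nonneg (U q - μ[U] - L q)]
      _ = 2 * var (ab (1 / 2) (a / 2) 0 (κ / 2)) + 2 * ∫ q, L q ^ 2 ∂μ := by
          rw [integral_add (hUsq.const_mul _) (hLsq.const_mul _), integral_const_mul, integral_const_mul, hVU]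
      _ ≤ _ := by linarith

end RS

open scoped ENNReal

namespace RS

theorem clt' (P : ℕ → Measure ℝ)
    (h : ∀ ε : ℝ, 0 < ε → ∀ᶠ n in atTop, IsProbabilityMeasure (P n) ∧ Good (P n) ε) (f : BoundedContinuousFunction ℝ ℝ) :
    Tendsto (fun n => ∫ x, f ((x - mean (P n)) / √(var (P n))) ∂(P n)) atTop
      (nhds (∫ z, f z ∂gaussianReal 0 1)) := by
  refine tendsto_of_subseq_tendsto fun ns hns => ?_
  have h1 : ∀ k : ℕ, ∃ m : ℕ, IsProbabilityMeasure (P (ns m)) ∧ Good (P (ns m)) (1 / ((k : ℝ) + 1)) := fun k =>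
    (hns.eventually (h (1 / ((k : ℝ) + 1)) (by positivity))).exists
  choose ms hms using h1
  refine ⟨ms, ?_⟩
  have : ∀ k, IsProbabilityMeasure (P (ns (ms k))) := fun k => (hms k).1
  exact clt (fun k => P (ns (ms k))) _ tendsto_one_div_add_atTop_nhds_zero_nat (fun k => (hms k).2) f

lemma good_of {P α S B : Measure ℝ} [IsProbabilityMeasure α] [IsProbabilityMeasure S] [IsProbabilityMeasure B]
    (hα : L2 α) (hB : L2 B) (h : ∀ t, charFun P t * charFun α t = charFun S t * charFun B t) {m ε : ℝ}
    (hS : Near S (var S / (2 * m))) (hm : 0 < m) (hε : 0 < ε) (hv : 1 ≤ (2 * m * ε) ^ 2 * var S)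
    (h1 : var α ≤ ε * var S) (h2 : var B ≤ ε * var S) : Good P ε := by
  have hv0 : 0 < var S := by
    rcases (var_nonneg S).eq_or_lt with h | h
    · rw [← h] at hv; norm_num at hv
    · exact h
  refine ⟨α, S, B, inferInstance, inferInstance, inferInstance, hα, hS.1, hB, h, hv0, h1, h2, fun t => (hS.2 t).trans ?_⟩
  have hs := Real.sqrt_pos.2 hv0
  have hsq := Real.sq_sqrt hv0.le
  have h3 : 1 ≤ 2 * m * ε * √(var S) := by
    by_contra hc
    push Not at hc
    have h0 : 0 ≤ 2 * m * ε * √(var S) := by positivity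
    have : (2 * m * ε * √(var S)) ^ 2 < 1 := by nlinarith
    rw [mul_pow, hsq] at this
    linarith
  have h4 : var S / (2 * m) ≤ ε * √(var S) ^ 3 := by
    rw [div_le_iff₀ (by positivity), pow_succ, hsq]
    nlinarith
  calc _ ≤ (ε * √(var S) ^ 3) * |t| ^ 3 := by gcongr
    _ = _ := by ring

lemma shift_stats {P : Measure ℝ} [IsProbabilityMeasure P] (hP : L2 P) (c : ℝ) :
    L2 (P.map (fun x => x + c)) ∧ var (P.map (fun x => x + c)) = var P := by
  constructor
  · unfold L2
    rw [memLp_map_measure_iff (by fun_prop) (by fun_prop)]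
    exact hP.add (memLp_const c)
  · unfold var
    rw [variance_id_map (by fun_prop)]
    exact variance_add_const hP.aestronglyMeasurable c

lemma Good.shift {P : Measure ℝ} {ε : ℝ} (h : Good P ε) (c : ℝ) : Good (P.map (fun x => x + c)) ε := by
  obtain ⟨α, S, B, i1, i2, i3, h1, h2, h3, h4, h5, h6, h7, h8⟩ := h
  obtain ⟨h9, h10⟩ := shift_stats h3 c
  refine ⟨α, S, B.map (fun x => x + c), i1, i2, Measure.isProbabilityMeasure_map (by fun_prop), h1, h2, h9, fun t => ?_, h5, h6, by rw [h10]; exact h7, h8⟩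
  rw [charFun_map_add_const, charFun_map_add_const, mul_right_comm, h4]
  ring

lemma ab_zero {A B : ℝ} (hA : 0 < A) (hB : 0 < B) (v : ℝ) : ab A B 0 v = (lb B A).map (fun x => v * x) := by
  have := ab_prob hA hB 0 v
  have := lb_prob hB hA
  have h1 := lg_prob hA
  have h2 := lg_prob hB
  have h3 := lg_prob (add_pos hA hB)
  have : IsProbabilityMeasure ((lg A).map (fun x => 0 * x)) := Measure.isProbabilityMeasure_map (by fun_prop)
  have : IsProbabilityMeasure ((lg B).map (fun x => v * x)) := Measure.isProbabilityMeasure_map (by fun_prop)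
  apply Measure.ext_of_charFun
  ext t
  have e1 := ab_charFun hA hB 0 v t
  have e2 := charFun_lb hB hA (v * t)
  rw [charFun_conv, charFun_map_mul, charFun_map_mul, charFun_map_mul, zero_add, zero_mul, show charFun (lg A) 0 = 1 by simp, one_mul] at e1
  rw [charFun_map_mul]
  rw [← e2, add_comm B A] at e1
  exact mul_right_cancel₀ (charFun_lg_ne (add_pos hA hB) _) e1

lemma ab_near {A B : ℝ} (hA : 0 < A) (hB : 0 < B) {v : ℝ} (hv : 0 ≤ v) :
    Near (ab A B 0 v) (v / B / 2 * var (ab A B 0 v)) := by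
  have h := (lb_near hB hA).scale v
  rw [← ab_zero hA hB] at h
  have h2 := (scale_stats v (lb_near hB hA).1).2.2.1
  rw [← ab_zero hA hB] at h2
  rw [h2]
  rw [abs_of_nonneg hv] at h
  convert h using 1
  ring

lemma hlb_near {A B : ℝ} (hA : 0 < A) (hB : 0 < B) :
    Near (hlb A B) (1 / A / 4 * var (hlb A B)) ∧ var (hlb A B) = (psi1 A - psi1 (A + B)) / 4 := by
  have h := (lb_near hA hB).scale (1 / 2)
  have h2 := (scale_stats (1 / 2) (lb_near hA hB).1).2.2.1
  have h3 := (lb_L2 hA hB).2.2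
  unfold hlb
  constructor
  · rw [h2]
    convert h using 1
    rw [abs_of_nonneg (by norm_num)]
    ring
  · rw [h2, h3]; ring

lemma Near.mono {S : Measure ℝ} {ρ σ : ℝ} (h : Near S ρ) (hρ : ρ ≤ σ) : Near S σ :=
  ⟨h.1, fun t => (h.2 t).trans (by gcongr)⟩

/-- harmonic lower bound -/
lemma harm (n k : ℕ) (hk : k ≤ n) : Real.log ((n + 1) / (n + 1 - k)) ≤ ∑ j ∈ range k, 1 / ((n : ℝ) - j) := by
  induction k with
  | zero =>
    have : (n:ℝ) + 1 ≠ 0 := by positivity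
    simp [this]
  | succ k ih =>
    rw [sum_range_succ]
    have h1 := ih (by lia)
    have hn : (0:ℝ) < n := by exact_mod_cast (by lia : 0 < n)
    have hk' : (k:ℝ) + 1 ≤ n := by exact_mod_cast hk
    have hk2 : (0:ℝ) < n - k := by linarith
    have hk3 : (0:ℝ) < n + 1 - k := by linarith
    have h2 : Real.log ((n + 1) / (n + 1 - (k + 1 : ℕ))) = Real.log ((n + 1) / (n + 1 - k)) + Real.log ((n + 1 - k) / (n - k)) := by
      push_cast
      rw [← Real.log_mul (by positivity) (by positivity)]
      congr 1
      rw [show (n:ℝ) + 1 - (k + 1) = n - k by ring]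
      field_simp
    have h3 := Real.log_le_sub_one_of_pos (show 0 < ((n:ℝ) + 1 - k) / (n - k) by positivity)
    have h4 : ((n:ℝ) + 1 - k) / (n - k) - 1 = 1 / (n - k) := by field_simp; ring
    rw [h2]; linarith

section num
variable {ν : ℝ} {n R : ℕ}

noncomputable def s2 (ν : ℝ) (n R : ℕ) : ℝ :=
  ∑ j ∈ range (R + 1), (psi1 (((n : ℝ) - j) / 2) - psi1 ((n + ν) / 2)) / 4

noncomputable def aa (ν : ℝ) (n R : ℕ) : ℝ := ν + R * (ν + n - 1)

noncomputable def vA (ν : ℝ) (n R : ℕ) : ℝ :=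
  (psi1 (((n : ℝ) - R) / 2) + R ^ 2 * psi1 (aa ν n R / 2) - (R + 1) ^ 2 * psi1 (((n : ℝ) - R) / 2 + aa ν n R / 2)) / 4

noncomputable def vB (ν : ℝ) (n R : ℕ) : ℝ :=
  R ^ 2 / 4 * (psi1 (aa ν n R / 2) - psi1 (((n : ℝ) - R) / 2 + aa ν n R / 2))

lemma s2_term (hν : 0 ≤ ν) (hR : R + 1 ≤ n) : ∀ j ∈ range (R + 1),
    (1 / ((n:ℝ) - j) - 1 / (n + ν)) / 2 ≤ (psi1 (((n : ℝ) - j) / 2) - psi1 ((n + ν) / 2)) / 4 := by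
  intro j hj
  have hj' : (j:ℝ) + 1 ≤ n := by
    have := mem_range.1 hj
    exact_mod_cast (by lia : j + 1 ≤ n)
  have h0 : (0:ℝ) ≤ j := by positivity
  have h := psi1_lower_diff (a := ((n:ℝ) - j) / 2) (b := (ν + j) / 2) (by linarith) (by positivity)
  rw [show ((n:ℝ) - j) / 2 + (ν + j) / 2 = (n + ν) / 2 by ring] at h
  have e1 : (1:ℝ) / ((n - j) / 2) = 2 * (1 / (n - j)) := by rw [one_div_div, mul_one_div]
  have e2 : (1:ℝ) / ((n + ν) / 2) = 2 * (1 / (n + ν)) := by rw [one_div_div, mul_one_div]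
  rw [e1, e2] at h
  linarith

lemma s2_log (hν : 0 ≤ ν) (hR : R + 1 ≤ n) : (Real.log (n / (n - R)) - 1) / 2 ≤ s2 ν n R := by
  have hR' : (R:ℝ) + 1 ≤ n := by exact_mod_cast hR
  have hn : (0:ℝ) < n := by exact_mod_cast (by lia : 0 < n)
  refine le_trans ?_ (sum_le_sum (s2_term hν hR))
  rw [← sum_div, sum_sub_distrib]
  have h1 := harm n (R + 1) hR
  have h2 : Real.log (n / (n - R)) ≤ Real.log ((n + 1) / (n + 1 - (R + 1 : ℕ))) := by
    push_cast
    rw [show (n:ℝ) + 1 - (R + 1) = n - R by ring]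
    have : (0:ℝ) < n - R := by linarith
    apply Real.log_le_log (by positivity)
    gcongr
    linarith
  have h3 : ∑ j ∈ range (R + 1), 1 / ((n:ℝ) + ν) ≤ 1 := by
    rw [sum_const, card_range, nsmul_eq_mul, mul_one_div, div_le_one (by positivity)]
    push_cast; linarith
  linarith

lemma s2_sq (hν : 0 ≤ ν) (hR : R + 1 ≤ n) : (R:ℝ) ^ 2 / n ^ 2 ≤ 4 * (1 + ν) * s2 ν n R := by
  have hR' : (R:ℝ) + 1 ≤ n := by exact_mod_cast hR
  have hn : (1:ℝ) ≤ n := by exact_mod_cast (by lia : 1 ≤ n)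
  have h1 : ∀ j ∈ range (R + 1), (j:ℝ) / (n ^ 2 * (1 + ν)) / 2 ≤ (1 / ((n:ℝ) - j) - 1 / (n + ν)) / 2 := by
    intro j hj
    have hj' : (j:ℝ) + 1 ≤ n := by
      have := mem_range.1 hj
      exact_mod_cast (by lia : j + 1 ≤ n)
    have h0 : (0:ℝ) ≤ j := by positivity
    have h2 : (0:ℝ) < n - j := by linarith
    have e : 1 / ((n:ℝ) - j) - 1 / (n + ν) = (ν + j) / ((n - j) * (n + ν)) := by field_simp; ring
    rw [e]
    gcongr ?_ / 2
    apply div_le_div₀ (by positivity) (by linarith) (by positivity)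
    have : (n:ℝ) + ν ≤ n * (1 + ν) := by nlinarith
    calc ((n:ℝ) - j) * (n + ν) ≤ n * (n * (1 + ν)) := by gcongr; linarith
      _ = _ := by ring
  have h2 := (sum_le_sum h1).trans (sum_le_sum (s2_term hν hR))
  have h3 : ∑ j ∈ range (R + 1), (j:ℝ) = R * (R + 1) / 2 := by
    have := Finset.sum_range_id_mul_two (R + 1)
    have h : (∑ j ∈ range (R + 1), (j:ℝ)) * 2 = (R + 1) * R := by
      have := congrArg (Nat.cast (R := ℝ)) this
      push_cast at this
      simpa using this
    linarith
  rw [← sum_div, ← sum_div, h3] at h2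
  have h4 : (R:ℝ) * (R + 1) / 2 / (n ^ 2 * (1 + ν)) / 2 ≤ s2 ν n R := h2
  have h5 : (R:ℝ) ^ 2 / n ^ 2 = 4 * (1 + ν) * (R ^ 2 / 2 / (n ^ 2 * (1 + ν)) / 2) := by field_simp; ring
  rw [h5]
  have h6 : (R:ℝ) ^ 2 / 2 / (n ^ 2 * (1 + ν)) / 2 ≤ R * (R + 1) / 2 / (n ^ 2 * (1 + ν)) / 2 := by
    gcongr; nlinarith
  have := h6.trans h4
  gcongr

lemma aa_low (hν : 0 ≤ ν) (hn2 : 2 ≤ n) : (R:ℝ) * n / 4 ≤ aa ν n R / 2 := by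
  have hn : (2:ℝ) ≤ n := by exact_mod_cast hn2
  have : (0:ℝ) ≤ R := by positivity
  unfold aa
  nlinarith [mul_nonneg this hν, mul_nonneg this (sub_nonneg.2 hn)]

lemma aa_up (hν : 0 ≤ ν) (hR1 : 1 ≤ R) (hn2 : 2 ≤ n) : aa ν n R ≤ R * n * (1 + ν) := by
  have hn : (2:ℝ) ≤ n := by exact_mod_cast hn2
  have hr : (1:ℝ) ≤ R := by exact_mod_cast hR1
  have h1 : 0 ≤ (n - 2) * (R * ν) := mul_nonneg (by linarith) (by positivity)
  have h2 : 0 ≤ (R - 1) * ν := mul_nonneg (by linarith) hν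
  unfold aa
  nlinarith

lemma vB_low (hν : 0 ≤ ν) (hR1 : 1 ≤ R) (hR : R + 1 ≤ n) : ((n:ℝ) - R) / (4 * (1 + ν) ^ 2 * n ^ 2) ≤ vB ν n R := by
  have hR' : (R:ℝ) + 1 ≤ n := by exact_mod_cast hR
  have hn : (2:ℝ) ≤ n := by exact_mod_cast (by lia : 2 ≤ n)
  have hr : (1:ℝ) ≤ R := by exact_mod_cast hR1
  have hl := aa_low (R := R) hν (by lia : 2 ≤ n)
  have hu := aa_up hν hR1 (by lia : 2 ≤ n)
  set b := aa ν n R / 2 with hb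
  have hb0 : 0 < b := lt_of_lt_of_le (by positivity) hl
  set a := ((n:ℝ) - R) / 2 with ha
  have ha0 : 0 < a := by rw [ha]; linarith
  have h := psi1_lower_diff (a := b) (b := a) hb0 ha0.le
  have e : 1 / b - 1 / (b + a) = a / (b * (b + a)) := by field_simp; ring
  rw [e, add_comm b a] at h
  unfold vB
  rw [← hb, ← ha]
  have h2 : a / (R * n * (1 + ν) / 2 * (R * n * (1 + ν))) ≤ a / (b * (a + b)) := by
    have h3 : a + b ≤ R * n * (1 + ν) := by
      have : (n:ℝ) ≤ R * n * (1 + ν) := by nlinarith [mul_nonneg (mul_nonneg (by positivity : (0:ℝ) ≤ R) (by positivity : (0:ℝ) ≤ n)) hν]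
      rw [ha, hb]; linarith
    gcongr
    linarith
  calc _ = (R:ℝ) ^ 2 / 4 * (a / (R * n * (1 + ν) / 2 * (R * n * (1 + ν)))) := by
        rw [show (n:ℝ) - R = 2 * a by rw [ha]; ring]; field_simp
    _ ≤ _ := by gcongr; exact h2.trans h

lemma vB_up (hν : 0 ≤ ν) (hR1 : 1 ≤ R) (hR : R + 1 ≤ n) : vB ν n R ≤ 6 := by
  have hR' : (R:ℝ) + 1 ≤ n := by exact_mod_cast hR
  have hn : (2:ℝ) ≤ n := by exact_mod_cast (by lia : 2 ≤ n)
  have hr : (1:ℝ) ≤ R := by exact_mod_cast hR1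
  have hl := aa_low (R := R) hν (by lia : 2 ≤ n)
  set b := aa ν n R / 2 with hb
  have hb0 : 0 < b := lt_of_lt_of_le (by positivity) hl
  set a := ((n:ℝ) - R) / 2 with ha
  have ha0 : 0 < a := by rw [ha]; linarith
  unfold vB
  rw [← hb, ← ha]
  have h1 := psi1_upper hb0
  have h2 := psi1_lower (add_pos ha0 hb0)
  have e : 1 / b - 1 / (a + b) = a / (b * (a + b)) := by field_simp; ring
  have h3 : a / (b * (a + b)) ≤ n / (R * n / 4 * (R * n / 4)) := by
    have : a ≤ n := by rw [ha]; linarith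
    gcongr
    linarith
  have h4 : 1 / b ^ 2 ≤ 1 / (R * n / 4) ^ 2 := by gcongr
  have h5 : (R:ℝ) ^ 2 / 4 * (n / (R * n / 4 * (R * n / 4)) + 1 / (R * n / 4) ^ 2) = 4 * (1 / n + 1 / n ^ 2) := by field_simp
  have h6 : 1 / (n:ℝ) ≤ 1 / 2 := by gcongr
  have h7 : 1 / (n:ℝ) ^ 2 ≤ 1 / 2 ^ 2 := by gcongr
  calc _ ≤ (R:ℝ) ^ 2 / 4 * (n / (R * n / 4 * (R * n / 4)) + 1 / (R * n / 4) ^ 2) := by gcongr; linarith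
    _ = _ := h5
    _ ≤ _ := by linarith

lemma vA_up (hν : 0 ≤ ν) (hR1 : 1 ≤ R) (hR : R + 1 ≤ n) :
    vA ν n R ≤ 8 * (1 + ν) ^ 2 * (R ^ 2 / n ^ 2) / ((n:ℝ) - R) + 5 / ((n:ℝ) - R) ^ 2 := by
  have hR' : (R:ℝ) + 1 ≤ n := by exact_mod_cast hR
  have hn : (2:ℝ) ≤ n := by exact_mod_cast (by lia : 2 ≤ n)
  have hr : (1:ℝ) ≤ R := by exact_mod_cast hR1
  have hl := aa_low (R := R) hν (by lia : 2 ≤ n)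
  have hba : aa ν n R / 2 - R * (((n:ℝ) - R) / 2) = (ν + R * ν + R * (R - 1)) / 2 := by unfold aa; ring
  set b := aa ν n R / 2 with hb
  have hb0 : 0 < b := lt_of_lt_of_le (by positivity) hl
  set a := ((n:ℝ) - R) / 2 with ha
  have ha0 : 0 < a := by rw [ha]; linarith
  have hm : (n:ℝ) - R = 2 * a := by rw [ha]; ring
  unfold vA
  rw [← hb, ← ha, hm]
  have h1 := psi1_upper hb0
  have h1' := psi1_upper ha0
  have h2 := psi1_lower (add_pos ha0 hb0)
  have e : 1 / a + R ^ 2 * (1 / b) - (R + 1) ^ 2 * (1 / (a + b)) = (b - R * a) ^ 2 / (a * (b * (a + b))) := by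
    field_simp; ring
  have h3 : (b - R * a) ^ 2 ≤ (R ^ 2 * (1 + ν)) ^ 2 := by
    rw [hba]
    have h0 : 0 ≤ R * ((R:ℝ) - 1) := mul_nonneg (by linarith) (by linarith)
    have hrr : (R:ℝ) ≤ R ^ 2 := by nlinarith
    apply pow_le_pow_left₀ (by positivity)
    nlinarith [mul_le_mul_of_nonneg_right hrr hν, mul_le_mul_of_nonneg_right hr hν]
  have h4 : (b - R * a) ^ 2 / (a * (b * (a + b))) ≤ (R ^ 2 * (1 + ν)) ^ 2 / (a * (R * n / 4 * (R * n / 4))) := by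
    gcongr
    linarith
  have h5 : 1 / b ^ 2 ≤ 1 / (R * a / 2) ^ 2 := by
    gcongr
    have : a ≤ n / 2 := by rw [ha]; linarith
    calc R * a / 2 ≤ R * (n / 2) / 2 := by gcongr
      _ = R * n / 4 := by ring
      _ ≤ _ := hl
  have e5 : (R:ℝ) ^ 2 * (1 / (R * a / 2) ^ 2) = 4 / a ^ 2 := by field_simp; ring
  have e6 : ((R:ℝ) ^ 2 * (1 + ν)) ^ 2 / (a * (R * n / 4 * (R * n / 4))) / 4 = 8 * (1 + ν) ^ 2 * (R ^ 2 / n ^ 2) / (2 * a) := by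
    field_simp; ring
  have e7 : 5 / (2 * a) ^ 2 = (1 / a ^ 2 + 4 / a ^ 2) / 4 := by field_simp; ring
  rw [← e6, e7, ← e5]
  have h6 : (R:ℝ) ^ 2 * psi1 b ≤ R ^ 2 * (1 / b) + R ^ 2 * (1 / (R * a / 2) ^ 2) := by
    rw [← mul_add]; gcongr; linarith
  have h7 : ((R:ℝ) + 1) ^ 2 * (1 / (a + b)) ≤ (R + 1) ^ 2 * psi1 (a + b) := by gcongr
  linarith

lemma num (hν : 0 ≤ ν) (K : ℝ) (hK : 0 ≤ K) {ε : ℝ} (hε : 0 < ε) : ∃ n0 : ℕ, ∀ n R : ℕ, n0 ≤ n → 1 ≤ R → R + 1 ≤ n →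
    (vA ν n R ≤ ε * (s2 ν n R + vB ν n R) ∧ 1 ≤ (((n:ℝ) - R) * ε) ^ 2 * (s2 ν n R + vB ν n R)) ∧
    (R + 1 = n → vA ν n R ≤ ε * s2 ν n R ∧ 1 ≤ (((n:ℝ) - R) * ε) ^ 2 * s2 ν n R ∧ 2 * vB ν n R + K ≤ ε * s2 ν n R) := by
  set M : ℝ := (8 * (1 + ν) ^ 2 + 5 + (12 + K)) / ε + 1 / ε ^ 2 with hM
  have hM0 : 0 < M := by positivity
  set δ : ℝ := rexp (-(2 * M + 1)) with hδ
  have hδ0 : 0 < δ := Real.exp_pos _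
  set C : ℝ := 1 / (ε ^ 2) + 10 / ε with hC
  have hC0 : 0 < C := by positivity
  obtain ⟨n1, hn1⟩ := exists_nat_gt (C * (4 * (1 + ν) ^ 2) / δ ^ 3 + 64 * (1 + ν) ^ 3 / ε / δ + 1 / δ)
  refine ⟨n1, fun n R hn hR1 hR => ?_⟩
  have hnn : C * (4 * (1 + ν) ^ 2) / δ ^ 3 + 64 * (1 + ν) ^ 3 / ε / δ + 1 / δ < n := hn1.trans_le (by exact_mod_cast hn)
  have q1 : 0 ≤ C * (4 * (1 + ν) ^ 2) / δ ^ 3 := by positivity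
  have q2 : 0 ≤ 64 * (1 + ν) ^ 3 / ε / δ := by positivity
  have q3 : 0 ≤ 1 / δ := by positivity
  have hR' : (R:ℝ) + 1 ≤ n := by exact_mod_cast hR
  have hn2 : (2:ℝ) ≤ n := by exact_mod_cast (by lia : 2 ≤ n)
  have hr : (1:ℝ) ≤ R := by exact_mod_cast hR1
  have hA := vA_up hν hR1 hR
  have hBl := vB_low hν hR1 hR
  have hBu := vB_up hν hR1 hR
  have hs1 := s2_log hν hR
  have hs2 := s2_sq hν hR
  set m : ℝ := (n:ℝ) - R with hm
  have hm1 : 1 ≤ m := by rw [hm]; linarith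
  have hB0 : 0 ≤ vB ν n R := le_trans (by positivity) hBl
  have hs0 : 0 ≤ s2 ν n R := by
    have h1 : 0 ≤ (R:ℝ) ^ 2 / n ^ 2 := by positivity
    have h2 := h1.trans hs2
    exact nonneg_of_mul_nonneg_right h2 (by positivity)
  have big : m < δ * n → M ≤ s2 ν n R := by
    intro hlt
    refine le_trans ?_ hs1
    have : 1 / δ ≤ n / m := by
      rw [div_le_div_iff₀ hδ0 (by linarith)]; linarith
    have h2 := Real.log_le_log (by positivity) this
    rw [one_div, Real.log_inv, hδ, Real.log_exp] at h2
    linarith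
  have hA' : vA ν n R ≤ 8 * (1 + ν) ^ 2 + 5 := by
    refine hA.trans ?_
    have h1 : (R:ℝ) ^ 2 / n ^ 2 ≤ 1 := by
      rw [div_le_one (by positivity)]; gcongr; linarith
    have h2 : 8 * (1 + ν) ^ 2 * ((R:ℝ) ^ 2 / n ^ 2) / m ≤ 8 * (1 + ν) ^ 2 * 1 / 1 := by gcongr
    have h3 : 5 / m ^ 2 ≤ 5 / 1 ^ 2 := by gcongr
    linarith
  have caseB : ∀ V, M ≤ V → vA ν n R ≤ ε * V ∧ 1 ≤ (m * ε) ^ 2 * V ∧ 12 + K ≤ ε * V := by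
    intro V hV
    have h1 : ε * M ≤ ε * V := by gcongr
    have h2 : ε * M = (8 * (1 + ν) ^ 2 + 5 + (12 + K)) + 1 / ε := by rw [hM]; field_simp
    have h3 : 0 < 1 / ε := by positivity
    have h4 : 0 ≤ 8 * (1 + ν) ^ 2 := by positivity
    refine ⟨by linarith, ?_, by linarith⟩
    have h5 : 1 / ε ^ 2 ≤ V := by
      refine le_trans ?_ hV
      rw [hM]
      have : 0 ≤ (8 * (1 + ν) ^ 2 + 5 + (12 + K)) / ε := by positivity
      linarith
    calc 1 = (1 * ε) ^ 2 * (1 / ε ^ 2) := by field_simp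
      _ ≤ _ := by gcongr
  refine ⟨?_, fun hRn => ?_⟩
  · rcases lt_or_ge m (δ * n) with hlt | hge
    · have := caseB (s2 ν n R + vB ν n R) (by linarith [big hlt])
      exact ⟨this.1, this.2.1⟩
    · set V := s2 ν n R + vB ν n R with hV
      have hV0 : 0 ≤ V := by positivity
      have h1 : C ≤ m ^ 2 * V := by
        have h2 : C * (4 * (1 + ν) ^ 2) / δ ^ 3 ≤ n := by linarith
        rw [div_le_iff₀ (by positivity)] at h2
        have h3 : m ^ 2 * (m / (4 * (1 + ν) ^ 2 * n ^ 2)) ≤ m ^ 2 * V := by gcongr; linarith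
        refine le_trans ?_ h3
        rw [← mul_div_assoc, le_div_iff₀ (by positivity)]
        calc C * (4 * (1 + ν) ^ 2 * n ^ 2) = (C * (4 * (1 + ν) ^ 2)) * n ^ 2 := by ring
          _ ≤ (n * δ ^ 3) * n ^ 2 := by gcongr
          _ = (δ * n) ^ 3 := by ring
          _ ≤ m ^ 3 := by gcongr
          _ = _ := by ring
      constructor
      · have h2 : 64 * (1 + ν) ^ 3 / ε ≤ m := by
          refine le_trans ?_ hge
          have : 64 * (1 + ν) ^ 3 / ε / δ ≤ n := by linarith
          rw [div_le_iff₀ hδ0] at this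
          linarith
        have h3 : 10 / ε ≤ m ^ 2 * V := by
          have : 0 < 1 / ε ^ 2 := by positivity
          linarith
        have h4 : 5 / m ^ 2 ≤ ε / 2 * V := by
          rw [div_le_iff₀ (by positivity)]
          rw [div_le_iff₀ hε] at h3
          linarith
        have h5 : 8 * (1 + ν) ^ 2 * ((R:ℝ) ^ 2 / n ^ 2) / m ≤ ε / 2 * V := by
          rw [div_le_iff₀ (by positivity)]
          have h6 : (R:ℝ) ^ 2 / n ^ 2 ≤ 4 * (1 + ν) * V := hs2.trans (by gcongr; linarith)
          rw [div_le_iff₀ hε] at h2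
          calc _ ≤ 8 * (1 + ν) ^ 2 * (4 * (1 + ν) * V) := by gcongr
            _ = 64 * (1 + ν) ^ 3 * (V / 2) := by ring
            _ ≤ m * ε * (V / 2) := by gcongr
            _ = _ := by ring
        linarith
      · have h2 : 1 / ε ^ 2 ≤ m ^ 2 * V := by
          have : 0 < 10 / ε := by positivity
          linarith
        rw [div_le_iff₀ (by positivity)] at h2
        linarith
  · have hmm : m = 1 := by
      rw [hm, ← hRn]; push_cast; ring
    have : m < δ * n := by
      have : 1 / δ < n := by linarith
      rw [div_lt_iff₀ hδ0] at this
      linarith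
    have := caseB _ (big this)
    exact ⟨this.1, this.2.1, by linarith [this.2.2]⟩

end num

end RS

open scoped ENNReal

namespace RS

lemma S_near {S : Measure ℝ} [IsProbabilityMeasure S] {k : ℕ} {A B : ℕ → ℝ} {m : ℝ} (hm : 0 < m)
    (hA : ∀ j < k, m ≤ 2 * A j) (hB : ∀ j < k, 0 < B j)
    (h : ∀ t, charFun S t = ∏ j ∈ range k, charFun (hlb (A j) (B j)) t) :
    Near S (var S / (2 * m)) ∧ var S = ∑ j ∈ range k, (psi1 (A j) - psi1 (A j + B j)) / 4 := by
  have hA0 : ∀ j < k, 0 < A j := fun j hj => by linarith [hA j hj]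
  have hp : ∀ j < k, IsProbabilityMeasure (hlb (A j) (B j)) := fun j hj => hlb_prob (hA0 j hj) (hB j hj)
  have := convN_prob (fun j => hlb (A j) (B j)) k hp
  have hS : S = convN (fun j => hlb (A j) (B j)) k := by
    apply Measure.ext_of_charFun
    ext t
    rw [h, charFun_convN _ k hp]
  have h1 := convN_near (fun j => hlb (A j) (B j)) (fun j => 1 / (2 * m) * var (hlb (A j) (B j))) k hp
    (fun j hj => (hlb_near (hA0 j hj) (hB j hj)).1.mono (by
      have := hA0 j hj
      have := var_nonneg (hlb (A j) (B j))
      refine mul_le_mul_of_nonneg_right ?_ this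
      rw [div_div]
      apply one_div_le_one_div_of_le (by positivity)
      linarith [hA j hj]))
  rw [← hS] at h1
  constructor
  · have := h1.1
    rw [← mul_sum, ← h1.2] at this
    convert this using 1
    ring
  · rw [h1.2]
    exact sum_congr rfl fun j hj => (hlb_near (hA0 j (mem_range.1 hj)) (hB j (mem_range.1 hj))).2

lemma core_good {ν : ℝ} (hν : 0 ≤ ν) (K : ℝ) (hK : 0 ≤ K) {ε : ℝ} (hε : 0 < ε) : ∃ n0 : ℕ, ∀ n R : ℕ, n0 ≤ n → 1 ≤ R → R + 1 ≤ n →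
    ∀ (P S : Measure ℝ) [IsProbabilityMeasure S], Near S (var S / (2 * ((n:ℝ) - R))) → var S = s2 ν n R →
    ((∀ t, charFun P t * charFun (ab (((n:ℝ) - R) / 2) (aa ν n R / 2) (1 / 2) (R / 2)) t =
        charFun S t * charFun (ab (((n:ℝ) - R) / 2) (aa ν n R / 2) 0 (R / 2)) t) → Good P ε) ∧
    (R + 1 = n → ∀ B : Measure ℝ, IsProbabilityMeasure B → L2 B →
      var B ≤ 2 * var (ab (((n:ℝ) - R) / 2) (aa ν n R / 2) 0 (R / 2)) + K →
      (∀ t, charFun P t * charFun (ab (((n:ℝ) - R) / 2) (aa ν n R / 2) (1 / 2) (R / 2)) t =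
        charFun S t * charFun B t) → Good P ε) := by
  obtain ⟨n0, h0⟩ := num hν K hK hε
  refine ⟨n0, fun n R hn hR1 hR P S _ hS hvS => ?_⟩
  obtain ⟨⟨h1, h2⟩, h3⟩ := h0 n R hn hR1 hR
  have hR' : (R:ℝ) + 1 ≤ n := by exact_mod_cast hR
  have hn2 : (2:ℝ) ≤ n := by exact_mod_cast (by lia : 2 ≤ n)
  have hr : (1:ℝ) ≤ R := by exact_mod_cast hR1
  have hl := aa_low (R := R) hν (by lia : 2 ≤ n)
  have hb0 : 0 < aa ν n R / 2 := lt_of_lt_of_le (by positivity) hl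
  have ha0 : 0 < ((n:ℝ) - R) / 2 := by linarith
  have i1 := ab_prob ha0 hb0 (1 / 2) (R / 2)
  have i2 := ab_prob ha0 hb0 0 (R / 2)
  obtain ⟨hA1, hA2⟩ := ab_stats ha0 hb0 (1 / 2) (R / 2)
  obtain ⟨hB1, hB2⟩ := ab_stats ha0 hb0 0 (R / 2)
  have hA3 : var (ab (((n:ℝ) - R) / 2) (aa ν n R / 2) (1 / 2) (R / 2)) = vA ν n R := by
    rw [hA2, vA]; ring
  have hB3 : var (ab (((n:ℝ) - R) / 2) (aa ν n R / 2) 0 (R / 2)) = vB ν n R := by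
    rw [hB2, vB]; ring
  constructor
  · intro hc
    have hBn := ab_near ha0 hb0 (show 0 ≤ (R:ℝ) / 2 by positivity)
    set B := ab (((n:ℝ) - R) / 2) (aa ν n R / 2) 0 (R / 2)
    have hst := conv_L2 hS.1 hB1
    have hcv := hS.conv hBn
    refine good_of (S := S.conv B) (B := Measure.dirac 0) (m := ((n:ℝ) - R) / 2) hA1 dirac_near.1.1 ?_ (hcv.mono ?_) (by linarith) hε ?_ ?_ ?_
    · intro t
      rw [hc, charFun_conv]
      simp
    · rw [hst.2.2]
      have hv1 := var_nonneg S
      have hv2 := var_nonneg B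
      have hm : (0:ℝ) < n - R := by linarith
      have e1 : var S / (2 * ((n:ℝ) - R)) ≤ var S / (2 * (((n:ℝ) - R) / 2)) := by gcongr; linarith
      have e2 : (R:ℝ) / 2 / (aa ν n R / 2) / 2 ≤ 1 / (2 * (((n:ℝ) - R) / 2)) := by
        calc (R:ℝ) / 2 / (aa ν n R / 2) / 2 ≤ R / 2 / (R * n / 4) / 2 := by gcongr
          _ = 1 / n := by field_simp; norm_num
          _ ≤ 1 / (2 * (((n:ℝ) - R) / 2)) := by gcongr; linarith
      calc _ ≤ var S / (2 * (((n:ℝ) - R) / 2)) + 1 / (2 * (((n:ℝ) - R) / 2)) * var B := by gcongr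
        _ = _ := by ring
    · rw [hst.2.2, hvS, hB3]
      convert h2 using 2
      ring
    · rw [hst.2.2, hvS, hB3, hA3]; exact h1
    · rw [dirac_near.2]
      have := var_nonneg (S.conv B)
      positivity
  · intro hRn B _ hB hBv hc
    obtain ⟨h4, h5, h6⟩ := h3 hRn
    refine good_of hA1 hB hc hS (by linarith) hε ?_ (by rw [hA3, hvS]; exact h4) ?_
    · rw [hvS]
      have := var_nonneg S
      rw [hvS] at this
      have e : (2 * ((n:ℝ) - R) * ε) ^ 2 * s2 ν n R = 4 * ((((n:ℝ) - R) * ε) ^ 2 * s2 ν n R) := by ring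
      linarith
    · rw [hvS]
      rw [hB3] at hBv
      linarith

/-- the law of the volume functional -/
noncomputable def VP {N : ℕ} (μ : Measure (E N)) (r : ℕ) : Measure ℝ :=
  (Measure.pi fun _ : Fin (r + 1) => μ).map (fun X => DV (X 0) (fun i : Fin r => X i.succ))

lemma DV_meas (N r : ℕ) : Measurable (fun X : Fin (r + 1) → E N => DV (X 0) (fun i : Fin r => X i.succ)) := by
  unfold DV
  apply Dn_continuous.measurable.comp
  fun_prop

lemma VP_beta (N r : ℕ) {b : ℝ} (hb : 0 < b) : VP (betaModel N b) r = Q @DV N r 0 b b := by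
  have := beta_prob N hb
  rw [VP, ← pi_cons, Measure.map_map (DV_meas N r) measurable_cons, Q]
  congr 1
  ext1 q
  simp [Function.comp]

lemma s2_eq {n R : ℕ} {ν : ℝ} : s2 ν n R = ∑ j ∈ range (R + 1), (psi1 (((n : ℝ) - j) / 2) - psi1 (((n : ℝ) - j) / 2 + (ν + j) / 2)) / 4 := by
  unfold s2
  refine sum_congr rfl fun j _ => ?_
  congr 3
  ring

lemma beta_good {ν : ℝ} (hν : 0 < ν) {ε : ℝ} (hε : 0 < ε) : ∃ n0 : ℕ, ∀ n r : ℕ, n0 ≤ n → 1 ≤ r → r ≤ n →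
    Pos (VP (betaModel n ν) r) ∧ Good ((VP (betaModel n ν) r).map Real.log) ε := by
  obtain ⟨K, hK⟩ := QL11_stats
  obtain ⟨n0, h0⟩ := core_good hν.le (max K 0) (le_max_right _ _) hε
  refine ⟨max n0 3, fun n r hn hr1 hr => ?_⟩
  have hn0 : n0 ≤ n := (le_max_left _ _).trans hn
  have hn3 : 3 ≤ n := (le_max_right _ _).trans hn
  rw [VP_beta n r hν]
  have hpos : Pos (Q @DV n r 0 ν ν) := by
    have := QV_pos (n - r) r 0 hν hν
    rwa [Nat.sub_add_cancel hr] at this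
  refine ⟨hpos, ?_⟩
  have key : ∀ R, 1 ≤ R → R + 1 ≤ n → IsProbabilityMeasure (QL @DO n R 0 ν ν) ∧
      Near (QL @DO n R 0 ν ν) (var (QL @DO n R 0 ν ν) / (2 * ((n:ℝ) - R))) ∧ var (QL @DO n R 0 ν ν) = s2 ν n R := by
    intro R hR1 hR
    have i := QL_prob goodDO n R 0 hν hν
    refine ⟨i, ?_⟩
    have hR' : (R:ℝ) + 1 ≤ n := by exact_mod_cast hR
    have h := (DL_beta (R + 1) (n - (R + 1)) hν).2
    rw [Nat.sub_add_cancel hR, ← QO_eq n R hν] at h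
    rw [s2_eq]
    refine S_near (by linarith) ?_ ?_ (fun t => (h t).trans ?_)
    · intro j hj
      have : (j:ℝ) ≤ R := by exact_mod_cast (by lia : j ≤ R)
      linarith
    · intro j hj; positivity
    · refine prod_congr rfl fun j _ => ?_
      rw [Nat.cast_sub hR]
      congr 2
      push_cast
      ring
  rcases hr.eq_or_lt with rfl | hlt
  · obtain ⟨i, h1, h2⟩ := key (r - 1) (by lia) (by lia)
    have hr3 : (3:ℝ) ≤ r := by exact_mod_cast hn3
    have ha' : aa ν r (r - 1) = ν + (r - 1 : ℕ) * (ν + (0 + 1 : ℕ) + (r - 1 : ℕ) - 1) := by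
      unfold aa
      rw [Nat.cast_sub (by lia : 1 ≤ r)]
      push_cast; ring
    have hb : (2:ℝ) ≤ ν + (r - 1 : ℕ) := by
      rw [Nat.cast_sub (by lia : 1 ≤ r)]; push_cast; linarith
    have hba : ν + (r - 1 : ℕ) ≤ aa ν r (r - 1) := by
      unfold aa
      rw [Nat.cast_sub (by lia : 1 ≤ r)]; push_cast
      nlinarith
    have hs := hK (aa ν r (r - 1)) (ν + (r - 1 : ℕ)) (0 + (r - 1)) hb hba
    have hap : 0 < aa ν r (r - 1) := by linarith
    have hq : ((r:ℝ) - (r - 1 : ℕ)) / 2 = 1 / 2 := by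
      rw [Nat.cast_sub (by lia : 1 ≤ r)]; push_cast; ring
    refine (h0 r (r - 1) hn0 (by lia) (by lia) (QL @DV r r 0 ν ν) _ h1 h2).2 (by lia)
      (QL @DV 1 1 (0 + (r - 1)) (aa ν r (r - 1)) (ν + (r - 1 : ℕ))) (QL_prob goodDV _ _ _ hap (by linarith)) hs.1 ?_ fun t => ?_
    · refine hs.2.trans ?_
      rw [hq, zero_add]
      have := le_max_left K 0
      linarith
    · have h := comb2 (r - 1) 0 hν hν t
      rw [← ha', show 1 + (r - 1) = r by lia] at h
      rw [hq]
      simpa using h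
  · obtain ⟨i, h1, h2⟩ := key r hr1 hlt
    refine (h0 n r hn0 hr1 hlt (QL @DV n r 0 ν ν) _ h1 h2).1 fun t => ?_
    have h := comb1 (n - r - 1) r 0 hν hν t
    have e1 : n - r - 1 + 1 + r = n := by lia
    have e2 : ((n - r - 1 : ℕ) : ℝ) + 1 = n - r := by
      have : n - r - 1 + 1 = n - r := by lia
      have := congrArg (Nat.cast (R := ℝ)) this
      rw [Nat.cast_sub hr] at this
      push_cast at this
      exact this
    have e3 : ν + r * (ν + ((n - r - 1 + 1 : ℕ) : ℝ) + r - 1) = aa ν n r := by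
      unfold aa
      push_cast
      rw [e2]; ring
    rw [e1, e2, e3, zero_add] at h
    exact h

lemma transfer (r : ℕ → ℕ) (μ : (n : ℕ) → Measure (E n))
    (h : ∀ ε : ℝ, 0 < ε → ∀ᶠ n in atTop, IsProbabilityMeasure (μ n) ∧ Pos (VP (μ n) (r n)) ∧ Good ((VP (μ n) (r n)).map Real.log) ε)
    (f : BoundedContinuousFunction ℝ ℝ) :
      Tendsto
        (fun n : ℕ =>
          ∫ X, f ((Lnr n (r n) X
              - ∫ Y, Lnr n (r n) Y ∂(Measure.pi fun _ : Fin (r n + 1) => μ n))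
            / Real.sqrt (variance (Lnr n (r n)) (Measure.pi fun _ : Fin (r n + 1) => μ n)))
            ∂(Measure.pi fun _ : Fin (r n + 1) => μ n))
        atTop (nhds (∫ z, f z ∂gaussianReal 0 1)) := by
  let c : ℕ → ℝ := fun n => Real.log (((r n).factorial : ℝ) * (μH[(r n : ℝ)] (refS (r n))).toReal)
  have hcl := clt' (fun n => ((VP (μ n) (r n)).map Real.log).map (fun x => x + c n)) (fun ε hε => by
    filter_upwards [h ε hε] with n hn
    obtain ⟨i, _, hg⟩ := hn
    refine ⟨?_, hg.shift _⟩
    have : IsProbabilityMeasure (VP (μ n) (r n)) := Measure.isProbabilityMeasure_map (DV_meas _ _).aemeasurable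
    have : IsProbabilityMeasure ((VP (μ n) (r n)).map Real.log) := Measure.isProbabilityMeasure_map (by fun_prop)
    exact Measure.isProbabilityMeasure_map (by fun_prop)) f
  refine hcl.congr' ?_
  filter_upwards [h 1 one_pos] with n hn
  obtain ⟨i, hp, -⟩ := hn
  have hae := ae_of_ae_map (DV_meas n (r n)).aemeasurable hp.ae
  have hL : ∀ᵐ X ∂(Measure.pi fun _ : Fin (r n + 1) => μ n), Real.log (DV (X 0) (fun i : Fin (r n) => X i.succ)) + c n = Lnr n (r n) X := by
    filter_upwards [hae] with X hX
    have h1 : 0 < (μH[(r n : ℝ)] (refS (r n))).toReal := refS_pos _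
    have h2 : (0:ℝ) < (r n).factorial := by exact_mod_cast Nat.factorial_pos _
    rw [Lnr, simplexVol_eq]
    change _ = Real.log (_ * (DV (X 0) (fun i : Fin (r n) => X i.succ) * _))
    rw [show ∀ a b c : ℝ, a * (b * c) = b * (a * c) by intros; ring, Real.log_mul hX.ne' (by positivity)]
  have hmeas : Measurable (fun X : Fin (r n + 1) → E n => Real.log (DV (X 0) (fun i : Fin (r n) => X i.succ)) + c n) :=
    ((DV_meas n (r n)).log).add_const _
  have hmap : ((VP (μ n) (r n)).map Real.log).map (fun x => x + c n) =
      (Measure.pi fun _ : Fin (r n + 1) => μ n).map (fun X => Real.log (DV (X 0) (fun i : Fin (r n) => X i.succ)) + c n) := by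
    rw [Measure.map_map (by fun_prop) (by fun_prop), VP, Measure.map_map (by fun_prop) (DV_meas _ _)]
    rfl
  have hmean : mean (((VP (μ n) (r n)).map Real.log).map (fun x => x + c n)) = ∫ Y, Lnr n (r n) Y ∂(Measure.pi fun _ : Fin (r n + 1) => μ n) := by
    rw [hmap, mean, integral_map hmeas.aemeasurable (by fun_prop)]
    exact integral_congr_ae hL
  have hvar : var (((VP (μ n) (r n)).map Real.log).map (fun x => x + c n)) = variance (Lnr n (r n)) (Measure.pi fun _ : Fin (r n + 1) => μ n) := by
    rw [hmap, var, variance_id_map hmeas.aemeasurable]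
    exact variance_congr hL
  rw [hmean, hvar, hmap, integral_map hmeas.aemeasurable]
  · refine integral_congr_ae ?_
    filter_upwards [hL] with X hX
    rw [hX]
  · exact (f.continuous.measurable.comp (by fun_prop)).aestronglyMeasurable

end RS

open scoped ENNReal
namespace RS

/-- the Gaussian model -/
noncomputable abbrev sG (N : ℕ) : Measure (E N) := _root_.stdGaussian N

lemma sG_dens_meas (N : ℕ) : Measurable (fun x : E N =>
    ENNReal.ofReal ((2 * π) ^ (-(N : ℝ) / 2) * Real.exp (-‖x‖ ^ 2 / 2))) := by fun_prop

lemma sG_charFun (N : ℕ) (t : E N) : charFun (sG N) t = Complex.exp (-‖t‖ ^ 2 / 2) := by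
  rw [charFun_apply, sG, _root_.stdGaussian, integral_withDensity_eq_integral_toReal_smul (sG_dens_meas N) (by simp)]
  have h := GaussianFourier.integral_cexp_neg_mul_sq_norm_add (V := E N) (b := 1 / 2) (by norm_num) Complex.I t
  have h1 : ∀ v : E N, (ENNReal.ofReal ((2 * π) ^ (-(N : ℝ) / 2) * Real.exp (-‖v‖ ^ 2 / 2))).toReal • Complex.exp (inner ℝ v t * Complex.I)
      = (((2 * π) ^ (-(N : ℝ) / 2) : ℝ) : ℂ) * Complex.exp (-(1 / 2) * ‖v‖ ^ 2 + Complex.I * inner ℝ t v) := by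
    intro v
    rw [ENNReal.toReal_ofReal (by positivity), Complex.real_smul, Complex.ofReal_mul, mul_assoc, Complex.ofReal_exp,
      ← Complex.exp_add, real_inner_comm]
    congr 2
    push_cast; ring
  simp_rw [h1]
  rw [integral_const_mul, h, ← mul_assoc]
  have h2 : (((2 * π) ^ (-(N : ℝ) / 2) : ℝ) : ℂ) * ((π : ℂ) / (1 / 2)) ^ ((Module.finrank ℝ (E N) : ℂ) / 2) = 1 := by
    have : ((π : ℂ) / (1 / 2)) ^ ((Module.finrank ℝ (E N) : ℂ) / 2) = (((2 * π) ^ ((N : ℝ) / 2) : ℝ) : ℂ) := by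
      rw [Complex.ofReal_cpow (by positivity)]
      simp; congr 1; ring
    rw [this, ← Complex.ofReal_mul, ← Real.rpow_add (by positivity)]
    simp [neg_div]
  rw [h2, one_mul]
  congr 1
  rw [Complex.I_sq]; ring

lemma sG_prob (N : ℕ) : IsProbabilityMeasure (sG N) := by
  have h0 := sG_charFun N 0
  rw [charFun_zero] at h0
  simp at h0
  constructor
  have : (sG N).real Set.univ = 1 := by exact_mod_cast h0
  rw [measureReal_def] at this
  exact (ENNReal.toReal_eq_one_iff _).1 this

lemma sG_rot (N : ℕ) : RotInv (sG N) := by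
  unfold sG _root_.stdGaussian
  exact rotInv_density _ (sG_dens_meas N) (by simp)

lemma sG_proj (N : ℕ) : (sG (N + 1)).map et = sG N := by
  have := sG_prob (N + 1)
  have := sG_prob N
  have : IsProbabilityMeasure ((sG (N + 1)).map et) := Measure.isProbabilityMeasure_map measurable_et.aemeasurable
  refine Measure.ext_of_charFun (funext fun t => ?_)
  have h : charFun ((sG (N + 1)).map et) t = charFun (sG (N + 1)) (ec 0 t) := by
    rw [charFun_apply, charFun_apply, integral_map measurable_et.aemeasurable (by fun_prop)]
    simp [inner_split]
  rw [h, sG_charFun, sG_charFun]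
  congr 2
  have := norm_sq_ec 0 t
  simp only [ne_eq, OfNat.ofNat_ne_zero, not_false_eq_true, zero_pow, zero_add] at this
  rw_mod_cast [this]

lemma sG_norm (N : ℕ) : (sG (N + 1)).map (fun x => 1 / 2 * ‖x‖ ^ 2) = gammaMeasure (((N : ℝ) + 1) / 2) 1 := by
  have := sG_prob (N + 1)
  have hA : 0 < ((N : ℝ) + 1) / 2 := by positivity
  have := isProbabilityMeasure_gammaMeasure hA one_pos
  have : IsProbabilityMeasure ((sG (N + 1)).map (fun x => 1 / 2 * ‖x‖ ^ 2)) := Measure.isProbabilityMeasure_map (by fun_prop)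
  have hG := Real.Gamma_pos_of_pos hA
  set c : ℝ≥0∞ := ENNReal.ofReal ((2 * π) ^ (-((N + 1 : ℕ) : ℝ) / 2)) with hc
  set K : ℝ := Real.Gamma (((N : ℝ) + 1) / 2) * 2 ^ (((N : ℝ) + 1) / 2 - 1) with hK
  have hK0 : 0 < K := by positivity
  refine eq_of_smul (c * (Cn N * ENNReal.ofReal K)) fun g hg => ?_
  rw [lintegral_map hg (by fun_prop), sG, _root_.stdGaussian, lintegral_withDensity_eq_lintegral_mul _ (sG_dens_meas _) (by fun_prop)]
  have e1 : ∀ x : E (N + 1), ENNReal.ofReal ((2 * π) ^ (-((N + 1 : ℕ) : ℝ) / 2) * Real.exp (-‖x‖ ^ 2 / 2)) * g (1 / 2 * ‖x‖ ^ 2)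
      = c * (fun s => ENNReal.ofReal (Real.exp (-s ^ 2 / 2)) * g (1 / 2 * s ^ 2)) ‖x‖ := by
    intro x
    simp only [hc]
    rw [ENNReal.ofReal_mul (by positivity), mul_assoc]
  simp only [Pi.mul_apply]
  rw [lintegral_congr e1, lintegral_const_mul _ (by fun_prop), lint_radial (fun s => ENNReal.ofReal (Real.exp (-s ^ 2 / 2)) * g (1 / 2 * s ^ 2)) (by fun_prop), mul_assoc, mul_assoc]
  congr 2
  have hpm : Measurable (gammaPDF (((N : ℝ) + 1) / 2) 1) := (measurable_gammaPDFReal _ _).ennreal_ofReal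
  rw [gammaMeasure, lintegral_withDensity_eq_lintegral_mul _ hpm hg, lint_scale one_half_pos,
    ← lintegral_add_compl (μ := volume) _ (measurableSet_Ioi (a := (0:ℝ)))]
  have hz : ∫⁻ (x : ℝ) in (Set.Ioi 0)ᶜ, (gammaPDF (((N : ℝ) + 1) / 2) 1 * g) (1 / 2 * x) = 0 := by
    rw [Set.compl_Ioi, setLIntegral_congr (Iio_ae_eq_Iic (μ := volume)).symm]
    refine setLIntegral_eq_zero measurableSet_Iio fun x hx => ?_
    simp only [Pi.mul_apply, Pi.zero_apply]
    rw [gammaPDF_of_neg (by simp at hx ⊢; linarith), zero_mul]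
  rw [hz, add_zero]
  conv_rhs => rw [lint_sq]
  rw [← mul_assoc, ← lintegral_const_mul _ (by fun_prop)]
  refine setLIntegral_congr_fun measurableSet_Ioi fun s hs => ?_
  have hs : 0 < s := hs
  simp only [Pi.mul_apply]
  rw [gammaPDF_of_nonneg (by positivity), ← mul_assoc, ← mul_assoc, ← mul_assoc, ← ENNReal.ofReal_mul (by positivity),
    ← ENNReal.ofReal_mul (by positivity), ← ENNReal.ofReal_mul (by positivity), ← ENNReal.ofReal_mul (by positivity)]
  congr 2
  have hss : (s ^ 2) ^ (((N:ℝ) + 1) / 2 - 1) = s ^ N / s := by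
    rw [← Real.rpow_natCast s 2, ← Real.rpow_mul hs.le, show ((2:ℕ):ℝ) * (((N:ℝ) + 1) / 2 - 1) = (N : ℝ) - 1 by push_cast; ring,
      Real.rpow_sub hs, Real.rpow_one, Real.rpow_natCast]
  rw [Real.mul_rpow (by positivity) (by positivity), hss, hK, one_div, Real.inv_rpow (by positivity), Real.one_rpow,
    show -(1 * (2⁻¹ * s ^ 2)) = -s ^ 2 / 2 by ring]
  have : (0:ℝ) < 2 ^ (((N : ℝ) + 1) / 2 - 1) := by positivity
  field_simp

end RS

open scoped ENNReal
namespace RS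

noncomputable def hlg (a : ℝ) : Measure ℝ := (lg a).map (fun x => 1 / 2 * x)

lemma hlg_prob {a : ℝ} (ha : 0 < a) : IsProbabilityMeasure (hlg a) := by
  have := lg_prob ha
  exact Measure.isProbabilityMeasure_map (by fun_prop)

lemma pos_norm_sG (N : ℕ) : ∀ᵐ x ∂(sG (N + 1)), 0 < ‖x‖ := by
  have h : sG (N + 1) ≪ volume := withDensity_absolutelyContinuous _ _
  refine h.ae_le (?_ : ∀ᵐ x ∂volume, 0 < ‖x‖)
  rw [ae_iff]
  have : {a : E (N + 1) | ¬0 < ‖a‖} = {0} := by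
    ext x; simp
  rw [this]
  have : Nontrivial (E (N + 1)) := by infer_instance
  simp

lemma log_norm_sG (N : ℕ) :
    ((sG (N + 1)).map (fun x => ‖x‖)).map Real.log = (hlg (((N : ℝ) + 1) / 2)).map (fun x => x + Real.log 2 / 2) := by
  rw [hlg, lg, ← sG_norm N, Measure.map_map (by fun_prop) (by fun_prop), Measure.map_map (by fun_prop) (by fun_prop), Measure.map_map (by fun_prop) (by fun_prop), Measure.map_map (by fun_prop) (by fun_prop)]
  refine Measure.map_congr ?_
  filter_upwards [pos_norm_sG N] with x hx
  simp only [Function.comp]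
  rw [Real.log_mul (by norm_num) (by positivity), Real.log_pow, one_div, Real.log_inv]
  push_cast; ring

lemma DL_sG (k : ℕ) : ∀ (N : ℕ), Pos (DL (sG (N + k)) k) ∧
    ∀ t, charFun ((DL (sG (N + k)) k).map Real.log) t =
      (∏ j ∈ range k, charFun (hlg (((N : ℝ) + k - j) / 2)) t) * Complex.exp (((k * (Real.log 2 / 2) * t : ℝ) : ℂ) * Complex.I) := by
  induction k with
  | zero =>
    intro N
    have := sG_prob N
    have h : DL (sG (N + 0)) 0 = Measure.dirac 1 := by
      unfold DL
      have : (Dn : (Fin 0 → E (N + 0)) → ℝ) = fun _ => 1 := funext Dn_zero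
      rw [this, Measure.map_const]
      simp
    rw [h, Measure.map_dirac' Real.measurable_log]
    refine ⟨?_, fun t => by simp⟩
    simp [Pos]
  | succ k ih =>
    intro N
    obtain ⟨h1, h2⟩ := ih N
    have := sG_prob (N + k + 1)
    have := sG_prob (N + k)
    have hl := DL_succ (sG (N + k + 1)) (sG_rot _) k
    rw [sG_proj] at hl
    have hp : Pos ((sG (N + k + 1)).map (fun x => ‖x‖)) := by
      apply Pos.of_ae
      rw [ae_map_iff (by fun_prop) measurableSet_Ioi]
      exact pos_norm_sG _
    have : IsProbabilityMeasure ((sG (N + k + 1)).map (fun x => ‖x‖)) := Measure.isProbabilityMeasure_map (by fun_prop)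
    have := DL_prob (sG (N + k)) k
    change Pos (DL (sG (N + k + 1)) (k + 1)) ∧ ∀ t, charFun ((DL (sG (N + k + 1)) (k + 1)).map Real.log) t = _
    rw [hl]
    refine ⟨pos_mconv hp h1, fun t => ?_⟩
    have : IsProbabilityMeasure ((DL (sG (N + k)) k).map Real.log) := Measure.isProbabilityMeasure_map (by fun_prop)
    have hA : (0:ℝ) < (((N + k : ℕ) : ℝ) + 1) / 2 := by positivity
    have := hlg_prob hA
    have : IsProbabilityMeasure ((hlg ((((N + k : ℕ) : ℝ) + 1) / 2)).map (fun x => x + Real.log 2 / 2)) := Measure.isProbabilityMeasure_map (by fun_prop)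
    rw [log_mconv hp h1, log_norm_sG, charFun_conv, h2, Finset.prod_range_succ', charFun_map_add_const]
    have e1 : (((k + 1 : ℕ) * (Real.log 2 / 2) * t : ℝ) : ℂ) * Complex.I = ((inner ℝ (Real.log 2 / 2) t : ℝ) : ℂ) * Complex.I
       + ((k * (Real.log 2 / 2) * t : ℝ) : ℂ) * Complex.I := by
      simp; ring
    have e2 : ∏ j ∈ range k, charFun (hlg (((N : ℝ) + (k + 1 : ℕ) - (j + 1 : ℕ)) / 2)) t = ∏ j ∈ range k, charFun (hlg (((N : ℝ) + k - j) / 2)) t := by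
      refine Finset.prod_congr rfl fun j _ => ?_
      congr 2; push_cast; ring
    have e3 : ((N : ℝ) + (k + 1 : ℕ) - (0 : ℕ)) / 2 = (((N + k : ℕ) : ℝ) + 1) / 2 := by push_cast; ring
    rw [e1, e2, e3, Complex.exp_add]
    ring

lemma gpi {N k : ℕ} (s : Fin k → E N) : ∫ X, Complex.exp (((∑ i, inner ℝ (X i) (s i) : ℝ) : ℂ) * Complex.I) ∂(Measure.pi fun _ : Fin k => sG N)
    = Complex.exp (((-(∑ i, ‖s i‖ ^ 2) / 2 : ℝ) : ℂ)) := by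
  have := sG_prob N
  have h := charFun_pi (μ := fun _ : Fin k => sG N) (WithLp.toLp 2 s)
  rw [charFun_apply, ← MeasurableEquiv.coe_toLp, integral_map_equiv] at h
  simp only [sG_charFun] at h
  rw [← Complex.exp_sum] at h
  have e : ∀ X : Fin k → E N, inner ℝ ((MeasurableEquiv.toLp 2 (Fin k → E N)) X) (WithLp.toLp 2 s) = ∑ i, inner ℝ (X i) (s i) :=
    fun X => PiLp.inner_apply _ _
  refine Eq.trans (integral_congr_ae (ae_of_all _ fun X => ?_)) (h.trans ?_)
  · exact congrArg (fun u : ℝ => Complex.exp ((u : ℂ) * Complex.I)) (e X).symm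
  congr 1
  push_cast
  rw [neg_div, Finset.sum_div, ← Finset.sum_neg_distrib]
  refine Finset.sum_congr rfl fun i _ => ?_
  change -(‖s i‖ : ℂ) ^ 2 / 2 = _
  ring

lemma VP_sG_law {N r : ℕ} {c : ℝ} (hc : 2 * c + r * c ^ 2 = 1) :
    (Measure.pi fun _ : Fin (r + 1) => sG N).map (fun X (i : Fin r) => X i.succ - X 0) =
    (Measure.pi fun _ : Fin r => sG N).map (fun Y (i : Fin r) => Y i + c • ∑ j, Y j) := by
  have := sG_prob N
  have hm1 : Measurable (fun (X : Fin (r + 1) → E N) (i : Fin r) => X i.succ - X 0) := by fun_prop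
  have hm2 : Measurable (fun (Y : Fin r → E N) (i : Fin r) => Y i + c • ∑ j, Y j) := by fun_prop
  let e := MeasurableEquiv.toLp 2 (Fin r → E N)
  have i1 : IsProbabilityMeasure ((Measure.pi fun _ : Fin (r + 1) => sG N).map (fun X (i : Fin r) => X i.succ - X 0)) := Measure.isProbabilityMeasure_map hm1.aemeasurable
  have i2 : IsProbabilityMeasure ((Measure.pi fun _ : Fin r => sG N).map (fun Y (i : Fin r) => Y i + c • ∑ j, Y j)) := Measure.isProbabilityMeasure_map hm2.aemeasurable
  have i3 := Measure.isProbabilityMeasure_map (μ := ((Measure.pi fun _ : Fin (r + 1) => sG N).map (fun X (i : Fin r) => X i.succ - X 0))) e.measurable.aemeasurable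
  have i4 := Measure.isProbabilityMeasure_map (μ := ((Measure.pi fun _ : Fin r => sG N).map (fun Y (i : Fin r) => Y i + c • ∑ j, Y j))) e.measurable.aemeasurable
  have key : ((Measure.pi fun _ : Fin (r + 1) => sG N).map (fun X (i : Fin r) => X i.succ - X 0)).map e =
     ((Measure.pi fun _ : Fin r => sG N).map (fun Y (i : Fin r) => Y i + c • ∑ j, Y j)).map e := by
    refine Measure.ext_of_charFun (funext fun t => ?_)
    rw [charFun_apply, charFun_apply, integral_map_equiv, integral_map_equiv,
      integral_map hm1.aemeasurable (by fun_prop), integral_map hm2.aemeasurable (by fun_prop)]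
    have h1 : ∀ X : Fin (r + 1) → E N, inner ℝ (e (fun i : Fin r => X i.succ - X 0)) t =
        ∑ i, inner ℝ (X i) ((Fin.cons (-∑ j, t j) (fun i => t i) : Fin (r + 1) → E N) i) := by
      intro X
      rw [PiLp.inner_apply, Fin.sum_univ_succ]
      simp only [Fin.cons_zero, Fin.cons_succ, e, MeasurableEquiv.coe_toLp, inner_sub_left, Finset.sum_sub_distrib, inner_neg_right, inner_sum]
      ring
    have h2 : ∀ Y : Fin r → E N, inner ℝ (e (fun i : Fin r => Y i + c • ∑ j, Y j)) t =
        ∑ i, inner ℝ (Y i) (t i + c • ∑ j, t j) := by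
      intro Y
      rw [PiLp.inner_apply]
      simp only [e, MeasurableEquiv.coe_toLp, inner_add_left, inner_add_right, Finset.sum_add_distrib, real_inner_smul_left, real_inner_smul_right,
        sum_inner, inner_sum, ← Finset.mul_sum]
      congr 2
      exact Finset.sum_comm
    simp_rw [h1, h2]
    rw [gpi, gpi]
    congr 3
    rw [Fin.sum_univ_succ]
    simp only [Fin.cons_zero, Fin.cons_succ, norm_neg]
    set T := ∑ j, t j with hT
    have : ∀ i, ‖t i + c • T‖ ^ 2 = ‖t i‖ ^ 2 + 2 * c * inner ℝ (t i) T + c ^ 2 * ‖T‖ ^ 2 := by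
      intro i
      rw [norm_add_sq_real, norm_smul, real_inner_smul_right, mul_pow, Real.norm_eq_abs, sq_abs]
      ring
    simp_rw [this]
    rw [Finset.sum_add_distrib, Finset.sum_add_distrib, ← Finset.mul_sum, ← sum_inner, ← hT, real_inner_self_eq_norm_sq]
    simp
    linear_combination (‖T‖ ^ 2) * hc
  have := congrArg (Measure.map e.symm) key
  rwa [MeasurableEquiv.map_symm_map, MeasurableEquiv.map_symm_map] at this

lemma VP_sG (N : ℕ) {r : ℕ} (hr : 1 ≤ r) : ∃ d : ℝ, 0 < d ∧ VP (sG N) r = (DL (sG N) r).map (fun x => d * x) := by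
  have hr' : (0:ℝ) < r := by exact_mod_cast hr
  set c : ℝ := (√(1 + r) - 1) / r with hc
  have h1 : 0 ≤ c := by
    have : 1 ≤ √(1 + r) := by rw [Real.one_le_sqrt]; linarith
    apply div_nonneg (by linarith) hr'.le
  have h2 : 2 * c + r * c ^ 2 = 1 := by
    have := Real.sq_sqrt (show (0:ℝ) ≤ 1 + r by positivity)
    rw [hc]; field_simp; linear_combination this
  let M : Matrix (Fin r) (Fin r) ℝ := 1 + Matrix.replicateCol Unit (fun _ : Fin r => c) * Matrix.replicateRow Unit (fun _ : Fin r => (1:ℝ))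
  have hM : M.det = 1 + r * c := by
    simp only [M]
    rw [Matrix.det_one_add_replicateCol_mul_replicateRow]
    simp [dotProduct]
  have hMij : ∀ i j, M i j = (if i = j then 1 else 0) + c := by
    intro i j
    simp [M, Matrix.mul_apply, Matrix.one_apply]
  refine ⟨|M.det|, by rw [hM]; positivity, ?_⟩
  have hm1 : Measurable (fun (X : Fin (r + 1) → E N) (i : Fin r) => X i.succ - X 0) := by fun_prop
  have hm2 : Measurable (fun (Y : Fin r → E N) (i : Fin r) => Y i + c • ∑ j, Y j) := by fun_prop
  have hD : Measurable (Dn (N := N) (k := r)) := Dn_continuous.measurable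
  have e := congrArg (Measure.map Dn) (VP_sG_law (N := N) h2)
  rw [Measure.map_map hD hm1, Measure.map_map hD hm2] at e
  rw [DL, Measure.map_map (by fun_prop) hD]
  refine Eq.trans e ?_
  congr 1
  ext1 Y
  simp only [Function.comp]
  rw [← Dn_lin]
  congr 1
  ext1 i
  simp [hMij, add_smul, Finset.sum_add_distrib, Finset.smul_sum]

end RS

open scoped ENNReal
namespace RS

lemma hlg_near {a : ℝ} (ha : 0 < a) : Near (hlg a) (1 / (4 * a) * var (hlg a)) ∧ var (hlg a) = psi1 a / 4 := by
  have h1 := (lg_near ha).scale (1 / 2)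
  have h2 := (scale_stats (1 / 2) (lg_L2 ha)).2.2.1
  have h3 : var (hlg a) = psi1 a / 4 := by
    rw [hlg, h2, psi1]; ring
  refine ⟨?_, h3⟩
  rw [h3]
  unfold hlg
  convert h1 using 1
  rw [abs_of_pos (by norm_num)]
  field_simp
  norm_num
  ring

lemma gnum {ε : ℝ} (hε : 0 < ε) : ∃ n0 : ℕ, ∀ n r : ℕ, n0 ≤ n → 1 ≤ r → r ≤ n →
    1 ≤ (2 * ((n : ℝ) - r + 1) * ε) ^ 2 * ∑ j ∈ range r, psi1 (((n : ℝ) - j) / 2) / 4 := by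
  set C : ℝ := Real.exp (1 / (2 * ε ^ 2)) with hC
  have hC0 : 0 < C := Real.exp_pos _
  obtain ⟨n0, hn0⟩ := exists_nat_ge (C ^ 2 / (2 * ε ^ 2))
  refine ⟨n0, fun n r hn h1 h2 => ?_⟩
  have hn' : C ^ 2 / (2 * ε ^ 2) ≤ n := hn0.trans (by exact_mod_cast hn)
  have hnpos : (0:ℝ) < n := by exact_mod_cast (show 0 < n by omega)
  have hrn : (r:ℝ) ≤ n := by exact_mod_cast h2
  set m : ℝ := (n : ℝ) - r + 1 with hm
  have hm1 : 1 ≤ m := by rw [hm]; linarith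
  set s : ℝ := ∑ j ∈ range r, psi1 (((n : ℝ) - j) / 2) / 4 with hs
  have hterm : ∀ j ∈ range r, 1 / ((n : ℝ) - j) / 2 ≤ psi1 (((n : ℝ) - j) / 2) / 4 := by
    intro j hj
    have : (j : ℝ) + 1 ≤ r := by exact_mod_cast (mem_range.1 hj)
    have h0 : 0 < (n : ℝ) - j := by linarith
    have := psi1_lower (half_pos h0)
    rw [one_div_div] at this
    have h3 : 1 / ((n : ℝ) - j) / 2 = 2 / ((n:ℝ) - j) / 4 := by ring
    rw [h3]
    linarith
  have hsum : (∑ j ∈ range r, 1 / ((n : ℝ) - j)) / 2 ≤ s := by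
    rw [Finset.sum_div]; exact sum_le_sum hterm
  have ha : 1 / (2 * (n : ℝ)) ≤ s := by
    have h := single_le_sum (f := fun j : ℕ => psi1 (((n : ℝ) - j) / 2) / 4) (s := range r) (fun j hj => le_trans (by
      have : (j : ℝ) + 1 ≤ r := by exact_mod_cast (mem_range.1 hj)
      have h0 : 0 < (n : ℝ) - j := by linarith
      positivity) (hterm j hj)) (mem_range.2 h1)
    have h' := hterm 0 (mem_range.2 h1)
    simp only [Nat.cast_zero, sub_zero] at h h'
    have : 1 / (2 * (n : ℝ)) = 1 / (n : ℝ) / 2 := by field_simp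
    rw [this]
    exact h'.trans h
  have hb : Real.log ((n + 1) / m) / 2 ≤ s := by
    have := harm n r h2
    rw [show (n : ℝ) + 1 - r = m by rw [hm]; ring] at this
    linarith
  by_cases hcase : (n : ℝ) ≤ m ^ 2 * (2 * ε ^ 2)
  · calc 1 ≤ (2 * m * ε) ^ 2 * (1 / (2 * n)) := by
          rw [mul_one_div, le_div_iff₀ (by positivity)]; linarith
      _ ≤ _ := by gcongr
  · push Not at hcase
    have h3 : m * C ≤ n + 1 := by
      have : (m * C) ^ 2 ≤ (n : ℝ) ^ 2 := by
        rw [div_le_iff₀ (by positivity)] at hn'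
        have h4 : 0 < 2 * ε ^ 2 := by positivity
        have : (m * C) ^ 2 * (2 * ε ^ 2) ≤ n ^ 2 * (2 * ε ^ 2) := by
          calc (m * C) ^ 2 * (2 * ε ^ 2) = (m ^ 2 * (2 * ε ^ 2)) * C ^ 2 := by ring
            _ ≤ n * (n * (2 * ε ^ 2)) := by gcongr
            _ = _ := by ring
        exact le_of_mul_le_mul_right this h4
      have := abs_le_of_sq_le_sq this hnpos.le
      linarith [le_abs_self (m * C)]
    have h4 : 1 / (2 * ε ^ 2) ≤ Real.log ((n + 1) / m) := by
      rw [Real.le_log_iff_exp_le (by positivity), le_div_iff₀ (by positivity)]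
      linarith
    have h5 : 1 / (2 * ε ^ 2) / 2 ≤ s := by linarith
    have h6 : 1 = (2 * 1 * ε) ^ 2 * (1 / (2 * ε ^ 2) / 2) := by field_simp
    rw [h6]
    gcongr

lemma gauss_good {ε : ℝ} (hε : 0 < ε) : ∃ n0 : ℕ, ∀ n r : ℕ, n0 ≤ n → 1 ≤ r → r ≤ n →
    Pos (VP (sG n) r) ∧ Good ((VP (sG n) r).map Real.log) ε := by
  obtain ⟨n0, h0⟩ := gnum hε
  refine ⟨n0, fun n r hn h1 h2 => ?_⟩
  obtain ⟨d, hd, hV⟩ := VP_sG n h1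
  have hnum := h0 n r hn h1 h2
  obtain ⟨N, rfl⟩ : ∃ N, n = N + r := ⟨n - r, by omega⟩
  obtain ⟨hp, hc⟩ := DL_sG r N
  have := sG_prob (N + r)
  have := DL_prob (sG (N + r)) r
  have hap := hp.ae
  have hlog : (VP (sG (N + r)) r).map Real.log = ((DL (sG (N + r)) r).map Real.log).map (fun x => x + Real.log d) := by
    rw [hV, Measure.map_map (by fun_prop) (by fun_prop), Measure.map_map (by fun_prop) (by fun_prop)]
    refine Measure.map_congr ?_
    filter_upwards [hap] with x hx
    simp only [Function.comp]
    rw [Real.log_mul hd.ne' hx.ne', add_comm]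
  constructor
  · rw [hV]
    apply Pos.of_ae
    rw [ae_map_iff (by fun_prop) measurableSet_Ioi]
    filter_upwards [hap] with x hx
    positivity
  rw [hlog]
  apply Good.shift
  have hA0 : ∀ j < r, 0 < ((N : ℝ) + r - j) / 2 := fun j hj => by
    have : (j : ℝ) + 1 ≤ r := by exact_mod_cast hj
    have : (0 : ℝ) ≤ N := by positivity
    linarith
  have hpr : ∀ j < r, IsProbabilityMeasure (hlg (((N : ℝ) + r - j) / 2)) := fun j hj => hlg_prob (hA0 j hj)
  set f : ℕ → Measure ℝ := fun j => hlg (((N : ℝ) + r - j) / 2) with hf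
  have hSp := convN_prob f r hpr
  have hSc := charFun_convN f r hpr
  set S := convN f r with hS
  have hm0 : (0:ℝ) < N + 1 := by positivity
  have hn := convN_near f (fun j => 1 / (2 * ((N:ℝ) + 1)) * var (f j)) r hpr (fun j hj => (hlg_near (hA0 j hj)).1.mono (by
      have := hA0 j hj
      have : (j : ℝ) + 1 ≤ r := by exact_mod_cast hj
      refine mul_le_mul_of_nonneg_right ?_ (var_nonneg _)
      apply one_div_le_one_div_of_le (by positivity)
      linarith))
  rw [← hS] at hn
  have hSv : var S = ∑ j ∈ range r, psi1 (((N : ℝ) + r - j) / 2) / 4 := by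
    rw [hn.2]
    exact sum_congr rfl fun j hj => (hlg_near (hA0 j (mem_range.1 hj))).2
  have hSn : Near S (var S / (2 * ((N:ℝ) + 1))) := by
    have := hn.1
    rw [← mul_sum, ← hn.2] at this
    convert this using 1
    ring
  have hL : (DL (sG (N + r)) r).map Real.log = S.map (fun x => x + r * (Real.log 2 / 2)) := by
    have : IsProbabilityMeasure ((DL (sG (N + r)) r).map Real.log) := Measure.isProbabilityMeasure_map (by fun_prop)
    have : IsProbabilityMeasure (S.map (fun x => x + r * (Real.log 2 / 2))) := Measure.isProbabilityMeasure_map (by fun_prop)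
    refine Measure.ext_of_charFun (funext fun t => ?_)
    rw [hc, charFun_map_add_const, hSc]
    congr 3
    simp; ring
  rw [hL]
  apply Good.shift
  have hd0 := dirac_near
  refine good_of (α := Measure.dirac 0) (B := Measure.dirac 0) hd0.1.1 hd0.1.1 (fun t => rfl) hSn hm0 hε ?_ ?_ ?_
  · rw [hSv]
    push_cast at hnum
    rwa [show (N:ℝ) + r - r + 1 = N + 1 by ring] at hnum
  · rw [hd0.2]; exact mul_nonneg hε.le (var_nonneg _)
  · rw [hd0.2]; exact mul_nonneg hε.le (var_nonneg _)

end RS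

open scoped ENNReal
namespace RS

lemma normalize_lip {V : Type*} [NormedAddCommGroup V] [NormedSpace ℝ V] {a b : V} {c : ℝ} (hc : 0 < c) (ha : c ≤ ‖a‖) (hb : c ≤ ‖b‖) :
    ‖‖a‖⁻¹ • a - ‖b‖⁻¹ • b‖ ≤ 2 / c * ‖a - b‖ := by
  have ha0 : 0 < ‖a‖ := hc.trans_le ha
  have hb0 : 0 < ‖b‖ := hc.trans_le hb
  have e : ‖a‖⁻¹ • a - ‖b‖⁻¹ • b = ‖a‖⁻¹ • (a - b) + (‖a‖⁻¹ * (‖b‖ - ‖a‖) * ‖b‖⁻¹) • b := by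
    have : ‖a‖⁻¹ * (‖b‖ - ‖a‖) * ‖b‖⁻¹ = ‖a‖⁻¹ - ‖b‖⁻¹ := by field_simp
    rw [this, smul_sub, sub_smul]; abel
  rw [e]
  refine (norm_add_le _ _).trans ?_
  rw [norm_smul, norm_smul, norm_mul, norm_mul, norm_inv, norm_inv, norm_norm, norm_norm, mul_assoc, inv_mul_cancel₀ hb0.ne', mul_one]
  have h1 : ‖‖b‖ - ‖a‖‖ ≤ ‖a - b‖ := by
    rw [Real.norm_eq_abs, norm_sub_rev]; exact abs_norm_sub_norm_le b a
  have h2 : ‖a‖⁻¹ ≤ 1 / c := by rw [← one_div]; exact one_div_le_one_div_of_le hc ha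
  have h3 : ‖a‖⁻¹ * ‖a - b‖ ≤ 1 / c * ‖a - b‖ := by gcongr
  have h4 : ‖a‖⁻¹ * ‖‖b‖ - ‖a‖‖ ≤ 1 / c * ‖a - b‖ := by gcongr
  have : 2 / c * ‖a - b‖ = 1 / c * ‖a - b‖ + 1 / c * ‖a - b‖ := by ring
  linarith

lemma haus_haar (N : ℕ) : (μH[((N + 1 : ℕ) : ℝ) - 1] : Measure (E N)).IsAddHaarMeasure := by
  have h := isAddHaarMeasure_hausdorffMeasure (E := E N)
  have e : ((N + 1 : ℕ) : ℝ) - 1 = (Module.finrank ℝ (E N) : ℝ) := by simp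
  rw [e]; exact h

lemma et_lip (N : ℕ) : LipschitzWith 1 (et (N := N)) := by
  refine LipschitzWith.of_dist_le_mul fun x y => ?_
  rw [dist_eq_norm, dist_eq_norm, ← et_sub, NNReal.coe_one, one_mul]
  have := norm_sq_ec ((x - y) 0) (et (x - y))
  rw [ec_et] at this
  exact abs_le_of_sq_le_sq' (by nlinarith [sq_nonneg ((x - y) 0)]) (norm_nonneg _) |>.2

lemma sphere_pos (N : ℕ) : (μH[((N + 1 : ℕ) : ℝ) - 1] : Measure (E (N + 1))) (Metric.sphere 0 1) ≠ 0 := by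
  have := haus_haar N
  have hd : 0 ≤ ((N + 1 : ℕ) : ℝ) - 1 := by push_cast; linarith [Nat.cast_nonneg (α := ℝ) N]
  have h1 := (et_lip N).hausdorffMeasure_image_le hd (Metric.sphere 0 1)
  have h2 : Metric.ball (0 : E N) 1 ⊆ et '' Metric.sphere (0 : E (N + 1)) 1 := by
    intro y hy
    have hy1 : ‖y‖ < 1 := by simpa using hy
    have hy2 : ‖y‖ ^ 2 < 1 := by nlinarith [norm_nonneg y]
    refine ⟨ec (√(1 - ‖y‖ ^ 2)) y, ?_, et_ec _ _⟩
    have := norm_sq_ec (√(1 - ‖y‖ ^ 2)) y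
    rw [Real.sq_sqrt (by linarith)] at this
    have h : ‖ec (√(1 - ‖y‖ ^ 2)) y‖ ^ 2 = 1 := by linarith
    simpa using (sq_eq_sq₀ (norm_nonneg _) zero_le_one).1 (h.trans (one_pow 2).symm)
  have h3 : 0 < (μH[((N + 1 : ℕ) : ℝ) - 1] : Measure (E N)) (Metric.ball 0 1) := Metric.measure_ball_pos _ _ one_pos
  intro h0
  rw [h0] at h1
  have := (measure_mono h2).trans h1
  simp at this
  simp at h3
  exact h3.ne' this

/-- a Lipschitz parametrisation of a half sphere -/
noncomputable def hs {N : ℕ} (s : ℝ) (y : E N) : E (N + 1) := ec (s * (1 - ‖y‖)) y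

lemma hs_lip {N : ℕ} {s : ℝ} (hs1 : s ^ 2 = 1) (x y : E N) : ‖hs s x - hs s y‖ ≤ 2 * ‖x - y‖ := by
  unfold hs
  rw [ec_sub]
  have h := norm_sq_ec (s * (1 - ‖x‖) - s * (1 - ‖y‖)) (x - y)
  have h1 : (s * (1 - ‖x‖) - s * (1 - ‖y‖)) ^ 2 = (‖x‖ - ‖y‖) ^ 2 := by
    calc _ = s ^ 2 * (‖x‖ - ‖y‖) ^ 2 := by ring
      _ = _ := by rw [hs1, one_mul]
  have h2 : (‖x‖ - ‖y‖) ^ 2 ≤ ‖x - y‖ ^ 2 := by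
    rw [sq_le_sq, abs_norm]; exact abs_norm_sub_norm_le x y
  refine (abs_le_of_sq_le_sq' (b := 2 * ‖x - y‖) ?_ (by positivity)).2
  nlinarith [sq_nonneg ‖x - y‖]

lemma hs_norm {N : ℕ} {s : ℝ} (hs1 : s ^ 2 = 1) (y : E N) : 1 / 2 ≤ ‖hs s y‖ := by
  have h := norm_sq_ec (s * (1 - ‖y‖)) y
  rw [mul_pow, hs1, one_mul] at h
  unfold hs
  refine (abs_le_of_sq_le_sq' (a := 1 / 2) ?_ (by positivity)).2
  nlinarith [sq_nonneg (2 * ‖y‖ - 1)]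

lemma sphere_sub (N : ℕ) : Metric.sphere (0 : E (N + 1)) 1 ⊆
    ((fun y : E N => ‖hs 1 y‖⁻¹ • hs 1 y) '' Metric.closedBall 0 1) ∪ ((fun y : E N => ‖hs (-1) y‖⁻¹ • hs (-1) y) '' Metric.closedBall 0 1) := by
  intro u hu
  have hu1 : ‖u‖ = 1 := by simpa using hu
  have key : ∀ s : ℝ, s ^ 2 = 1 → 0 ≤ s * u 0 → ∃ y : E N, y ∈ Metric.closedBall (0 : E N) 1 ∧ ‖hs s y‖⁻¹ • hs s y = u := by
    intro s hs1 h0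
    have hn := norm_sq_ec (u 0) (et u)
    rw [ec_et, hu1] at hn
    have hl : 0 < s * u 0 + ‖et u‖ := by
      by_contra hneg
      push Not at hneg
      have h1 : ‖et u‖ = 0 := le_antisymm (by linarith) (norm_nonneg _)
      have h2 : s * u 0 = 0 := by rw [h1] at hneg; linarith
      have h3 : (s * u 0) ^ 2 = u 0 ^ 2 := by rw [mul_pow, hs1, one_mul]
      rw [h1, ← h3, h2] at hn
      norm_num at hn
    set l := (s * u 0 + ‖et u‖)⁻¹ with hldef
    have hl0 : 0 < l := inv_pos.2 hl
    have hy : ‖l • et u‖ = l * ‖et u‖ := by rw [norm_smul, Real.norm_eq_abs, abs_of_pos hl0]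
    have hll : l * (s * u 0 + ‖et u‖) = 1 := inv_mul_cancel₀ hl.ne'
    have hh : hs s (l • et u) = l • u := by
      unfold hs
      rw [hy]
      have : s * (1 - l * ‖et u‖) = l * u 0 := by
        linear_combination (-s) * hll + l * u 0 * hs1
      rw [this]
      ext i
      refine Fin.cases ?_ (fun i => ?_) i <;> simp
    refine ⟨l • et u, ?_, ?_⟩
    · rw [mem_closedBall_zero_iff, hy]
      nlinarith
    · rw [hh, norm_smul, hu1, Real.norm_eq_abs, abs_of_pos hl0, mul_one, smul_smul, inv_mul_cancel₀ hl0.ne', one_smul]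
  rcases le_total 0 (u 0) with h | h
  · left; exact key 1 (by norm_num) (by linarith)
  · right; exact key (-1) (by norm_num) (by linarith)

lemma sphere_fin (N : ℕ) : (μH[((N + 1 : ℕ) : ℝ) - 1] : Measure (E (N + 1))) (Metric.sphere 0 1) ≠ ∞ := by
  have := haus_haar N
  have hd : 0 ≤ ((N + 1 : ℕ) : ℝ) - 1 := by push_cast; linarith [Nat.cast_nonneg (α := ℝ) N]
  have hfin : (μH[((N + 1 : ℕ) : ℝ) - 1] : Measure (E N)) (Metric.closedBall 0 1) < ∞ := measure_closedBall_lt_top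
  have key : ∀ s : ℝ, s ^ 2 = 1 → (μH[((N + 1 : ℕ) : ℝ) - 1] : Measure (E (N + 1))) ((fun y : E N => ‖hs s y‖⁻¹ • hs s y) '' Metric.closedBall 0 1) < ∞ := by
    intro s hs1
    have hL : LipschitzWith 8 (fun y : E N => ‖hs s y‖⁻¹ • hs s y) := by
      refine LipschitzWith.of_dist_le_mul fun x y => ?_
      rw [dist_eq_norm, dist_eq_norm]
      refine (normalize_lip one_half_pos (hs_norm hs1 x) (hs_norm hs1 y)).trans ?_
      have := hs_lip hs1 x y
      norm_num
      linarith
    refine (hL.hausdorffMeasure_image_le hd _).trans_lt ?_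
    exact ENNReal.mul_lt_top (ENNReal.rpow_lt_top_of_nonneg hd (by simp)) hfin
  refine ((measure_mono (sphere_sub N)).trans (measure_union_le _ _)).trans_lt (ENNReal.add_lt_top.2 ⟨key 1 (by norm_num), key (-1) (by norm_num)⟩) |>.ne

lemma su_prob (N : ℕ) : IsProbabilityMeasure (sphereUniform (N + 1)) := by
  constructor
  rw [sphereUniform, Measure.smul_apply, Measure.restrict_apply_univ, smul_eq_mul]
  exact ENNReal.inv_mul_cancel (sphere_pos N) (sphere_fin N)

lemma su_norm (N : ℕ) : ∀ᵐ x ∂(sphereUniform (N + 1)), ‖x‖ = 1 := by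
  unfold sphereUniform
  apply Measure.ae_smul_measure
  filter_upwards [ae_restrict_mem Metric.isClosed_sphere.measurableSet] with x hx
  simpa using hx

lemma su_rot (N : ℕ) : RotInv (sphereUniform N) := by
  intro U
  have hU : MeasurableEmbedding U := U.toHomeomorph.measurableEmbedding
  unfold sphereUniform
  rw [Measure.map_smul]
  congr 1
  have h1 : (μH[(N : ℝ) - 1] : Measure (E N)).map U = μH[(N : ℝ) - 1] := U.toIsometryEquiv.map_hausdorffMeasure _
  have h2 : (U : E N → E N) ⁻¹' (Metric.sphere 0 1) = Metric.sphere 0 1 := by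
    ext x; simp
  conv_lhs => rw [← h2]
  rw [← hU.restrict_map, h1]

end RS

open scoped ENNReal
namespace RS

lemma rotInv_charFun {N : ℕ} {σ : Measure (E N)} (hr : RotInv σ) {s t : E N} (h : ‖s‖ = ‖t‖) :
    charFun σ s = charFun σ t := by
  obtain ⟨U, hU⟩ := exists_rot t s h.symm
  have hUm : Measurable (fun x : E N => U x) := U.continuous.measurable
  rw [charFun_apply, charFun_apply, ← hU]
  have h1 : ∫ x, Complex.exp (((inner ℝ x (U t) : ℝ) : ℂ) * Complex.I) ∂σ =
      ∫ x, Complex.exp (((inner ℝ x (U t) : ℝ) : ℂ) * Complex.I) ∂(σ.map U) := by rw [hr U]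
  rw [h1, integral_map hUm.aemeasurable (by fun_prop)]
  refine integral_congr_ae (ae_of_all _ fun x => ?_)
  simp only [LinearIsometryEquiv.inner_map_map]

lemma polar {N : ℕ} {σ μ : Measure (E N)} [IsProbabilityMeasure σ] [IsProbabilityMeasure μ] (hσ : RotInv σ) (hμ : RotInv μ)
    (hn : ∀ᵐ u ∂σ, ‖u‖ = 1) : (μ.prod σ).map (fun q : E N × E N => ‖q.1‖ • q.2) = μ := by
  have hm : Measurable (fun q : E N × E N => ‖q.1‖ • q.2) := by fun_prop
  have := Measure.isProbabilityMeasure_map (μ := μ.prod σ) hm.aemeasurable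
  refine Measure.ext_of_charFun (funext fun t => ?_)
  rw [charFun_apply, integral_map hm.aemeasurable (by fun_prop)]
  have hi : Integrable (fun q : E N × E N => Complex.exp (((inner ℝ (‖q.1‖ • q.2) t : ℝ) : ℂ) * Complex.I)) (μ.prod σ) := by
    refine Integrable.of_bound (C := 1) (by fun_prop) (ae_of_all _ fun q => ?_)
    rw [Complex.norm_exp_ofReal_mul_I]
  have hi2 : Integrable (fun q : E N × E N => Complex.exp (((inner ℝ q.2 (‖t‖ • q.1) : ℝ) : ℂ) * Complex.I)) (μ.prod σ) := by
    refine Integrable.of_bound (C := 1) (by fun_prop) (ae_of_all _ fun q => ?_)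
    rw [Complex.norm_exp_ofReal_mul_I]
  rw [integral_prod _ hi]
  have e1 : ∀ x : E N, ∫ u, Complex.exp (((inner ℝ (‖x‖ • u) t : ℝ) : ℂ) * Complex.I) ∂σ =
      ∫ u, Complex.exp (((inner ℝ u (‖t‖ • x) : ℝ) : ℂ) * Complex.I) ∂σ := by
    intro x
    have := rotInv_charFun hσ (s := ‖x‖ • t) (t := ‖t‖ • x) (by simp [norm_smul, mul_comm])
    rw [charFun_apply, charFun_apply] at this
    rw [← this]
    refine integral_congr_ae (ae_of_all _ fun u => ?_)
    simp only [inner_smul_left, inner_smul_right]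
    simp
  simp_rw [e1]
  rw [← integral_prod _ hi2, integral_prod_symm _ hi2]
  have e2 : ∀ᵐ u ∂σ, ∫ x, Complex.exp (((inner ℝ u (‖t‖ • x) : ℝ) : ℂ) * Complex.I) ∂μ = charFun μ t := by
    filter_upwards [hn] with u hu
    rw [← rotInv_charFun hμ (s := ‖t‖ • u) (t := t) (by simp [norm_smul, hu]), charFun_apply]
    refine integral_congr_ae (ae_of_all _ fun x => ?_)
    simp only [inner_smul_right, real_inner_comm]
  rw [integral_congr_ae e2]
  simp

lemma rot_unique {N : ℕ} {P R : Measure (E (N + 1))} [IsProbabilityMeasure P] [IsProbabilityMeasure R] (hP : RotInv P) (hR : RotInv R)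
    (h : P.map (fun x => ‖x‖) = R.map (fun x => ‖x‖)) : P = R := by
  have hrot := su_rot (N + 1)
  have hno := su_norm N
  have hpr := su_prob N
  generalize sphereUniform (N + 1) = σ at hpr hrot hno
  have key : ∀ P : Measure (E (N + 1)), IsProbabilityMeasure P → RotInv P →
      P = ((P.map (fun x => ‖x‖)).prod σ).map (fun q : ℝ × E (N + 1) => q.1 • q.2) := by
    intro P _ hP
    conv_lhs => rw [← polar hrot hP hno]
    have e := Measure.map_prod_map P σ (f := fun x => ‖x‖) (g := id) (by fun_prop) measurable_id
    rw [Measure.map_id] at e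
    rw [e, Measure.map_map (by fun_prop) (by fun_prop)]
    rfl
  rw [key P inferInstance hP, key R inferInstance hR, h]

lemma eq_of_log {P R : Measure ℝ} (hP : Pos P) (hR : Pos R) (h : P.map Real.log = R.map Real.log) : P = R := by
  have key : ∀ P : Measure ℝ, Pos P → (P.map Real.log).map Real.exp = P := by
    intro P hP
    rw [Measure.map_map Real.measurable_exp Real.measurable_log]
    conv_rhs => rw [← Measure.map_id (μ := P)]
    refine Measure.map_congr ?_
    filter_upwards [hP.ae] with x hx
    simp [Real.exp_log hx]
  rw [← key P hP, ← key R hR, h]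

/-- extend a rotation -/
noncomputable def liftRot {N : ℕ} (U : E N ≃ₗᵢ[ℝ] E N) : E (N + 1) ≃ₗᵢ[ℝ] E (N + 1) where
  toFun x := ec (x 0) (U (et x))
  invFun x := ec (x 0) (U.symm (et x))
  left_inv x := by simp [ec_et]
  right_inv x := by simp [ec_et]
  map_add' x y := by
    have : et (x + y) = et x + et y := by ext i; simp
    rw [this, map_add, ec_add]; rfl
  map_smul' c x := by
    have : et (c • x) = c • et x := by ext i; simp
    rw [this, map_smul]
    ext i
    refine Fin.cases ?_ (fun i => ?_) i <;> simp
  norm_map' x := by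
    have h1 := norm_sq_ec (x 0) (U (et x))
    have h2 := norm_sq_ec (x 0) (et x)
    rw [ec_et] at h2
    rw [U.norm_map, ← h2] at h1
    exact (sq_eq_sq₀ (norm_nonneg _) (norm_nonneg _)).1 h1

lemma rot_et {N : ℕ} {μ : Measure (E (N + 1))} (h : RotInv μ) : RotInv (μ.map et) := by
  intro U
  rw [Measure.map_map U.continuous.measurable measurable_et]
  conv_rhs => rw [← h (liftRot U), Measure.map_map measurable_et (liftRot U).continuous.measurable]
  rfl

lemma su_et (N : ℕ) : (sphereUniform (N + 2)).map et = betaModel (N + 1) 1 := by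
  have := su_prob (N + 1)
  have := sG_prob (N + 2)
  have := sG_prob (N + 1)
  have := beta_prob (N + 1) one_pos
  set σ := sphereUniform (N + 2) with hσ
  have := Measure.isProbabilityMeasure_map (μ := σ) (f := et) measurable_et.aemeasurable
  have := Measure.isProbabilityMeasure_map (μ := σ.map et) (f := fun x : E (N + 1) => ‖x‖) (by fun_prop)
  have := Measure.isProbabilityMeasure_map (μ := sG (N + 2)) (f := fun x : E (N + 2) => ‖x‖) (by fun_prop)
  have hpol := polar (su_rot (N + 2)) (sG_rot (N + 2)) (su_norm (N + 1))
  have hA : (0 : ℝ) < ((N : ℝ) + 1) / 2 := by positivity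
  have hA2 : (0 : ℝ) < (((N + 1 : ℕ) : ℝ) + 1) / 2 := by positivity
  have hmc : (sG (N + 1)).map (fun x => ‖x‖) = ((sG (N + 2)).map (fun x => ‖x‖)).mconv ((σ.map et).map (fun x => ‖x‖)) := by
    conv_lhs => rw [← sG_proj (N + 1), ← hpol, Measure.map_map measurable_et (by fun_prop), Measure.map_map (by fun_prop) (measurable_et.comp (by fun_prop))]
    rw [Measure.map_map (by fun_prop) measurable_et, Measure.mconv, Measure.map_prod_map _ _ (by fun_prop) ((measurable_norm).comp measurable_et),
      Measure.map_map (by fun_prop) (by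
        exact Measurable.prodMap (by fun_prop) (measurable_norm.comp measurable_et))]
    congr 1
    funext q
    have : et (‖q.1‖ • q.2) = ‖q.1‖ • et q.2 := by ext i; simp
    simp [this, norm_smul]
  have hp2 : Pos ((sG (N + 2)).map (fun x => ‖x‖)) := Pos.of_ae ((ae_map_iff (by fun_prop) measurableSet_Ioi).2 (pos_norm_sG (N + 1)))
  have hp1 : Pos ((sG (N + 1)).map (fun x => ‖x‖)) := Pos.of_ae ((ae_map_iff (by fun_prop) measurableSet_Ioi).2 (pos_norm_sG N))
  have hps : Pos ((σ.map et).map (fun x => ‖x‖)) := by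
    have h1 := hp1.ae
    rw [hmc, Measure.mconv, ae_map_iff (by fun_prop) measurableSet_Ioi] at h1
    refine Pos.of_ae ?_
    have h2 := Measure.ae_ae_of_ae_prod h1
    obtain ⟨x, hx, hx2⟩ := (h2.and hp2.ae).exists
    filter_upwards [hx] with y hy
    exact pos_of_mul_pos_right hy hx2.le
  refine rot_unique (rot_et (su_rot _)) (beta_rot _ one_pos) (eq_of_log hps (pos_norm_beta N one_pos) ?_)
  have hl := log_mconv hp2 hps
  rw [← hmc, log_norm_sG, log_norm_sG] at hl
  rw [log_norm_beta N one_pos]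
  have := hlb_prob hA one_half_pos
  have := hlg_prob hA2
  have := Measure.isProbabilityMeasure_map (μ := (hlg ((((N + 1 : ℕ) : ℝ) + 1) / 2))) (f := fun x : ℝ => x + Real.log 2 / 2) (by fun_prop)
  have := Measure.isProbabilityMeasure_map (μ := ((σ.map et).map (fun x => ‖x‖))) (f := Real.log) (Real.measurable_log.aemeasurable)
  refine Measure.ext_of_charFun (funext fun t => ?_)
  have h3 := congrArg (fun m => charFun m t) hl
  rw [charFun_conv, charFun_map_add_const, charFun_map_add_const] at h3
  have hb := charFun_lb hA (one_half_pos (α := ℝ)) (1 / 2 * t)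
  have hne := charFun_lg_ne hA2 (1 / 2 * t)
  unfold hlg at h3
  unfold hlb
  rw [charFun_map_mul, charFun_map_mul] at h3
  rw [charFun_map_mul]
  have hab : ((N : ℝ) + 1) / 2 + 1 / 2 = (((N + 1 : ℕ) : ℝ) + 1) / 2 := by push_cast; ring
  rw [hab] at hb
  rw [← hb] at h3
  have hx : Complex.exp (((inner ℝ (Real.log 2 / 2) t : ℝ) : ℂ) * Complex.I) ≠ 0 := Complex.exp_ne_zero _
  refine mul_right_cancel₀ (mul_ne_zero hne hx) ?_
  linear_combination -h3

end RS

open scoped ENNReal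
namespace RS

lemma kk_beta {a : ℝ} (ha : 0 < a) (v : ℝ) :
    kk a (v * (1 - v)) = ENNReal.ofReal (beta (a / 2) (a / 2)) * betaPDF (a / 2) (a / 2) v := by
  have hb : 0 < beta (a / 2) (a / 2) := beta_pos (by positivity) (by positivity)
  rcases le_or_gt v 0 with h0 | h0
  · rw [betaPDF_eq_zero_of_nonpos h0, kk_nonpos (by nlinarith), mul_zero]
  rcases le_or_gt 1 v with h1 | h1
  · rw [betaPDF_eq_zero_of_one_le h1, kk_nonpos (by nlinarith), mul_zero]
  rw [betaPDF_of_pos_lt_one h0 h1, kk, if_pos (mul_pos h0 (by linarith)), ← ENNReal.ofReal_mul hb.le]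
  congr 1
  rw [Real.mul_rpow h0.le (by linarith)]
  have : (a - 2) / 2 = a / 2 - 1 := by ring
  rw [this]
  field_simp

lemma coord1 {a : ℝ} (ha : 0 < a) : (betaModel 1 a).map (fun x => (1 + x 0) / 2) = betaMeasure (a / 2) (a / 2) := by
  have hm : Measurable (fun x : E 1 => (1 + x 0) / 2) := by fun_prop
  have := beta_prob 1 ha
  have := isProbabilityMeasureBeta (half_pos ha) (half_pos ha)
  have := Measure.isProbabilityMeasure_map (μ := betaModel 1 a) hm.aemeasurable
  have hk := kk_meas a
  have hm2 := measurable_ec (N := 0)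
  have hpm : Measurable (betaPDF (a / 2) (a / 2)) := (measurable_betaPDFReal _ _).ennreal_ofReal
  apply eq_of_smul (ENNReal.ofReal (cb 1 a) * (ENNReal.ofReal 2 * (kk a 4 * (volume (Set.univ : Set (E 0)) * ENNReal.ofReal (beta (a / 2) (a / 2))))))
  intro g hg
  rw [lintegral_map hg hm, beta_lint 1 ha (fun x => g ((1 + x 0) / 2)) (hg.comp hm), betaMeasure, lintegral_withDensity_eq_lintegral_mul _ hpm hg,
    lint_split (N := 0) (fun x => kk a (1 - ‖x‖ ^ 2) * g ((1 + x 0) / 2)) ((kkn_meas 1 a).mul (hg.comp hm)), mul_assoc]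
  congr 1
  have e1 : ∀ t : ℝ, ∫⁻ y : E 0, kk a (1 - ‖ec t y‖ ^ 2) * g ((1 + ec t y 0) / 2) = kk a (1 - t ^ 2) * g ((1 + t) / 2) * volume (Set.univ : Set (E 0)) := by
    intro t
    rw [← lintegral_const]
    refine lintegral_congr fun y => ?_
    rw [norm_sq_ec, Subsingleton.elim y 0]
    simp
  rw [lintegral_congr e1, lint_scale two_pos, mul_assoc]
  congr 1
  rw [← lintegral_sub_right_eq_self _ (1 / 2 : ℝ), ← lintegral_const_mul _ (hpm.mul hg)]
  refine lintegral_congr fun v => ?_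
  have e2 : 1 - (2 * (v - 1 / 2)) ^ 2 = 4 * (v * (1 - v)) := by ring
  have e3 : (1 + 2 * (v - 1 / 2)) / 2 = v := by ring
  rw [e2, e3, kk_mul (by norm_num), kk_beta ha]
  simp only [Pi.mul_apply]
  ring

lemma coord_beta (k : ℕ) : ∀ {b : ℝ}, 0 < b → (betaModel (k + 1) b).map (fun x => (1 + x (Fin.last k)) / 2) = betaMeasure ((b + k) / 2) ((b + k) / 2) := by
  induction k with
  | zero => intro b hb; simpa using coord1 hb
  | succ k ih =>
    intro b hb
    have := ih (b := b + 1) (by linarith)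
    rw [← beta_proj (k + 1) hb, Measure.map_map (by fun_prop) measurable_et] at this
    have e : b + 1 + (k : ℝ) = b + (k + 1 : ℕ) := by push_cast; ring
    rw [e] at this
    rw [← this]
    rfl

lemma coord_su (M : ℕ) (p : E (M + 2)) (hp : ‖p‖ = 1) :
    (sphereUniform (M + 2)).map (fun q => (1 + inner ℝ p q) / 2) = betaMeasure (((M : ℝ) + 1) / 2) (((M : ℝ) + 1) / 2) := by
  have h := coord_beta M one_pos
  rw [← su_et M, Measure.map_map (by fun_prop) measurable_et] at h
  obtain ⟨U, hU⟩ := exists_rot p (EuclideanSpace.single (Fin.last (M + 1)) (1 : ℝ)) (by simp [hp])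
  have hUm : Measurable (fun x : E (M + 2) => U x) := U.continuous.measurable
  rw [← su_rot (M + 2) U, Measure.map_map (by
      exact (by fun_prop : Measurable (fun x : E (M + 1) => (1 + x (Fin.last M)) / 2)).comp measurable_et) hUm, add_comm (1:ℝ)] at h
  rw [← h]
  congr 1
  funext q
  rw [← U.inner_map_map, hU, EuclideanSpace.inner_single_left]
  simp

/-- reduction of two points on the sphere -/
lemma two_point {M : ℕ} {p q : E (M + 2)} (hp : ‖p‖ = 1) (hq : ‖q‖ = 1) :
    ∃ (U : E (M + 2) ≃ₗᵢ[ℝ] E (M + 2)) (s : ℝ) (y : E (M + 1)), 0 ≤ s ∧ U p = ec (-(s / 2)) y ∧ U q = ec (-(s / 2) + s) y ∧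
      ‖y‖ ^ 2 = (1 + inner ℝ p q) / 2 ∧ s = 2 * √(1 - ‖y‖ ^ 2) := by
  obtain ⟨U, hU⟩ := exists_rot (q - p) (ec ‖q - p‖ (0 : E (M + 1))) (norm_ec_zero _ (norm_nonneg _)).symm
  set s := ‖q - p‖ with hs
  have hs0 : 0 ≤ s := norm_nonneg _
  have hUq : U q = U p + ec s 0 := by rw [← hU, map_sub]; abel
  have hss : s ^ 2 = 2 - 2 * inner ℝ p q := by
    rw [hs, norm_sub_sq_real, hp, hq, real_inner_comm]; ring
  have h0 : s * (U p) 0 = - (s ^ 2 / 2) := by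
    have h1 : inner ℝ (U (q - p)) (U p) = inner ℝ (q - p) p := U.inner_map_map _ _
    rw [hU, inner_split, inner_sub_left, real_inner_self_eq_norm_sq, hp, real_inner_comm p q] at h1
    simp at h1
    linarith
  have hpn := norm_sq_ec ((U p) 0) (et (U p))
  rw [ec_et, U.norm_map, hp] at hpn
  rcases hs0.eq_or_lt with hz | hpos
  · have hqp : q = p := by
      have : q - p = 0 := norm_eq_zero.1 (hs ▸ hz.symm)
      exact sub_eq_zero.1 this
    have hy1 : ‖ec 1 (0 : E M)‖ = 1 := norm_ec_zero 1 zero_le_one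
    obtain ⟨W, hW⟩ := exists_rot p (ec 0 (ec 1 (0 : E M))) (by
      have := norm_sq_ec 0 (ec 1 (0 : E M))
      rw [hy1] at this
      rw [hp]
      exact (sq_eq_sq₀ zero_le_one (norm_nonneg _)).1 (by rw [this]; norm_num))
    refine ⟨W, 0, ec 1 0, le_rfl, by simp [hW], by simp [hqp, hW], ?_, ?_⟩
    · rw [hqp, real_inner_self_eq_norm_sq, hp, hy1]; norm_num
    · rw [hy1]; simp
  · have h1 : (U p) 0 = -(s / 2) := by
      have : s * ((U p) 0 + s / 2) = 0 := by linear_combination h0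
      rcases mul_eq_zero.1 this with h | h <;> linarith
    have hy : ‖et (U p)‖ ^ 2 = (1 + inner ℝ p q) / 2 := by
      rw [h1] at hpn; linarith
    refine ⟨U, s, et (U p), hs0, ?_, ?_, hy, ?_⟩
    · rw [← h1, ec_et]
    · rw [hUq]
      conv_lhs => rw [← ec_et (U p), h1, ec_add, add_zero]
    · have : 1 - ‖et (U p)‖ ^ 2 = (s / 2) ^ 2 := by rw [h1] at hpn; linarith
      rw [this, Real.sqrt_sq (by linarith)]; ring

end RS

open scoped ENNReal
namespace RS

variable {D : ∀ {N r : ℕ}, E N → (Fin r → E N) → ℝ}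

lemma D_meas_right (hD : GoodD @D) {N r : ℕ} (p : E N) : Measurable (fun X : Fin r → E N => D p X) :=
  (hD.cont N r).measurable.comp measurable_prodMk_left

lemma D_inv (hD : GoodD @D) {N r : ℕ} {μ : Measure (E N)} [IsProbabilityMeasure μ] (hμ : RotInv μ)
    (F : ℝ → ℝ≥0∞) (hF : Measurable F) {y y' : E N} (h : ‖y‖ = ‖y'‖) :
    ∫⁻ X, F (D y X) ∂(Measure.pi fun _ : Fin r => μ) = ∫⁻ X, F (D y' X) ∂(Measure.pi fun _ : Fin r => μ) := by
  obtain ⟨U, rfl⟩ := exists_rot y y' h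
  have hUm : Measurable (fun x : E N => U x) := U.continuous.measurable
  have hU2 : Measurable (fun (X : Fin r → E N) i => U (X i)) := by fun_prop
  conv_rhs => rw [← pi_rot hμ U]
  refine Eq.trans ?_ (lintegral_map (f := fun X => F (D (U y) X)) (hF.comp (D_meas_right hD (U y))) hU2).symm
  refine lintegral_congr fun X => ?_
  simp only [hD.rot]

lemma D_two (hD : GoodD @D) {M r : ℕ} {σ : Measure (E (M + 2))} [IsProbabilityMeasure σ] (hσ : RotInv σ)
    (hse : σ.map et = betaModel (M + 1) 1)
    (g : ℝ → ℝ≥0∞) (hg : Measurable g) {p q : E (M + 2)} (hp : ‖p‖ = 1) (hq : ‖q‖ = 1) :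
    ∫⁻ X, g (D p (Fin.cons q X : Fin (r + 1) → E (M + 2))) ∂(Measure.pi fun _ : Fin r => σ) =
    ∫⁻ X, g (2 * √(1 - (1 + inner ℝ p q) / 2) * D (ec (√((1 + inner ℝ p q) / 2)) (0 : E M)) X) ∂(Measure.pi fun _ : Fin r => betaModel (M + 1) 1) := by
  have := beta_prob (M + 1) one_pos
  obtain ⟨U, s, y, hs, hUp, hUq, hy, hsy⟩ := two_point hp hq
  have hUm : Measurable (fun x : E (M + 2) => U x) := U.continuous.measurable
  have hU2 : Measurable (fun (X : Fin r → E (M + 2)) i => U (X i)) := by fun_prop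
  have he : Measurable (et (N := M + 1)) := measurable_et
  have he2 : Measurable (fun (X : Fin r → E (M + 2)) i => et (X i)) := by fun_prop
  have hn : ‖ec (√((1 + inner ℝ p q) / 2)) (0 : E M)‖ = ‖y‖ := by
    rw [norm_ec_zero _ (Real.sqrt_nonneg _), ← hy, Real.sqrt_sq (norm_nonneg _)]
  rw [D_inv hD (beta_rot (M + 1) one_pos) (fun d => g (2 * √(1 - (1 + inner ℝ p q) / 2) * d)) (hg.comp (measurable_const_mul _)) hn, ← hy, ← hsy]
  have e1 : ∀ X : Fin r → E (M + 2), D p (Fin.cons q X : Fin (r + 1) → E (M + 2)) = s * D y (fun i => et (U (X i))) := by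
    intro X
    rw [← hD.rot _ _ U, hUp]
    have : (fun i => U ((Fin.cons q X : Fin (r + 1) → E (M + 2)) i)) = (Fin.cons (ec (-(s / 2) + s) y) (fun i => U (X i)) : Fin (r + 1) → E (M + 2)) := by
      funext i
      refine Fin.cases ?_ (fun i => ?_) i
      · simp [hUq]
      · simp
    rw [this, hD.elim _ _ _ _ _ _ hs]
  have hm : Measurable (fun X : Fin r → E (M + 1) => g (s * D y X)) := hg.comp ((D_meas_right hD y).const_mul s)
  have hpr := Measure.isProbabilityMeasure_map (μ := σ) he.aemeasurable
  simp_rw [e1]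
  rw [← hse, ← Measure.pi_map_pi (fun i => he.aemeasurable), lintegral_map hm he2]
  conv_rhs => rw [← pi_rot hσ U]
  exact (lintegral_map (f := fun X : Fin r → E (M + 2) => g (s * D y (fun i => et (X i)))) (hm.comp he2) hU2).symm

lemma D_sph (hD : GoodD @D) {M r : ℕ} {σ : Measure (E (M + 2))} [IsProbabilityMeasure σ] (hσ : RotInv σ)
    (hse : σ.map et = betaModel (M + 1) 1) (hn : ∀ᵐ x ∂σ, ‖x‖ = 1)
    (hc : ∀ p : E (M + 2), ‖p‖ = 1 → σ.map (fun q => (1 + inner ℝ p q) / 2) = betaMeasure (((M : ℝ) + 1) / 2) (((M : ℝ) + 1) / 2)) :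
    (Measure.pi fun _ : Fin (r + 2) => σ).map (fun X => D (X 0) (fun i => X i.succ)) =
      (Q @D (M + 1) r 1 (M + 1) 1).map (fun x => 2 * x) := by
  have hb1 := beta_prob (M + 1) one_pos
  have hM : (0 : ℝ) < (M : ℝ) + 1 := by positivity
  have hb2 := beta_prob (M + 1) hM
  have hDm : Measurable (fun X : Fin (r + 2) → E (M + 2) => D (X 0) (fun i : Fin (r + 1) => X i.succ)) :=
    (hD.cont (M + 2) (r + 1)).measurable.comp (f := fun X : Fin (r + 2) → E (M + 2) => (X 0, fun i : Fin (r + 1) => X i.succ)) (by fun_prop)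
  refine Measure.ext_of_lintegral _ fun g hg => ?_
  set H : ℝ → ℝ≥0∞ := fun v => ∫⁻ X, g (2 * √(1 - v) * D (ec (√v) (0 : E M)) X) ∂(Measure.pi fun _ : Fin r => betaModel (M + 1) 1) with hH
  have hHm : Measurable H := by
    refine Measurable.lintegral_prod_right' (f := fun q : ℝ × (Fin r → E (M + 1)) => g (2 * √(1 - q.1) * D (ec (√q.1) (0 : E M)) q.2)) ?_
    refine hg.comp (Measurable.mul (by fun_prop) ?_)
    refine (hD.cont (M + 1) r).measurable.comp (f := fun q : ℝ × (Fin r → E (M + 1)) => (ec (√q.1) (0 : E M), q.2)) ?_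
    exact Measurable.prodMk (measurable_ec.comp (f := fun q : ℝ × (Fin r → E (M + 1)) => (√q.1, (0 : E M))) (by fun_prop)) measurable_snd
  trans ∫⁻ v, H v ∂(betaMeasure (((M : ℝ) + 1) / 2) (((M : ℝ) + 1) / 2))
  · rw [lintegral_map hg hDm, lint_pi_succ (fun X : Fin (r + 2) → E (M + 2) => g (D (X 0) (fun i : Fin (r + 1) => X i.succ))) (hg.comp hDm)]
    have e : ∀ᵐ p ∂σ, ∫⁻ X, g (D ((Fin.cons p X : Fin (r + 2) → E (M + 2)) 0) (fun i => (Fin.cons p X : Fin (r + 2) → E (M + 2)) i.succ)) ∂(Measure.pi fun _ : Fin (r + 1) => σ)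
        = ∫⁻ v, H v ∂(betaMeasure (((M : ℝ) + 1) / 2) (((M : ℝ) + 1) / 2)) := by
      filter_upwards [hn] with p hp
      simp only [Fin.cons_zero, Fin.cons_succ]
      rw [lint_pi_succ (fun X : Fin (r + 1) → E (M + 2) => g (D p X)) (hg.comp (D_meas_right hD p)), ← hc p hp, lintegral_map hHm (by fun_prop)]
      refine lintegral_congr_ae ?_
      filter_upwards [hn] with q hq
      exact D_two hD hσ hse g hg hp hq
    rw [lintegral_congr_ae e]
    simp
  · have hQm := Q_meas hD (M + 1) r 1
    have h2 : Measurable (fun x : ℝ => 2 * x) := measurable_const_mul 2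
    rw [lintegral_map hg h2, Q, lintegral_map (f := fun x => g (2 * x)) (hg.comp h2) hQm,
      lintegral_prod (fun q : E (M + 1) × (Fin r → E (M + 1)) => g (2 * (√(1 - ‖q.1‖ ^ 2) ^ 1 * D q.1 q.2))) ((hg.comp h2).comp hQm).aemeasurable]
    have hbn := beta_norm_map M hM
    rw [← hbn, lintegral_map hHm (by fun_prop)]
    refine lintegral_congr fun y => ?_
    have hny : ‖ec (√(‖y‖ ^ 2)) (0 : E M)‖ = ‖y‖ := by
      rw [norm_ec_zero _ (Real.sqrt_nonneg _), Real.sqrt_sq (norm_nonneg _)]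
    refine (D_inv hD (beta_rot (M + 1) one_pos) (fun d => g (2 * √(1 - ‖y‖ ^ 2) * d)) (hg.comp (measurable_const_mul _)) hny).trans ?_
    refine lintegral_congr fun X => ?_
    simp only [Function.comp, pow_one]
    rw [mul_assoc]

lemma VP_su (M r : ℕ) : VP (sphereUniform (M + 2)) (r + 1) = (Q @DV (M + 1) r 1 (M + 1) 1).map (fun x => 2 * x) := by
  have := su_prob (M + 1)
  exact D_sph goodDV (su_rot _) (su_et M) (su_norm (M + 1)) (coord_su M)

lemma DL_su (M r : ℕ) : DL (sphereUniform (M + 2)) (r + 2) = (Q @DO (M + 1) r 1 (M + 1) 1).map (fun x => 2 * x) := by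
  have := su_prob (M + 1)
  rw [← D_sph (r := r) goodDO (su_rot _) (su_et M) (su_norm (M + 1)) (coord_su M), DL]
  congr 1
  funext X
  unfold DO
  congr 1
  exact (Fin.cons_self_tail X).symm

lemma DL_su' (M k : ℕ) : DL (sphereUniform (M + 2)) (k + 1) = DL (betaModel (M + 1) 1) k := by
  have := su_prob (M + 1)
  have := beta_prob (M + 1) one_pos
  have := DL_prob (betaModel (M + 1) 1) k
  rw [DL_succ _ (su_rot _), su_et]
  have : (sphereUniform (M + 2)).map (fun x => ‖x‖) = Measure.dirac 1 := by
    rw [Measure.map_congr (g := fun _ => (1:ℝ)) (su_norm (M + 1)), Measure.map_const]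
    simp
  rw [this, Measure.dirac_one_mconv]

end RS

open scoped ENNReal
namespace RS

lemma two_log {P : Measure ℝ} [IsProbabilityMeasure P] (h : Pos P) : Pos (P.map (fun x => 2 * x)) ∧
    ∀ t, charFun ((P.map (fun x => 2 * x)).map Real.log) t = charFun (P.map Real.log) t * Complex.exp (((inner ℝ (Real.log 2) t : ℝ) : ℂ) * Complex.I) := by
  refine ⟨Pos.of_ae ((ae_map_iff (by fun_prop) measurableSet_Ioi).2 ?_), fun t => ?_⟩
  · filter_upwards [h.ae] with x hx
    have : 0 < 2 * x := by linarith
    exact this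
  · rw [← charFun_map_add_const, Measure.map_map (by fun_prop) (by fun_prop), Measure.map_map (by fun_prop) (by fun_prop)]
    congr 1
    refine Measure.map_congr ?_
    filter_upwards [h.ae] with x hx
    simp only [Function.comp]
    rw [Real.log_mul two_ne_zero hx.ne', add_comm]

lemma two_pos_inv {P : Measure ℝ} (h : Pos (P.map (fun x => 2 * x))) : Pos P := by
  have := h.ae
  rw [ae_map_iff (by fun_prop) measurableSet_Ioi] at this
  refine Pos.of_ae ?_
  filter_upwards [this] with x hx
  linarith

lemma S_sphere (M k : ℕ) (hk : k ≤ M) :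
    IsProbabilityMeasure ((DL (sphereUniform (M + 2)) (k + 2)).map Real.log) ∧
    Near ((DL (sphereUniform (M + 2)) (k + 2)).map Real.log) (var ((DL (sphereUniform (M + 2)) (k + 2)).map Real.log) / (2 * (((M + 2 : ℕ) : ℝ) - (k + 1 : ℕ)))) ∧
    var ((DL (sphereUniform (M + 2)) (k + 2)).map Real.log) = s2 0 (M + 2) (k + 1) ∧
    ∀ t, charFun ((DL (sphereUniform (M + 2)) (k + 2)).map Real.log) t =
      charFun (QL @DO (M + 1) k 1 (M + 1) 1) t * Complex.exp (((inner ℝ (Real.log 2) t : ℝ) : ℂ) * Complex.I) := by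
  have hM : (0 : ℝ) < (M : ℝ) + 1 := by positivity
  have hkM : (k : ℝ) ≤ M := by exact_mod_cast hk
  obtain ⟨hp, hc⟩ := DL_beta (k + 1) (M + 1 - (k + 1)) one_pos
  rw [Nat.sub_add_cancel (by lia : k + 1 ≤ M + 1), ← DL_su' M (k + 1)] at hp hc
  have hQ := Q_prob goodDO (M + 1) k 1 hM one_pos
  have hchar : ∀ t, charFun ((DL (sphereUniform (M + 2)) (k + 2)).map Real.log) t =
      charFun (QL @DO (M + 1) k 1 (M + 1) 1) t * Complex.exp (((inner ℝ (Real.log 2) t : ℝ) : ℂ) * Complex.I) := by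
    rw [DL_su] at hp ⊢
    exact (two_log (two_pos_inv hp)).2
  have := su_prob (M + 1)
  have := DL_prob (sphereUniform (M + 2)) (k + 2)
  have i : IsProbabilityMeasure ((DL (sphereUniform (M + 2)) (k + 2)).map Real.log) := Measure.isProbabilityMeasure_map (by fun_prop)
  have hN := S_near (S := (DL (sphereUniform (M + 2)) (k + 2)).map Real.log) (k := k + 1)
    (A := fun j => ((M : ℝ) + 1 - j) / 2) (B := fun j => (1 + (j : ℝ)) / 2) (m := ((M + 2 : ℕ) : ℝ) - (k + 1 : ℕ))
    (by push_cast; linarith) (by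
      intro j hj
      have : (j : ℝ) ≤ k := by exact_mod_cast (by lia : j ≤ k)
      push_cast; linarith) (fun j hj => by positivity) (fun t => (hc t).trans (by
      refine prod_congr rfl fun j _ => ?_
      rw [Nat.cast_sub (by lia : k + 1 ≤ M + 1)]
      congr 2
      push_cast
      ring))
  refine ⟨i, hN.1, ?_, hchar⟩
  rw [hN.2, s2_eq, sum_range_succ' _ (k + 1)]
  have e : (psi1 ((((M + 2 : ℕ) : ℝ) - (0 : ℕ)) / 2) - psi1 ((((M + 2 : ℕ) : ℝ) - (0 : ℕ)) / 2 + (0 + ((0 : ℕ) : ℝ)) / 2)) / 4 = 0 := by simp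
  rw [e, add_zero]
  refine sum_congr rfl fun j _ => ?_
  have e1 : (((M + 2 : ℕ) : ℝ) - (j + 1 : ℕ)) / 2 = ((M : ℝ) + 1 - j) / 2 := by push_cast; ring
  have e2 : (0 + ((j + 1 : ℕ) : ℝ)) / 2 = (1 + (j : ℝ)) / 2 := by push_cast; ring
  rw [e1, e2]

lemma sphere_good {ε : ℝ} (hε : 0 < ε) : ∃ n0 : ℕ, ∀ n r : ℕ, n0 ≤ n → 1 ≤ r → r ≤ n →
    Pos (VP (sphereUniform n) r) ∧ Good ((VP (sphereUniform n) r).map Real.log) ε := by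
  obtain ⟨K, hK⟩ := QL11_stats
  obtain ⟨n0, h0⟩ := core_good le_rfl (max K 0) (le_max_right _ _) hε
  refine ⟨max n0 3, fun n r hn hr1 hr => ?_⟩
  have hn0 : n0 ≤ n := (le_max_left _ _).trans hn
  have hn3 : 3 ≤ n := (le_max_right _ _).trans hn
  obtain ⟨M, rfl⟩ : ∃ M, n = M + 2 := ⟨n - 2, by lia⟩
  obtain ⟨k, rfl⟩ : ∃ k, r = k + 1 := ⟨r - 1, by lia⟩
  have hM : (0 : ℝ) < (M : ℝ) + 1 := by positivity
  have hM1 : (1 : ℝ) ≤ M := by exact_mod_cast (by lia : 1 ≤ M)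
  rw [VP_su M k]
  have hpos : Pos (Q @DV (M + 1) k 1 (M + 1) 1) := by
    have := QV_pos (M + 1 - k) k 1 hM one_pos
    rwa [Nat.sub_add_cancel (by lia : k ≤ M + 1)] at this
  have hQ := Q_prob goodDV (M + 1) k 1 hM one_pos
  obtain ⟨hp, hchar⟩ := two_log hpos
  refine ⟨hp, ?_⟩
  rcases (by lia : k = M + 1 ∨ k ≤ M) with rfl | hk
  · obtain ⟨i, h1, h2, h3⟩ := S_sphere M M le_rfl
    have ha' : aa 0 (M + 2 : ℕ) (M + 1 : ℕ) = ((M : ℝ) + 1) + M * (1 + (0 + 1 : ℕ) + M - 1) := by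
      unfold aa
      push_cast; ring
    have hb : (2:ℝ) ≤ 1 + M := by linarith
    have hba : 1 + (M : ℝ) ≤ aa 0 (M + 2 : ℕ) (M + 1 : ℕ) := by
      rw [ha']; push_cast; nlinarith
    have hs := hK (aa 0 (M + 2 : ℕ) (M + 1 : ℕ)) (1 + M) (1 + M) hb hba
    have hap : 0 < aa 0 (M + 2 : ℕ) (M + 1 : ℕ) := by linarith
    have hq : (((M + 2 : ℕ) : ℝ) - (M + 1 : ℕ)) / 2 = 1 / 2 := by push_cast; ring
    refine (h0 (M + 2) (M + 1) hn0 (by lia) (by lia) _ _ h1 h2).2 (by lia)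
      (QL @DV 1 1 (1 + M) (aa 0 (M + 2 : ℕ) (M + 1 : ℕ)) (1 + M)) (QL_prob goodDV _ _ _ hap (by linarith)) hs.1 ?_ fun t => ?_
    · refine hs.2.trans ?_
      rw [hq, add_comm 1 M]
      have := le_max_left K 0
      linarith
    · have h := comb2 M 1 hM one_pos t
      rw [← ha', add_comm 1 M] at h
      rw [hq, hchar, h3, add_comm 1 M]
      unfold QL at h ⊢
      linear_combination (Complex.exp (((inner ℝ (Real.log 2) t : ℝ) : ℂ) * Complex.I)) * h
  · obtain ⟨i, h1, h2, h3⟩ := S_sphere M k hk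
    refine (h0 (M + 2) (k + 1) hn0 (by lia) (by lia) _ _ h1 h2).1 fun t => ?_
    have h := comb1 (M - k) k 1 hM one_pos t
    have e1 : M - k + 1 + k = M + 1 := by lia
    have e2 : ((M - k : ℕ) : ℝ) + 1 = ((M + 2 : ℕ) : ℝ) - (k + 1 : ℕ) := by
      rw [Nat.cast_sub hk]; push_cast; ring
    have e3 : (M : ℝ) + 1 + k * (1 + ((M - k + 1 : ℕ) : ℝ) + k - 1) = aa 0 (M + 2 : ℕ) (k + 1 : ℕ) := by
      unfold aa
      push_cast
      rw [Nat.cast_sub hk]; ring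
    rw [e1, e2, e3, add_comm 1 k] at h
    rw [hchar, h3]
    unfold QL at h ⊢
    linear_combination (Complex.exp (((inner ℝ (Real.log 2) t : ℝ) : ℂ) * Complex.I)) * h

end RS

theorem stmt15 (r : ℕ → ℕ) (hr : ∀ n, 1 ≤ n → 1 ≤ r n ∧ r n ≤ n)
    (μ : (n : ℕ) → Measure (EuclideanSpace ℝ (Fin n)))
    (hμ : (∀ n, μ n = stdGaussian n)
      ∨ (∃ ν : ℝ, 0 < ν ∧ ∀ n, μ n = betaModel n ν)
      ∨ (∀ n, μ n = sphereUniform n)) :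
    ∀ f : BoundedContinuousFunction ℝ ℝ,
      Tendsto
        (fun n : ℕ =>
          ∫ X, f ((Lnr n (r n) X
              - ∫ Y, Lnr n (r n) Y ∂(Measure.pi fun _ : Fin (r n + 1) => μ n))
            / Real.sqrt (variance (Lnr n (r n)) (Measure.pi fun _ : Fin (r n + 1) => μ n)))
            ∂(Measure.pi fun _ : Fin (r n + 1) => μ n))
        atTop (nhds (∫ z, f z ∂gaussianReal 0 1)) := by
  intro f
  refine RS.transfer r μ (fun ε hε => ?_) f
  rcases hμ with h | ⟨ν, hν, h⟩ | h
  · obtain ⟨n0, hn⟩ := RS.gauss_good hε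
    filter_upwards [eventually_ge_atTop (max n0 1)] with n hn1
    obtain ⟨hr1, hr2⟩ := hr n ((le_max_right _ _).trans hn1)
    rw [h n]
    exact ⟨RS.sG_prob n, hn n (r n) ((le_max_left _ _).trans hn1) hr1 hr2⟩
  · obtain ⟨n0, hn⟩ := RS.beta_good hν hε
    filter_upwards [eventually_ge_atTop (max n0 1)] with n hn1
    obtain ⟨hr1, hr2⟩ := hr n ((le_max_right _ _).trans hn1)
    rw [h n]
    exact ⟨RS.beta_prob n hν, hn n (r n) ((le_max_left _ _).trans hn1) hr1 hr2⟩
  · obtain ⟨n0, hn⟩ := RS.sphere_good hε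
    filter_upwards [eventually_ge_atTop (max n0 1)] with n hn1
    obtain ⟨hr1, hr2⟩ := hr n ((le_max_right _ _).trans hn1)
    rw [h n]
    refine ⟨?_, hn n (r n) ((le_max_left _ _).trans hn1) hr1 hr2⟩
    have h1 : 1 ≤ n := (le_max_right _ _).trans hn1
    obtain ⟨m, rfl⟩ : ∃ m, n = m + 1 := ⟨n - 1, by lia⟩
    exact RS.su_prob m
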